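/- arXiv:1609.06675 — 3 statements merged into one kernel-verified Lean document; each statement's English description precedes it below -/
import Mathlib

section
/- Let F: ℝᵖ → [0,+∞] be a proper convex function (convex, nonnegative, and finite at some point), and let 𝕏 ∈ ℝ^{n×p}. For each y ∈ ℝⁿ, let β̂(y) be any solution of the convex minimization problem min_{β∈ℝᵖ} ( ‖y − 𝕏β‖² + 2F(β) ). Then the map μ̂(y) = 𝕏β̂(y) is 1-Lipschitz: ‖μ̂(y) − μ̂(y′)‖ ≤ ‖y − y′‖ for all y, y′ ∈ ℝⁿ. -/
open MeasureTheory
open scoped ENNReal NNReal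

/-- The scaled Euclidean norm `‖u‖ = sqrt((1/n) ∑ u_i²)` on `ℝⁿ`. -/
noncomputable def scaledNorm {n : ℕ} (u : Fin n → ℝ) : ℝ :=
  Real.sqrt ((∑ i, u i ^ 2) / n)

theorem scaledNorm_nonneg {n : ℕ} (u : Fin n → ℝ) : 0 ≤ scaledNorm u :=
  Real.sqrt_nonneg _

/-- The inner product inducing `scaledNorm`. -/
noncomputable def scaledInner {n : ℕ} (u v : Fin n → ℝ) : ℝ :=
  (∑ i, u i * v i) / n

theorem scaledNorm_sq {n : ℕ} (u : Fin n → ℝ) : scaledNorm u ^ 2 = scaledInner u u := by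
  rw [scaledNorm, Real.sq_sqrt (by positivity)]
  simp only [scaledInner, pow_two]

theorem scaledInner_comm {n : ℕ} (u v : Fin n → ℝ) : scaledInner u v = scaledInner v u := by
  simp only [scaledInner, mul_comm]

theorem scaledInner_sub_left {n : ℕ} (u v w : Fin n → ℝ) :
    scaledInner (u - v) w = scaledInner u w - scaledInner v w := by
  simp only [scaledInner, Pi.sub_apply, sub_mul, Finset.sum_sub_distrib, sub_div]

theorem scaledInner_sub_right {n : ℕ} (u v w : Fin n → ℝ) :
    scaledInner u (v - w) = scaledInner u v - scaledInner u w := by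
  simp only [scaledInner_comm u, scaledInner_sub_left]

theorem scaledInner_smul_left {n : ℕ} (t : ℝ) (u v : Fin n → ℝ) :
    scaledInner (t • u) v = t * scaledInner u v := by
  simp only [scaledInner, Pi.smul_apply, smul_eq_mul, mul_assoc, ← Finset.mul_sum, mul_div_assoc]

theorem scaledInner_smul_right {n : ℕ} (t : ℝ) (u v : Fin n → ℝ) :
    scaledInner u (t • v) = t * scaledInner u v := by
  simp only [scaledInner_comm u, scaledInner_smul_left]

theorem scaledNorm_sub_smul_sq {n : ℕ} (r d : Fin n → ℝ) (t : ℝ) :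
    scaledNorm (r - t • d) ^ 2
      = scaledNorm r ^ 2 - 2 * t * scaledInner r d + t ^ 2 * scaledNorm d ^ 2 := by
  simp only [scaledNorm_sq, scaledInner_sub_left, scaledInner_sub_right, scaledInner_smul_left,
    scaledInner_smul_right, scaledInner_comm d r]
  ring

theorem nonpos_of_forall_le_mul {c D : ℝ} (hD : 0 ≤ D)
    (h : ∀ t : ℝ, 0 < t → t ≤ 1 → c ≤ t * D) : c ≤ 0 := by
  by_contra! hc
  have hcD : 0 < c + D := by linarith
  have key := h (c / (c + D)) (by positivity) ((div_le_one hcD).2 (by linarith))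
  rw [div_mul_eq_mul_div, le_div_iff₀ hcD] at key
  nlinarith

/-- A minimizer of a penalized least squares criterion has finite penalty. -/
theorem penalty_ne_top_of_isMin {n p : ℕ} {F : (Fin p → ℝ) → ℝ≥0∞} (hFproper : ∃ b, F b ≠ ⊤)
    {X : Matrix (Fin n) (Fin p) ℝ} {y : Fin n → ℝ} {a : Fin p → ℝ}
    (hmin : ∀ b : Fin p → ℝ,
      ENNReal.ofReal (scaledNorm (y - X.mulVec a) ^ 2) + 2 * F a
        ≤ ENNReal.ofReal (scaledNorm (y - X.mulVec b) ^ 2) + 2 * F b) :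
    F a ≠ ⊤ := by
  obtain ⟨b, hb⟩ := hFproper
  intro ha
  have h := hmin b
  rw [ha, ENNReal.mul_top two_ne_zero, add_top, top_le_iff] at h
  exact ENNReal.add_ne_top.2
    ⟨ENNReal.ofReal_ne_top, ENNReal.mul_ne_top ENNReal.ofNat_ne_top hb⟩ h

/-- The first-order optimality condition: the residual at a minimizer of the penalized least
squares criterion is a subgradient of the penalty along the range of `X`. -/
theorem scaledInner_residual_le {n p : ℕ} {F : (Fin p → ℝ) → ℝ≥0∞}
    (hFconv : ∀ (a b : Fin p → ℝ) (s : ℝ), 0 ≤ s → s ≤ 1 →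
      F (s • a + (1 - s) • b) ≤ ENNReal.ofReal s * F a + ENNReal.ofReal (1 - s) * F b)
    {X : Matrix (Fin n) (Fin p) ℝ} {y : Fin n → ℝ} {a b : Fin p → ℝ}
    (ha : F a ≠ ⊤) (hb : F b ≠ ⊤)
    (hmin : ∀ b : Fin p → ℝ,
      ENNReal.ofReal (scaledNorm (y - X.mulVec a) ^ 2) + 2 * F a
        ≤ ENNReal.ofReal (scaledNorm (y - X.mulVec b) ^ 2) + 2 * F b) :
    scaledInner (y - X.mulVec a) (X.mulVec b - X.mulVec a) ≤ (F b).toReal - (F a).toReal := by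
  set r := y - X.mulVec a with hr
  set d := X.mulVec b - X.mulVec a with hd
  refine sub_nonpos.1 (nonpos_of_forall_le_mul (D := scaledNorm d ^ 2) (sq_nonneg _) ?_)
  intro t ht ht1
  have hres : y - X.mulVec (t • b + (1 - t) • a) = r - t • d := by
    rw [Matrix.mulVec_add, Matrix.mulVec_smul, Matrix.mulVec_smul, hr, hd]
    module
  have hmin_t := (hmin (t • b + (1 - t) • a)).trans
    (add_le_add_right (mul_le_mul_right (hFconv b a t ht.le ht1) 2) _)
  lift F a to ℝ≥0 using ha with f
  lift F b to ℝ≥0 using hb with g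
  rw [hres] at hmin_t
  have h := ENNReal.toReal_mono (by finiteness) hmin_t
  rw [ENNReal.toReal_add (by finiteness) (by finiteness),
    ENNReal.toReal_add (by finiteness) (by finiteness), ENNReal.toReal_mul, ENNReal.toReal_mul,
    ENNReal.toReal_add (by finiteness) (by finiteness), ENNReal.toReal_mul, ENNReal.toReal_mul,
    ENNReal.toReal_ofReal (sq_nonneg _), ENNReal.toReal_ofReal (sq_nonneg _),
    ENNReal.toReal_ofReal ht.le, ENNReal.toReal_ofReal (sub_nonneg.2 ht1),
    scaledNorm_sub_smul_sq, ENNReal.toReal_ofNat] at h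
  have hD : 0 ≤ t * scaledNorm d ^ 2 := by positivity
  refine le_of_mul_le_mul_left ?_ ht
  nlinarith

theorem stmt3 (n p : ℕ) (hn : 0 < n)
    (F : (Fin p → ℝ) → ℝ≥0∞)
    -- `F` is convex (with values in `[0,+∞]`)
    (hFconv : ∀ (a b : Fin p → ℝ) (s : ℝ), 0 ≤ s → s ≤ 1 →
      F (s • a + (1 - s) • b) ≤ ENNReal.ofReal s * F a + ENNReal.ofReal (1 - s) * F b)
    -- `F` is proper: finite at some point
    (hFproper : ∃ b, F b ≠ ⊤)
    (X : Matrix (Fin n) (Fin p) ℝ)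
    (βhat : (Fin n → ℝ) → (Fin p → ℝ))
    (hmin : ∀ (y : Fin n → ℝ) (b : Fin p → ℝ),
      ENNReal.ofReal (scaledNorm (y - X.mulVec (βhat y)) ^ 2) + 2 * F (βhat y)
        ≤ ENNReal.ofReal (scaledNorm (y - X.mulVec b) ^ 2) + 2 * F b) :
    ∀ y y' : Fin n → ℝ,
      scaledNorm (X.mulVec (βhat y) - X.mulVec (βhat y')) ≤ scaledNorm (y - y') := by
  intro y y'
  have ha := penalty_ne_top_of_isMin hFproper (hmin y)
  have hb := penalty_ne_top_of_isMin hFproper (hmin y')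
  have h₁ := scaledInner_residual_le hFconv ha hb (hmin y)
  have h₂ := scaledInner_residual_le hFconv hb ha (hmin y')
  have h₃ := sq_nonneg
    (scaledNorm (y - y' - (X.mulVec (βhat y) - X.mulVec (βhat y'))))
  refine (sq_le_sq₀ (scaledNorm_nonneg _) (scaledNorm_nonneg _)).1 ?_
  generalize X.mulVec (βhat y) = u at *
  generalize X.mulVec (βhat y') = v at *
  simp only [scaledNorm_sq, scaledInner_sub_left, scaledInner_sub_right] at h₁ h₂ h₃ ⊢
  linarith [scaledInner_comm u v, scaledInner_comm u y, scaledInner_comm v y,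
    scaledInner_comm u y', scaledInner_comm v y', scaledInner_comm y y']
end

section
/- Let f ∈ ℝⁿ, ξ ∼ N(0, σ²I_{n×n}), y = f + ξ, let F: ℝᵖ → [0,+∞] be a proper convex function, 𝕏 ∈ ℝ^{n×p}, and let β̂(y) be any solution of min_{β∈ℝᵖ}( ‖y − 𝕏β‖² + 2F(β) ). Suppose there is a constant R ≥ 0 such that P( ‖𝕏β̂(y) − f‖ ≤ R ) ≥ 1/2. Then for all t > 0, P( ‖𝕏β̂(y) − f‖ ≤ R + σt/√n ) ≥ Φ(t), and consequently for all x > 0, P( ‖𝕏β̂(y) − f‖ ≤ R + σ√(2x/n) ) ≥ 1 − e^{−x}. -/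
open MeasureTheory ProbabilityTheory
open scoped ENNReal NNReal

/-- The standard normal cumulative distribution function `Φ`. -/
noncomputable def stdPhi (t : ℝ) : ℝ :=
  (gaussianReal 0 1 (Set.Iic t)).toReal

/-- The Gaussian measure `N(0, σ²I_{n×n})` on `ℝⁿ` (i.i.d. `N(0,σ²)` components). -/
noncomputable def gaussianVec (n : ℕ) (σ : ℝ) : Measure (Fin n → ℝ) :=
  Measure.pi fun _ : Fin n => gaussianReal 0 ⟨σ ^ 2, sq_nonneg σ⟩

section

open Filter Topology Set

/-! ### The standard normal distribution function and the Gaussian isoperimetric profile -/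

lemma gaussianPDFReal_std (t : ℝ) :
    gaussianPDFReal 0 1 t = (√(2 * Real.pi))⁻¹ * Real.exp (-(t ^ 2 / 2)) := by
  simp [gaussianPDFReal, neg_div]

lemma gaussianPDFReal_std_pos (t : ℝ) : 0 < gaussianPDFReal 0 1 t :=
  gaussianPDFReal_pos 0 1 t one_ne_zero

lemma gaussianPDFReal_std_neg (t : ℝ) : gaussianPDFReal 0 1 (-t) = gaussianPDFReal 0 1 t := by
  simp [gaussianPDFReal_std]

lemma hasDerivAt_gaussianPDFReal_std (t : ℝ) :
    HasDerivAt (gaussianPDFReal 0 1) (-t * gaussianPDFReal 0 1 t) t := by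
  have h : HasDerivAt (fun t : ℝ => (√(2 * Real.pi))⁻¹ * Real.exp (-(t ^ 2 / 2)))
      ((√(2 * Real.pi))⁻¹ * (Real.exp (-(t ^ 2 / 2)) * (-(((2 : ℕ) * t ^ (2 - 1) * 1) / 2)))) t :=
    ((((hasDerivAt_id t).pow 2).div_const 2).neg.exp).const_mul _
  rw [show gaussianPDFReal 0 1 = fun t : ℝ => (√(2 * Real.pi))⁻¹ * Real.exp (-(t ^ 2 / 2)) from
    funext gaussianPDFReal_std]
  convert h using 1
  push_cast
  ring

lemma continuous_gaussianPDFReal_std : Continuous (gaussianPDFReal 0 1) :=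
  continuous_iff_continuousAt.2 fun t => (hasDerivAt_gaussianPDFReal_std t).continuousAt

lemma gaussianPDFReal_std_le_one (t : ℝ) : gaussianPDFReal 0 1 t ≤ 1 := by
  rw [gaussianPDFReal_std]
  refine mul_le_one₀ (inv_le_one_of_one_le₀ ?_) (Real.exp_pos _).le ?_
  · rw [Real.one_le_sqrt]
    linarith [Real.two_le_pi]
  · rw [Real.exp_le_one_iff]
    nlinarith [sq_nonneg t]

lemma abs_mul_gaussianPDFReal_std_le_one (t : ℝ) : |(-t) * gaussianPDFReal 0 1 t| ≤ 1 := by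
  have h1 : |t| ≤ Real.exp (t ^ 2 / 2) := by
    have := Real.add_one_le_exp (t ^ 2 / 2)
    nlinarith [sq_nonneg (|t| - 1), sq_abs t]
  have h2 : (√(2 * Real.pi))⁻¹ ≤ 1 := by
    refine inv_le_one_of_one_le₀ ?_
    rw [Real.one_le_sqrt]
    linarith [Real.two_le_pi]
  rw [abs_mul, abs_neg, abs_of_pos (gaussianPDFReal_std_pos t), gaussianPDFReal_std, Real.exp_neg]
  have h3 := Real.exp_pos (t ^ 2 / 2)
  have h4 : |t| * (Real.exp (t ^ 2 / 2))⁻¹ ≤ 1 := by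
    rw [← div_eq_mul_inv, div_le_one h3]
    exact h1
  calc |t| * ((√(2 * Real.pi))⁻¹ * (Real.exp (t ^ 2 / 2))⁻¹)
      = (√(2 * Real.pi))⁻¹ * (|t| * (Real.exp (t ^ 2 / 2))⁻¹) := by ring
    _ ≤ 1 := mul_le_one₀ h2 (by positivity) h4

lemma gaussianPDFReal_std_le_of_sq_le {s t : ℝ} (h : s ^ 2 ≤ t ^ 2) :
    gaussianPDFReal 0 1 t ≤ gaussianPDFReal 0 1 s := by
  simp only [gaussianPDFReal_std]
  gcongr

lemma monotone_div_gaussianPDFReal_std : Monotone fun t : ℝ => t / gaussianPDFReal 0 1 t := by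
  have hd (t : ℝ) : HasDerivAt (fun t : ℝ => t / gaussianPDFReal 0 1 t)
      ((1 + t ^ 2) / gaussianPDFReal 0 1 t) t := by
    have hp := (gaussianPDFReal_std_pos t).ne'
    have h := (hasDerivAt_id t).fun_div (hasDerivAt_gaussianPDFReal_std t) hp
    refine h.congr_deriv ?_
    simp only [id]
    field_simp
    ring
  exact monotone_of_hasDerivAt_nonneg hd fun t =>
    div_nonneg (by positivity) (gaussianPDFReal_std_pos t).le

lemma stdPhi_eq_cdf (t : ℝ) : stdPhi t = cdf (gaussianReal 0 1) t := by
  rw [cdf_eq_real]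
  rfl

lemma hasDerivAt_stdPhi (t : ℝ) : HasDerivAt stdPhi (gaussianPDFReal 0 1 t) t := by
  have hint (a : ℝ) : IntegrableOn (gaussianPDFReal 0 1) (Iic a) :=
    (integrable_gaussianPDFReal 0 1).integrableOn
  have h (t : ℝ) : stdPhi t = (∫ x in Iic (0 : ℝ), gaussianPDFReal 0 1 x)
      + ∫ x in (0 : ℝ)..t, gaussianPDFReal 0 1 x := by
    rw [← intervalIntegral.integral_Iic_sub_Iic (hint 0) (hint t), stdPhi,
      gaussianReal_apply_eq_integral 0 one_ne_zero,
      ENNReal.toReal_ofReal (integral_nonneg fun x => gaussianPDFReal_nonneg 0 1 x)]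
    ring
  rw [show stdPhi = fun t => _ from funext h]
  exact (intervalIntegral.integral_hasDerivAt_right
    ((integrable_gaussianPDFReal 0 1).intervalIntegrable)
    (stronglyMeasurable_gaussianPDFReal 0 1).stronglyMeasurableAtFilter
    continuous_gaussianPDFReal_std.continuousAt).const_add _

lemma strictMono_stdPhi : StrictMono stdPhi :=
  strictMono_of_hasDerivAt_pos hasDerivAt_stdPhi gaussianPDFReal_std_pos

lemma continuous_stdPhi : Continuous stdPhi :=
  continuous_iff_continuousAt.2 fun t => (hasDerivAt_stdPhi t).continuousAt

lemma tendsto_stdPhi_atTop : Tendsto stdPhi atTop (𝓝 1) := by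
  rw [show stdPhi = _ from funext stdPhi_eq_cdf]
  exact tendsto_cdf_atTop _

lemma tendsto_stdPhi_atBot : Tendsto stdPhi atBot (𝓝 0) := by
  rw [show stdPhi = _ from funext stdPhi_eq_cdf]
  exact tendsto_cdf_atBot _

lemma stdPhi_mem_Ioo (t : ℝ) : stdPhi t ∈ Ioo (0 : ℝ) 1 := by
  have h0 (s : ℝ) : 0 ≤ stdPhi s := ENNReal.toReal_nonneg
  have h1 (s : ℝ) : stdPhi s ≤ 1 := by
    rw [stdPhi_eq_cdf]
    exact cdf_le_one _ _
  exact ⟨(h0 (t - 1)).trans_lt (strictMono_stdPhi (by linarith)),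
    (strictMono_stdPhi (by linarith : t < t + 1)).trans_le (h1 _)⟩

lemma range_stdPhi : range stdPhi = Ioo (0 : ℝ) 1 := by
  refine subset_antisymm (range_subset_iff.2 stdPhi_mem_Ioo) fun p hp => ?_
  obtain ⟨a, ha⟩ := (tendsto_stdPhi_atBot.eventually_lt_const hp.1).exists
  obtain ⟨b, hb⟩ := (tendsto_stdPhi_atTop.eventually_const_lt hp.2).exists
  exact mem_range_of_exists_le_of_exists_ge continuous_stdPhi ⟨a, ha.le⟩ ⟨b, hb.le⟩

lemma isOpenEmbedding_stdPhi : IsOpenEmbedding stdPhi :=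
  ⟨strictMono_stdPhi.isEmbedding_of_ordConnected (range_stdPhi ▸ ordConnected_Ioo),
    range_stdPhi ▸ isOpen_Ioo⟩

lemma stdPhi_neg (t : ℝ) : stdPhi (-t) = 1 - stdPhi t := by
  have hd (t : ℝ) : HasDerivAt (fun t => stdPhi (-t) + stdPhi t) 0 t := by
    have h1 := (hasDerivAt_stdPhi (-t)).comp t (hasDerivAt_neg t)
    refine (h1.add (hasDerivAt_stdPhi t)).congr_deriv ?_
    rw [gaussianPDFReal_std_neg]
    ring
  have hc : ∀ x y : ℝ, stdPhi (-x) + stdPhi x = stdPhi (-y) + stdPhi y :=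
    is_const_of_deriv_eq_zero (fun t => (hd t).differentiableAt) fun t => (hd t).deriv
  have hl : Tendsto (fun x => stdPhi (-x) + stdPhi x) atTop (𝓝 (0 + 1)) :=
    (tendsto_stdPhi_atBot.comp tendsto_neg_atTop_atBot).add tendsto_stdPhi_atTop
  have hl' : Tendsto (fun x => stdPhi (-x) + stdPhi x) atTop (𝓝 (stdPhi (-t) + stdPhi t)) :=
    tendsto_const_nhds.congr fun x => hc t x
  linarith [tendsto_nhds_unique hl hl']

lemma stdPhi_zero : stdPhi 0 = 1 / 2 := by
  have := stdPhi_neg 0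
  rw [neg_zero] at this
  linarith

/-- The standard normal quantile function, the inverse of `Φ` on `(0,1)`. -/
noncomputable def stdQuantile : ℝ → ℝ :=
  (isOpenEmbedding_stdPhi.toOpenPartialHomeomorph stdPhi).symm

lemma stdPhi_stdQuantile {p : ℝ} (hp : p ∈ Ioo (0 : ℝ) 1) : stdPhi (stdQuantile p) = p :=
  (isOpenEmbedding_stdPhi.toOpenPartialHomeomorph stdPhi).right_inv
    (by simpa [range_stdPhi] using hp)

lemma stdQuantile_stdPhi (t : ℝ) : stdQuantile (stdPhi t) = t :=
  strictMono_stdPhi.injective (stdPhi_stdQuantile (stdPhi_mem_Ioo t))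

lemma hasDerivAt_stdQuantile {p : ℝ} (hp : p ∈ Ioo (0 : ℝ) 1) :
    HasDerivAt stdQuantile (gaussianPDFReal 0 1 (stdQuantile p))⁻¹ p :=
  (isOpenEmbedding_stdPhi.toOpenPartialHomeomorph stdPhi).hasDerivAt_symm
    (by simpa [range_stdPhi] using hp) (gaussianPDFReal_std_pos _).ne'
    (hasDerivAt_stdPhi _)

lemma stdQuantile_le_stdQuantile {p q : ℝ} (hp : p ∈ Ioo (0 : ℝ) 1) (hq : q ∈ Ioo (0 : ℝ) 1)
    (h : p ≤ q) : stdQuantile p ≤ stdQuantile q := by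
  rwa [← strictMono_stdPhi.le_iff_le, stdPhi_stdQuantile hp, stdPhi_stdQuantile hq]

lemma stdQuantile_one_sub {p : ℝ} (hp : p ∈ Ioo (0 : ℝ) 1) :
    stdQuantile (1 - p) = -stdQuantile p := by
  apply strictMono_stdPhi.injective
  rw [stdPhi_neg, stdPhi_stdQuantile hp,
    stdPhi_stdQuantile ⟨by linarith [hp.2], by linarith [hp.1]⟩]

/-- The Gaussian isoperimetric profile `φ ∘ Φ⁻¹` on `(0,1)`. -/
noncomputable def gaussProfile (p : ℝ) : ℝ := gaussianPDFReal 0 1 (stdQuantile p)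

lemma gaussProfile_pos (p : ℝ) : 0 < gaussProfile p := gaussianPDFReal_std_pos _

lemma gaussProfile_stdPhi (t : ℝ) : gaussProfile (stdPhi t) = gaussianPDFReal 0 1 t := by
  rw [gaussProfile, stdQuantile_stdPhi]

lemma hasDerivAt_gaussProfile {p : ℝ} (hp : p ∈ Ioo (0 : ℝ) 1) :
    HasDerivAt gaussProfile (-stdQuantile p) p := by
  refine ((hasDerivAt_gaussianPDFReal_std (stdQuantile p)).comp p
    (hasDerivAt_stdQuantile hp)).congr_deriv ?_
  rw [mul_assoc, mul_inv_cancel₀ (gaussianPDFReal_std_pos _).ne', mul_one]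

lemma gaussProfile_one_sub {p : ℝ} (hp : p ∈ Ioo (0 : ℝ) 1) :
    gaussProfile (1 - p) = gaussProfile p := by
  rw [gaussProfile, stdQuantile_one_sub hp, gaussianPDFReal_std_neg, gaussProfile]

/-! ### Bobkov's two-point inequality -/

lemma nonneg_of_hasDerivAt_nonneg {g g' : ℝ → ℝ} {r : ℝ} (h0 : 0 ≤ g 0)
    (hd : ∀ x ∈ Icc 0 r, HasDerivAt g (g' x) x) (hg' : ∀ x ∈ Icc 0 r, 0 ≤ g' x) :
    ∀ x ∈ Icc 0 r, 0 ≤ g x := by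
  intro x hx
  have hmono : MonotoneOn g (Icc 0 r) := by
    refine monotoneOn_of_deriv_nonneg (convex_Icc 0 r)
      (fun y hy => (hd y hy).continuousAt.continuousWithinAt)
      (fun y hy => (hd y (interior_subset hy)).differentiableAt.differentiableWithinAt)
      fun y hy => ?_
    rw [(hd y (interior_subset hy)).deriv]
    exact hg' y (interior_subset hy)
  exact h0.trans (hmono ⟨le_rfl, hx.1.trans hx.2⟩ hx hx.1)

lemma two_mul_le_sqrt_add_sqrt {u v w a : ℝ} (hu : 0 ≤ u) (hv : 0 ≤ v)
    (hsum : 2 * w ^ 2 + a ≤ u + v) (hdiff : (u - v) ^ 2 ≤ 8 * w ^ 2 * a) :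
    2 * w ≤ √u + √v := by
  have hsu := Real.sq_sqrt hu
  have hsv := Real.sq_sqrt hv
  have h1 : 4 * w ^ 2 - (u + v) ≤ 2 * (√u * √v) := by
    by_cases h : 4 * w ^ 2 ≤ u + v
    · have : 0 ≤ √u * √v := by positivity
      linarith
    · refine abs_le_of_sq_le_sq' ?_ (by positivity) |>.2
      have : (2 * (√u * √v)) ^ 2 = 4 * u * v := by
        rw [mul_pow, mul_pow, hsu, hsv]
        ring
      rw [this]
      nlinarith [mul_le_mul_of_nonneg_left hsum (sq_nonneg w)]
  refine abs_le_of_sq_le_sq' ?_ (by positivity) |>.2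
  nlinarith

lemma hasDerivAt_sq_gaussProfile {p : ℝ} (hp : p ∈ Ioo (0 : ℝ) 1) :
    HasDerivAt (fun p => gaussProfile p ^ 2) (-2 * (gaussProfile p * stdQuantile p)) p :=
  ((hasDerivAt_gaussProfile hp).fun_pow 2).congr_deriv (by push_cast; ring)

lemma hasDerivAt_gaussProfile_mul_stdQuantile {p : ℝ} (hp : p ∈ Ioo (0 : ℝ) 1) :
    HasDerivAt (fun p => gaussProfile p * stdQuantile p) (1 - stdQuantile p ^ 2) p := by
  refine ((hasDerivAt_gaussProfile hp).fun_mul (hasDerivAt_stdQuantile hp)).congr_deriv ?_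
  rw [gaussProfile, mul_inv_cancel₀ (gaussianPDFReal_std_pos _).ne']
  ring

lemma hasDerivAt_sq_stdQuantile {p : ℝ} (hp : p ∈ Ioo (0 : ℝ) 1) :
    HasDerivAt (fun p => stdQuantile p ^ 2)
      (2 * (stdQuantile p / gaussianPDFReal 0 1 (stdQuantile p))) p :=
  ((hasDerivAt_stdQuantile hp).fun_pow 2).congr_deriv (by push_cast; ring)

lemma gaussProfile_two_point_of_le_half {c r : ℝ} (hr : 0 ≤ r) (hcr : 0 < c - r)
    (hc : c ≤ 1 / 2) :
    2 * gaussProfile c ≤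
      √(gaussProfile (c + r) ^ 2 + r ^ 2) + √(gaussProfile (c - r) ^ 2 + r ^ 2) := by
  have hp (x : ℝ) (hx : x ∈ Icc 0 r) : c + x ∈ Ioo (0 : ℝ) 1 :=
    ⟨by linarith [hx.1], by linarith [hx.2]⟩
  have hm (x : ℝ) (hx : x ∈ Icc 0 r) : c - x ∈ Ioo (0 : ℝ) 1 :=
    ⟨by linarith [hx.2], by linarith [hx.1]⟩
  have hc' : c ∈ Ioo (0 : ℝ) 1 := ⟨by linarith, by linarith⟩
  have hadd (x : ℝ) : HasDerivAt (fun x => c + x) 1 x := (hasDerivAt_id x).const_add c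
  have hsub (x : ℝ) : HasDerivAt (fun x => c - x) (-1) x := (hasDerivAt_id x).const_sub c
  set J : ℝ → ℝ := fun p => gaussProfile p * stdQuantile p with hJ
  have hqc : stdQuantile c ≤ 0 := by
    have h := stdQuantile_le_stdQuantile hc' ⟨by linarith, by linarith [hc'.1]⟩
      (by linarith : c ≤ 1 - c)
    rw [stdQuantile_one_sub hc'] at h
    linarith
  -- comparison of the quantiles at `c + x` and `c - x`
  have hqle (x : ℝ) (hx : x ∈ Icc 0 r) : stdQuantile (c - x) ≤ stdQuantile (c + x) :=
    stdQuantile_le_stdQuantile (hm x hx) (hp x hx) (by linarith [hx.1])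
  have hqsq (x : ℝ) (hx : x ∈ Icc 0 r) : stdQuantile (c + x) ^ 2 ≤ stdQuantile (c - x) ^ 2 := by
    have h := stdQuantile_le_stdQuantile (hp x hx)
      ⟨by linarith [(hm x hx).2], by linarith [(hm x hx).1]⟩ (by linarith : c + x ≤ 1 - (c - x))
    rw [stdQuantile_one_sub (hm x hx)] at h
    nlinarith [hqle x hx]
  -- convexity of the squared quantile
  have hconv : ∀ x ∈ Icc 0 r,
      0 ≤ stdQuantile (c + x) ^ 2 + stdQuantile (c - x) ^ 2 - 2 * stdQuantile c ^ 2 := by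
    refine nonneg_of_hasDerivAt_nonneg (by simp only [add_zero, sub_zero]; linarith)
      (fun x hx => ((((hasDerivAt_sq_stdQuantile (hp x hx)).comp x (hadd x)).add
        ((hasDerivAt_sq_stdQuantile (hm x hx)).comp x (hsub x))).sub_const _)) fun x hx => ?_
    have := monotone_div_gaussianPDFReal_std (hqle x hx)
    simp only at this
    linarith
  have hsum' : ∀ x ∈ Icc 0 r,
      0 ≤ -2 * J (c + x) + 2 * J (c - x) + 4 * x - 4 * stdQuantile c ^ 2 * x := by
    refine nonneg_of_hasDerivAt_nonneg (by simp)
      (fun x hx => ((((hasDerivAt_gaussProfile_mul_stdQuantile (hp x hx)).comp x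
        (hadd x)).const_mul (-2)).add (((hasDerivAt_gaussProfile_mul_stdQuantile (hm x hx)).comp x
        (hsub x)).const_mul 2) |>.add ((hasDerivAt_id x).const_mul 4)).sub
        ((hasDerivAt_id x).const_mul _)) fun x hx => ?_
    linarith [hconv x hx]
  have hsum : ∀ x ∈ Icc 0 r, 0 ≤ gaussProfile (c + x) ^ 2 + gaussProfile (c - x) ^ 2 + 2 * x ^ 2
      - 2 * gaussProfile c ^ 2 - 2 * stdQuantile c ^ 2 * x ^ 2 := by
    refine nonneg_of_hasDerivAt_nonneg
      (by simp only [add_zero, sub_zero]; apply le_of_eq; ring)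
      (fun x hx => (((((hasDerivAt_sq_gaussProfile (hp x hx)).comp x (hadd x)).add
        ((hasDerivAt_sq_gaussProfile (hm x hx)).comp x (hsub x))).add
        (((hasDerivAt_id x).fun_pow 2).const_mul 2)).sub_const _).sub
        (((hasDerivAt_id x).fun_pow 2).const_mul _)) fun x hx => ?_
    have := hsum' x hx
    simp only [hJ, id, Nat.cast_ofNat, Nat.add_one_sub_one, pow_one] at this ⊢
    linarith
  have hdiff' : ∀ x ∈ Icc 0 r, 0 ≤ 2 * J (c + x) + 2 * J (c - x) - 4 * J c := by
    refine nonneg_of_hasDerivAt_nonneg (by simp only [add_zero, sub_zero]; linarith)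
      (fun x hx => ((((hasDerivAt_gaussProfile_mul_stdQuantile (hp x hx)).comp x
        (hadd x)).const_mul 2).add (((hasDerivAt_gaussProfile_mul_stdQuantile (hm x hx)).comp x
        (hsub x)).const_mul 2)).sub_const _) fun x hx => ?_
    linarith [hqsq x hx]
  have hdiff : ∀ x ∈ Icc 0 r,
      0 ≤ gaussProfile (c - x) ^ 2 - gaussProfile (c + x) ^ 2 - 4 * J c * x := by
    refine nonneg_of_hasDerivAt_nonneg (by simp)
      (fun x hx => (((hasDerivAt_sq_gaussProfile (hm x hx)).comp x (hsub x)).sub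
        ((hasDerivAt_sq_gaussProfile (hp x hx)).comp x (hadd x))).sub
        ((hasDerivAt_id x).const_mul _)) fun x hx => ?_
    have := hdiff' x hx
    simp only [hJ] at this ⊢
    linarith
  have hrr : r ∈ Icc 0 r := ⟨hr, le_rfl⟩
  have hle : gaussProfile (c - r) ≤ gaussProfile (c + r) :=
    gaussianPDFReal_std_le_of_sq_le (hqsq r hrr)
  have hpos := gaussProfile_pos (c - r)
  refine two_mul_le_sqrt_add_sqrt (a := 2 * stdQuantile c ^ 2 * r ^ 2) (by positivity)
    (by positivity) (by linarith [hsum r hrr]) ?_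
  have h1 : gaussProfile (c + r) ^ 2 - gaussProfile (c - r) ^ 2 ≤ -4 * J c * r := by
    linarith [hdiff r hrr]
  have h2 : 0 ≤ gaussProfile (c + r) ^ 2 - gaussProfile (c - r) ^ 2 := by nlinarith
  calc (gaussProfile (c + r) ^ 2 + r ^ 2 - (gaussProfile (c - r) ^ 2 + r ^ 2)) ^ 2
      = (gaussProfile (c + r) ^ 2 - gaussProfile (c - r) ^ 2) ^ 2 := by ring
    _ ≤ (-4 * J c * r) ^ 2 := pow_le_pow_left₀ h2 h1 2
    _ = 8 * gaussProfile c ^ 2 * (2 * stdQuantile c ^ 2 * r ^ 2) := by rw [hJ]; ring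

/-- Bobkov's two-point inequality. -/
theorem gaussProfile_two_point {a b : ℝ} (ha : a ∈ Ioo (0 : ℝ) 1) (hb : b ∈ Ioo (0 : ℝ) 1) :
    gaussProfile ((a + b) / 2) ≤ (√(gaussProfile a ^ 2 + ((a - b) / 2) ^ 2)
      + √(gaussProfile b ^ 2 + ((a - b) / 2) ^ 2)) / 2 := by
  have key {a b : ℝ} (ha : a ∈ Ioo (0 : ℝ) 1) (hb : b ∈ Ioo (0 : ℝ) 1) (hab : b ≤ a)
      (h : a + b ≤ 1) :
      gaussProfile ((a + b) / 2) ≤ (√(gaussProfile a ^ 2 + ((a - b) / 2) ^ 2)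
        + √(gaussProfile b ^ 2 + ((a - b) / 2) ^ 2)) / 2 := by
    have := gaussProfile_two_point_of_le_half (c := (a + b) / 2) (r := (a - b) / 2)
      (by linarith) (by linarith [hb.1]) (by linarith)
    rw [show (a + b) / 2 + (a - b) / 2 = a by ring, show (a + b) / 2 - (a - b) / 2 = b by ring]
      at this
    linarith
  have one_sub {p : ℝ} (hp : p ∈ Ioo (0 : ℝ) 1) : 1 - p ∈ Ioo (0 : ℝ) 1 :=
    ⟨by linarith [hp.2], by linarith [hp.1]⟩
  have key' {a b : ℝ} (ha : a ∈ Ioo (0 : ℝ) 1) (hb : b ∈ Ioo (0 : ℝ) 1) (hab : b ≤ a) :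
      gaussProfile ((a + b) / 2) ≤ (√(gaussProfile a ^ 2 + ((a - b) / 2) ^ 2)
        + √(gaussProfile b ^ 2 + ((a - b) / 2) ^ 2)) / 2 := by
    rcases le_total (a + b) 1 with h | h
    · exact key ha hb hab h
    · have hk := key (one_sub hb) (one_sub ha) (by linarith) (by linarith)
      rw [show (1 - b + (1 - a)) / 2 = 1 - (a + b) / 2 by ring, gaussProfile_one_sub ha,
        gaussProfile_one_sub hb, show 1 - b - (1 - a) = a - b by ring, gaussProfile_one_sub
        ⟨by linarith [ha.1, hb.1], by linarith [ha.2, hb.2]⟩] at hk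
      linarith
  rcases le_total b a with h | h
  · exact key' ha hb h
  · have hk := key' hb ha h
    rw [add_comm b a, show ((b - a) / 2) ^ 2 = ((a - b) / 2) ^ 2 by ring] at hk
    linarith

/-! ### Averages over random signs -/

lemma sqrt_add_sq_add_sq_le (a b c d : ℝ) :
    √((a + c) ^ 2 + (b + d) ^ 2) ≤ √(a ^ 2 + b ^ 2) + √(c ^ 2 + d ^ 2) := by
  have h1 := Real.sq_sqrt (add_nonneg (sq_nonneg a) (sq_nonneg b))
  have h2 := Real.sq_sqrt (add_nonneg (sq_nonneg c) (sq_nonneg d))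
  have h3 : a * c + b * d ≤ √(a ^ 2 + b ^ 2) * √(c ^ 2 + d ^ 2) := by
    refine abs_le_of_sq_le_sq' ?_ (by positivity) |>.2
    rw [mul_pow, h1, h2]
    nlinarith [sq_nonneg (a * d - b * c)]
  rw [Real.sqrt_le_left (by positivity)]
  nlinarith

/-- The average of `h (x + ∑ ± v)` over all choices of signs, `v` running through a list. -/
noncomputable def signAverage {E : Type*} [AddCommGroup E] : List E → (E → ℝ) → E → ℝ
  | [], h => h
  | v :: vs, h => fun x => (signAverage vs h (x + v) + signAverage vs h (x - v)) / 2

section SignAverage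

variable {E : Type*} [AddCommGroup E]

lemma signAverage_mono (vs : List E) {h k : E → ℝ} (hk : ∀ y, h y ≤ k y) (x : E) :
    signAverage vs h x ≤ signAverage vs k x := by
  induction vs generalizing x with
  | nil => exact hk x
  | cons v vs ih =>
    simp only [signAverage]
    linarith [ih (x + v), ih (x - v)]

lemma signAverage_sub (vs : List E) (h k : E → ℝ) (x : E) :
    signAverage vs (fun y => h y - k y) x = signAverage vs h x - signAverage vs k x := by
  induction vs generalizing x with
  | nil => rfl
  | cons v vs ih =>
    simp only [signAverage, ih]
    ring

lemma signAverage_add_const (vs : List E) (h : E → ℝ) (c : ℝ) (x : E) :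
    signAverage vs (fun y => h y + c) x = signAverage vs h x + c := by
  induction vs generalizing x with
  | nil => rfl
  | cons v vs ih =>
    simp only [signAverage, ih]
    ring

lemma signAverage_comp_add (vs : List E) (h : E → ℝ) (w x : E) :
    signAverage vs (fun y => h (y + w)) x = signAverage vs h (x + w) := by
  induction vs generalizing x with
  | nil => rfl
  | cons v vs ih =>
    simp only [signAverage, ih]
    rw [show x + v + w = x + w + v by abel, show x - v + w = x + w - v by abel]

lemma abs_signAverage_le (vs : List E) (h : E → ℝ) (x : E) :
    |signAverage vs h x| ≤ signAverage vs (fun y => |h y|) x := by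
  induction vs generalizing x with
  | nil => exact le_rfl
  | cons v vs ih =>
    simp only [signAverage, abs_div, abs_two]
    linarith [ih (x + v), ih (x - v), abs_add_le (signAverage vs h (x + v))
      (signAverage vs h (x - v))]

lemma signAverage_mem_Ioo (vs : List E) {h : E → ℝ} (hh : ∀ y, h y ∈ Ioo (0 : ℝ) 1) (x : E) :
    signAverage vs h x ∈ Ioo (0 : ℝ) 1 := by
  induction vs generalizing x with
  | nil => exact hh x
  | cons v vs ih =>
    simp only [signAverage]
    have h1 := ih (x + v)
    have h2 := ih (x - v)
    exact ⟨by linarith [h1.1, h2.1], by linarith [h1.2, h2.2]⟩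

lemma sqrt_sq_signAverage_add_sq_le (vs : List E) (h k : E → ℝ) (x : E) :
    √(signAverage vs h x ^ 2 + signAverage vs k x ^ 2) ≤
      signAverage vs (fun y => √(h y ^ 2 + k y ^ 2)) x := by
  induction vs generalizing x with
  | nil => exact le_rfl
  | cons v vs ih =>
    simp only [signAverage]
    have h1 := sqrt_add_sq_add_sq_le (signAverage vs h (x + v)) (signAverage vs k (x + v))
      (signAverage vs h (x - v)) (signAverage vs k (x - v))
    rw [div_pow, div_pow, ← add_div, Real.sqrt_div (by positivity),
      Real.sqrt_sq (by norm_num : (0 : ℝ) ≤ 2)]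
    linarith [ih (x + v), ih (x - v)]

/-- Bobkov's inequality on the discrete cube. -/
theorem gaussProfile_signAverage_le (vs : List E) {f : E → ℝ} {G : E → E → ℝ}
    (hf : ∀ y, f y ∈ Ioo (0 : ℝ) 1)
    (hadd : ∀ v ∈ vs, ∀ y, |f y - f (y + (v + v))| / 2 ≤ G v y)
    (hsub : ∀ v ∈ vs, ∀ y, |f y - f (y - (v + v))| / 2 ≤ G v y) (x : E) :
    gaussProfile (signAverage vs f x) ≤
      signAverage vs (fun y => √(gaussProfile (f y) ^ 2 + (vs.map fun v => G v y ^ 2).sum)) x := by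
  induction vs generalizing x with
  | nil => simp [signAverage, Real.sqrt_sq (gaussProfile_pos _).le]
  | cons v vs ih =>
    have ih := ih (fun w hw => hadd w (List.mem_cons_of_mem _ hw))
      (fun w hw => hsub w (List.mem_cons_of_mem _ hw))
    have hG (y : E) : 0 ≤ G v y := le_trans (by positivity) (hadd v List.mem_cons_self y)
    set U : E → ℝ := fun y => √(gaussProfile (f y) ^ 2 + (vs.map fun v => G v y ^ 2).sum) with hU
    have hUsq (y : E) : U y ^ 2 = gaussProfile (f y) ^ 2 + (vs.map fun v => G v y ^ 2).sum := by
      refine Real.sq_sqrt (add_nonneg (sq_nonneg _) (List.sum_nonneg fun z hz => ?_))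
      obtain ⟨w, -, rfl⟩ := List.mem_map.1 hz
      positivity
    have hstep (z : E) {d : ℝ} (hd : |d| ≤ signAverage vs (G v) z) :
        √(gaussProfile (signAverage vs f z) ^ 2 + d ^ 2) ≤
          signAverage vs (fun y => √(U y ^ 2 + G v y ^ 2)) z := by
      refine le_trans (Real.sqrt_le_sqrt (add_le_add ?_ ?_))
        (sqrt_sq_signAverage_add_sq_le vs U (G v) z)
      · exact pow_le_pow_left₀ (gaussProfile_pos _).le (ih z) 2
      · rw [← sq_abs d]
        exact pow_le_pow_left₀ (abs_nonneg d) hd 2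
    have hdiff (k : E → E) (w : E) (hk : ∀ y, k y = y + w)
        (hkG : ∀ y, |f y - f (k y)| / 2 ≤ G v y) (z : E) :
        |(signAverage vs f z - signAverage vs f (z + w)) / 2| ≤ signAverage vs (G v) z := by
      rw [← signAverage_comp_add, ← signAverage_sub, abs_div, abs_two, div_le_iff₀ two_pos]
      refine (abs_signAverage_le _ _ _).trans ?_
      have h2 : signAverage vs (G v) z * 2 = signAverage vs (fun y => G v y - -G v y) z := by
        rw [signAverage_sub, show (fun y => -G v y) = fun y => (G v y - G v y) - G v y by
          funext; ring, signAverage_sub, signAverage_sub]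
        ring
      rw [h2]
      refine signAverage_mono vs (fun y => ?_) z
      have := hkG y
      rw [hk] at this
      linarith
    have h1 := hdiff (fun y => y - (v + v)) (-(v + v)) (fun y => sub_eq_add_neg _ _)
      (hsub v List.mem_cons_self) (x + v)
    have h2 := hdiff (fun y => y + (v + v)) (v + v) (fun y => rfl)
      (hadd v List.mem_cons_self) (x - v)
    rw [show x + v + -(v + v) = x - v by abel] at h1
    rw [show x - v + (v + v) = x + v by abel, ← abs_neg, ← neg_div, neg_sub] at h2
    have h3 := gaussProfile_two_point (signAverage_mem_Ioo vs hf (x + v))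
      (signAverage_mem_Ioo vs hf (x - v))
    have h4 : (fun y => √(gaussProfile (f y) ^ 2 + ((v :: vs).map fun v => G v y ^ 2).sum))
        = fun y => √(U y ^ 2 + G v y ^ 2) := by
      funext y
      rw [hUsq, List.map_cons, List.sum_cons]
      congr 1
      ring
    rw [h4]
    simp only [signAverage]
    linarith [hstep (x + v) h1, hstep (x - v) h2]

end SignAverage

/-! ### Convergence of the random walk to the Gaussian measure -/

section SignWalk

variable {E : Type*} [NormedAddCommGroup E] [MeasurableSpace E]

/-- The law of `∑ ± v` with independent uniform signs, `v` running through a list. -/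
noncomputable def signWalk : List E → Measure E
  | [] => Measure.dirac 0
  | v :: vs => (2⁻¹ : ℝ≥0) • (signWalk vs).map (fun x => x + v)
      + (2⁻¹ : ℝ≥0) • (signWalk vs).map (fun x => x + -v)

variable [BorelSpace E]

instance isProbabilityMeasure_signWalk (vs : List E) : IsProbabilityMeasure (signWalk vs) := by
  induction vs with
  | nil => exact Measure.dirac.isProbabilityMeasure
  | cons v vs ih =>
    have h (w : E) : IsProbabilityMeasure ((signWalk vs).map (fun x => x + w)) :=
      Measure.isProbabilityMeasure_map (measurable_add_const w).aemeasurable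
    refine ⟨?_⟩
    have h1 := (h v).measure_univ
    have h2 := (h (-v)).measure_univ
    simp only [signWalk, Measure.add_apply, Measure.smul_apply, h1, h2]
    rw [← add_smul]
    norm_num [ENNReal.smul_def]

lemma integral_signWalk [SecondCountableTopology E] (vs : List E) {h : E → ℝ} (hh : Continuous h)
    {B : ℝ} (hB : ∀ y, |h y| ≤ B) (x : E) :
    ∫ y, h (x + y) ∂signWalk vs = signAverage vs h x := by
  induction vs generalizing x with
  | nil => simp [signWalk, signAverage]
  | cons v vs ih =>
    have hint (μ : Measure E) [IsFiniteMeasure μ] : Integrable (fun y => h (x + y)) μ :=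
      Integrable.of_bound (hh.comp (continuous_const_add x)).aestronglyMeasurable B
        (Eventually.of_forall fun y => hB _)
    have hmap (w : E) : ∫ y, h (x + y) ∂(signWalk vs).map (fun x => x + w)
        = signAverage vs h (x + w) := by
      rw [integral_map (measurable_add_const w).aemeasurable
        (by fun_prop), ← ih]
      congr 1 with y
      congr 1
      abel
    have hfin (w : E) : IsFiniteMeasure ((signWalk vs).map (fun x => x + w)) := inferInstance
    rw [signWalk, integral_add_measure (hint _) (hint _), integral_smul_nnreal_measure,
      integral_smul_nnreal_measure, hmap, hmap]
    simp only [signAverage, sub_eq_add_neg x v, NNReal.smul_def, NNReal.coe_inv, NNReal.coe_ofNat,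
      smul_eq_mul]
    ring

lemma charFun_signWalk [InnerProductSpace ℝ E] [SecondCountableTopology E] (vs : List E) (t : E) :
    charFun (signWalk vs) t = (vs.map fun v => (Real.cos (inner ℝ v t) : ℂ)).prod := by
  induction vs with
  | nil => simp [signWalk]
  | cons v vs ih =>
    have hint (μ : Measure E) [IsFiniteMeasure μ] :
        Integrable (fun x => Complex.exp (inner ℝ x t * Complex.I)) μ := by
      refine Integrable.of_bound (by fun_prop) 1 (Eventually.of_forall fun y => ?_)
      rw [Complex.norm_exp_ofReal_mul_I]
    have h (w : E) : ∫ x, Complex.exp (inner ℝ x t * Complex.I)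
          ∂(signWalk vs).map (fun x => x + w)
        = charFun (signWalk vs) t * Complex.exp (inner ℝ w t * Complex.I) := by
      rw [← charFun_apply, charFun_map_add_const]
    rw [charFun_apply, signWalk, integral_add_measure (hint _) (hint _),
      integral_smul_nnreal_measure, integral_smul_nnreal_measure, h, h, ih, List.map_cons,
      List.prod_cons, inner_neg_left, Complex.ofReal_cos, Complex.cos]
    simp only [NNReal.smul_def, NNReal.coe_inv, NNReal.coe_ofNat, Complex.real_smul,
      Complex.ofReal_neg]
    push_cast
    ring

end SignWalk

lemma tendsto_cos_div_sqrt_pow (t : ℝ) :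
    Tendsto (fun m : ℕ => Real.cos (t / √m) ^ m) atTop (𝓝 (Real.exp (-(t ^ 2 / 2)))) := by
  have h : Tendsto (fun m : ℕ => (m : ℝ) * (Real.cos (t / √m) - 1)) atTop
      (𝓝 (-(t ^ 2 / 2))) := by
    have h0 : Tendsto (fun m : ℕ => t ^ 4 / (m : ℝ)) atTop (𝓝 0) :=
      tendsto_const_div_atTop_nhds_zero_nat _
    rw [tendsto_iff_norm_sub_tendsto_zero]
    refine squeeze_zero' (Eventually.of_forall fun _ => norm_nonneg _) ?_ h0
    filter_upwards [eventually_ge_atTop (⌈t ^ 2⌉₊ + 1)] with m hm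
    have hm0 : (0 : ℝ) < m := by exact_mod_cast (by lia : 0 < m)
    have hmt : t ^ 2 ≤ m := (Nat.le_ceil _).trans (by exact_mod_cast (by lia : ⌈t ^ 2⌉₊ ≤ m))
    have hsq : (t / √m) ^ 2 = t ^ 2 / m := by rw [div_pow, Real.sq_sqrt hm0.le]
    have habs : |t / √m| ≤ 1 := by
      rw [← sq_le_one_iff_abs_le_one, hsq, div_le_one hm0]
      exact hmt
    have hb := Real.cos_bound habs
    have h4 : |t / √m| ^ 4 = t ^ 4 / m ^ 2 := by
      rw [show |t / √m| ^ 4 = (|t / √m| ^ 2) ^ 2 by ring, sq_abs, hsq]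
      ring
    rw [hsq, h4] at hb
    rw [Real.norm_eq_abs, show (m : ℝ) * (Real.cos (t / √m) - 1) - -(t ^ 2 / 2)
      = m * (Real.cos (t / √m) - (1 - t ^ 2 / m / 2)) by field_simp; ring, abs_mul,
      abs_of_pos hm0]
    calc (m : ℝ) * |Real.cos (t / √m) - (1 - t ^ 2 / m / 2)|
        ≤ m * (t ^ 4 / m ^ 2 * (5 / 96)) := by gcongr
      _ = t ^ 4 / m * (5 / 96) := by field_simp
      _ ≤ t ^ 4 / m := mul_le_of_le_one_right (by positivity) (by norm_num)
  refine (Real.tendsto_one_add_pow_exp_of_tendsto h).congr fun m => ?_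
  rw [add_sub_cancel]

/-- The steps of a random walk approximating the standard Gaussian measure on `ℝⁿ`: each vector
`e_j / √m` of the rescaled standard basis is repeated `m` times. -/
noncomputable def walkSteps (n m : ℕ) : List (EuclideanSpace ℝ (Fin n)) :=
  (List.finRange n).flatMap fun j => List.replicate m (EuclideanSpace.single j (1 / √m))

lemma sum_map_walkSteps (n m : ℕ) (k : EuclideanSpace ℝ (Fin n) → ℝ) :
    ((walkSteps n m).map k).sum = ∑ j, m * k (EuclideanSpace.single j (1 / √m)) := by
  simp [walkSteps, List.flatMap, List.sum_flatten, ← List.ofFn_eq_map,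
    List.sum_ofFn, Function.comp_def]

lemma prod_map_walkSteps (n m : ℕ) (k : EuclideanSpace ℝ (Fin n) → ℂ) :
    ((walkSteps n m).map k).prod = ∏ j, k (EuclideanSpace.single j (1 / √m)) ^ m := by
  simp [walkSteps, List.flatMap, List.prod_flatten, ← List.ofFn_eq_map,
    List.prod_ofFn, Function.comp_def]

lemma tendsto_signAverage_walkSteps (n : ℕ) {h : EuclideanSpace ℝ (Fin n) → ℝ}
    (hh : Continuous h) {B : ℝ} (hB : ∀ y, |h y| ≤ B) :
    Tendsto (fun m => signAverage (walkSteps n m) h 0) atTop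
      (𝓝 (∫ y, h y ∂stdGaussian (EuclideanSpace ℝ (Fin n)))) := by
  let μ (m : ℕ) : ProbabilityMeasure (EuclideanSpace ℝ (Fin n)) :=
    ⟨signWalk (walkSteps n m), inferInstance⟩
  let μ₀ : ProbabilityMeasure (EuclideanSpace ℝ (Fin n)) := ⟨stdGaussian _, inferInstance⟩
  have hμ : Tendsto μ atTop (𝓝 μ₀) := by
    refine ProbabilityMeasure.tendsto_of_tendsto_charFun fun t => ?_
    have hlim : charFun (stdGaussian (EuclideanSpace ℝ (Fin n))) t
        = ((∏ j, Real.exp (-(t j ^ 2 / 2)) : ℝ) : ℂ) := by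
      rw [charFun_stdGaussian, ← Real.exp_sum, ← Complex.ofReal_pow,
        EuclideanSpace.real_norm_sq_eq, Finset.sum_neg_distrib, ← Finset.sum_div]
      push_cast
      congr 1
      ring
    have hseq (m : ℕ) : charFun (signWalk (walkSteps n m)) t
        = ((∏ j, Real.cos (t j / √m) ^ m : ℝ) : ℂ) := by
      rw [charFun_signWalk, prod_map_walkSteps]
      push_cast
      refine Finset.prod_congr rfl fun j _ => ?_
      rw [EuclideanSpace.inner_single_left]
      simp [div_eq_inv_mul]
    simp only [μ, μ₀, ProbabilityMeasure.coe_mk, hlim, hseq]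
    exact (Complex.continuous_ofReal.tendsto _).comp
      (tendsto_finsetProd _ fun j _ => tendsto_cos_div_sqrt_pow (t j))
  rw [ProbabilityMeasure.tendsto_iff_forall_integral_tendsto] at hμ
  refine (hμ (BoundedContinuousFunction.ofNormedAddCommGroup h hh B hB)).congr fun m => ?_
  have := integral_signWalk (walkSteps n m) hh hB 0
  simpa [μ] using this

/-! ### Bobkov's functional inequality for the Gaussian measure -/

lemma abs_sub_sub_apply_le {E : Type*} [NormedAddCommGroup E] [NormedSpace ℝ E] {f : E → ℝ}
    {f' : E → E →L[ℝ] ℝ} {C : ℝ≥0} (hd : ∀ x, HasFDerivAt f (f' x) x) (hC : LipschitzWith C f')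
    (y w : E) : |f (y + w) - f y - f' y w| ≤ C * ‖w‖ ^ 2 := by
  have h := (convex_closedBall y ‖w‖).norm_image_sub_le_of_norm_hasFDerivWithin_le'
    (f := f) (f' := f') (φ := f' y) (C := C * ‖w‖) (x := y) (y := y + w)
    (fun x _ => (hd x).hasFDerivWithinAt) (fun x hx => ?_) (by simp) (by simp)
  · rw [add_sub_cancel_left, Real.norm_eq_abs] at h
    linarith
  · refine (hC.norm_sub_le x y).trans ?_
    gcongr
    simpa [dist_eq_norm] using hx

lemma sum_sq_apply_single_le {n : ℕ} (L : EuclideanSpace ℝ (Fin n) →L[ℝ] ℝ) :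
    ∑ j, L (EuclideanSpace.single j 1) ^ 2 ≤ ‖L‖ ^ 2 := by
  set x : EuclideanSpace ℝ (Fin n) := WithLp.toLp 2 fun j => L (EuclideanSpace.single j 1) with hx
  have h1 : L x = ∑ j, L (EuclideanSpace.single j 1) ^ 2 := by
    conv_lhs => rw [← (EuclideanSpace.basisFun (Fin n) ℝ).sum_repr x]
    simp [hx, map_sum, sq]
  have h2 : ‖x‖ ^ 2 = ∑ j, L (EuclideanSpace.single j 1) ^ 2 := by
    simp [EuclideanSpace.real_norm_sq_eq, hx]
  have h3 : L x ≤ ‖L‖ * ‖x‖ := (le_abs_self _).trans (L.le_opNorm x)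
  rw [← h2]
  rw [h1, ← h2] at h3
  have h4 : ‖x‖ ≤ ‖L‖ := by
    by_contra! h
    nlinarith [norm_nonneg L, norm_nonneg x]
  gcongr

lemma sqrt_add_sum_add_const_le {ι : Type*} [Fintype ι] (a c b : ℝ) (d : ι → ℝ) (hc : 0 ≤ c)
    (hd : ∑ j, d j ^ 2 ≤ b ^ 2) :
    √(a ^ 2 + ∑ j, (|d j| + c) ^ 2) ≤ √(a ^ 2 + b ^ 2) + Fintype.card ι * c := by
  set Q := √(a ^ 2 + b ^ 2) with hQ
  have hQsq : Q ^ 2 = a ^ 2 + b ^ 2 := Real.sq_sqrt (by positivity)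
  have hle (j : ι) : |d j| ≤ Q := by
    refine Real.le_sqrt_of_sq_le ?_
    have : d j ^ 2 ≤ ∑ j, d j ^ 2 :=
      Finset.single_le_sum (fun i _ => sq_nonneg (d i)) (Finset.mem_univ j)
    rw [sq_abs]
    nlinarith [sq_nonneg a]
  rw [Real.sqrt_le_left (by positivity)]
  have hsum : ∑ j, (|d j| + c) ^ 2 ≤ ∑ j, (d j ^ 2 + (2 * Q * c + c ^ 2)) := by
    refine Finset.sum_le_sum fun j _ => ?_
    nlinarith [hle j, sq_abs (d j)]
  rw [Finset.sum_add_distrib, Finset.sum_const, Finset.card_univ, nsmul_eq_mul] at hsum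
  have hcard : (Fintype.card ι : ℝ) ≤ (Fintype.card ι : ℝ) ^ 2 := by
    exact_mod_cast Nat.le_self_pow two_ne_zero _
  nlinarith [mul_le_mul_of_nonneg_right hcard (sq_nonneg c)]

lemma integral_mem_Ioo {α : Type*} [MeasurableSpace α] {μ : Measure α} [IsProbabilityMeasure μ]
    {f : α → ℝ} (hfm : AEStronglyMeasurable f μ) (hf : ∀ x, f x ∈ Ioo (0 : ℝ) 1) :
    ∫ x, f x ∂μ ∈ Ioo (0 : ℝ) 1 := by
  have hpos {k : α → ℝ} (hk : ∀ x, 0 < k x) (hki : Integrable k μ) : 0 < ∫ x, k x ∂μ := by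
    rw [integral_pos_iff_support_of_nonneg (fun x => (hk x).le) hki,
      show Function.support k = univ from eq_univ_of_forall fun x => (hk x).ne', measure_univ]
    exact one_pos
  have hint : Integrable f μ := Integrable.of_bound hfm 1 (Eventually.of_forall fun x => by
    rw [Real.norm_eq_abs, abs_of_pos (hf x).1]
    exact (hf x).2.le)
  have h1 := hpos (fun x => sub_pos.2 (hf x).2) ((integrable_const 1).sub hint)
  rw [integral_sub (integrable_const 1) hint] at h1
  simp only [integral_const, probReal_univ, one_smul] at h1
  exact ⟨hpos (fun x => (hf x).1) hint, by linarith⟩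

theorem gaussProfile_integral_stdGaussian_le {n : ℕ} {f : EuclideanSpace ℝ (Fin n) → ℝ}
    {f' : EuclideanSpace ℝ (Fin n) → EuclideanSpace ℝ (Fin n) →L[ℝ] ℝ} {B : ℝ} {C : ℝ≥0}
    (hf : ∀ x, f x ∈ Ioo (0 : ℝ) 1) (hd : ∀ x, HasFDerivAt f (f' x) x) (hB : ∀ x, ‖f' x‖ ≤ B)
    (hC : LipschitzWith C f') :
    gaussProfile (∫ x, f x ∂stdGaussian (EuclideanSpace ℝ (Fin n))) ≤
      ∫ x, √(gaussProfile (f x) ^ 2 + ‖f' x‖ ^ 2) ∂stdGaussian (EuclideanSpace ℝ (Fin n)) := by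
  have hfc : Continuous f := continuous_iff_continuousAt.2 fun x => (hd x).continuousAt
  have hIc : Continuous fun x => gaussProfile (f x) :=
    continuous_iff_continuousAt.2 fun x =>
      ContinuousAt.comp (g := gaussProfile) (hasDerivAt_gaussProfile (hf x)).continuousAt
        hfc.continuousAt
  set H : EuclideanSpace ℝ (Fin n) → ℝ := fun x => √(gaussProfile (f x) ^ 2 + ‖f' x‖ ^ 2) with hH
  have hHc : Continuous H := by
    have := hC.continuous
    fun_prop
  have hHB (x : EuclideanSpace ℝ (Fin n)) : |H x| ≤ 1 + B := by
    have h1 : gaussProfile (f x) ≤ 1 := gaussianPDFReal_std_le_one _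
    have h2 := gaussProfile_pos (f x)
    rw [hH, abs_of_nonneg (Real.sqrt_nonneg _), Real.sqrt_le_left
      (by linarith [hB x, norm_nonneg (f' x)])]
    nlinarith [hB x, norm_nonneg (f' x)]
  have hfB (x : EuclideanSpace ℝ (Fin n)) : |f x| ≤ 1 := by
    rw [abs_of_pos (hf x).1]
    exact (hf x).2.le
  have hlim1 := tendsto_signAverage_walkSteps n hfc hfB
  have hlim2 := tendsto_signAverage_walkSteps n hHc hHB
  have hlim3 : Tendsto (fun m : ℕ => (n : ℝ) * (2 * C / √m)) atTop (𝓝 (n * 0)) := by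
    refine Tendsto.const_mul _ (tendsto_const_nhds.div_atTop ?_)
    exact Real.tendsto_sqrt_atTop.comp tendsto_natCast_atTop_atTop
  rw [mul_zero] at hlim3
  have hmean : ∫ x, f x ∂stdGaussian (EuclideanSpace ℝ (Fin n)) ∈ Ioo (0 : ℝ) 1 :=
    integral_mem_Ioo hfc.aestronglyMeasurable hf
  have hlim4 := (hasDerivAt_gaussProfile hmean).continuousAt.tendsto.comp hlim1
  have hlim5 := hlim2.add hlim3
  rw [add_zero] at hlim5
  refine le_of_tendsto_of_tendsto hlim4 hlim5 ?_
  filter_upwards [eventually_ge_atTop 1] with m hm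
  have hm0 : (0 : ℝ) < m := by exact_mod_cast hm
  have hs0 : 0 < √(m : ℝ) := Real.sqrt_pos.2 hm0
  have hinc (y v w : EuclideanSpace ℝ (Fin n)) (hw : w = v + v ∨ w = -(v + v)) :
      |f y - f (y + w)| / 2 ≤ |f' y v| + 2 * C * ‖v‖ ^ 2 := by
    have h1 := abs_sub_sub_apply_le hd hC y w
    have h2 : |f' y w| = 2 * |f' y v| := by
      rcases hw with rfl | rfl
      · rw [map_add, ← two_mul, abs_mul, abs_two]
      · rw [map_neg, abs_neg, map_add, ← two_mul, abs_mul, abs_two]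
    have h3 : ‖w‖ = 2 * ‖v‖ := by
      rcases hw with rfl | rfl
      · rw [← two_smul ℝ v, norm_smul, Real.norm_two]
      · rw [norm_neg, ← two_smul ℝ v, norm_smul, Real.norm_two]
    rw [h3] at h1
    have h4 : |f y - f (y + w)| ≤ |f (y + w) - f y - f' y w| + |f' y w| := by
      rw [abs_sub_comm]
      calc |f (y + w) - f y| = |(f (y + w) - f y - f' y w) + f' y w| := by rw [sub_add_cancel]
        _ ≤ _ := abs_add_le _ _
    rw [h2] at h4
    nlinarith
  have hcube := gaussProfile_signAverage_le (walkSteps n m)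
    (G := fun v y => |f' y v| + 2 * C * ‖v‖ ^ 2) hf (fun v _ y => hinc y v _ (Or.inl rfl))
    (fun v _ y => by
      rw [sub_eq_add_neg y]
      exact hinc y v _ (Or.inr rfl)) 0
  refine hcube.trans ?_
  rw [← signAverage_add_const]
  refine signAverage_mono _ (fun y => ?_) 0
  have hterm (j : Fin n) : (m : ℝ) * (|f' y (EuclideanSpace.single j (1 / √m))|
        + 2 * C * ‖EuclideanSpace.single j (1 / √(m : ℝ))‖ ^ 2) ^ 2
      = (|f' y (EuclideanSpace.single j 1)| + 2 * C / √m) ^ 2 := by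
    have h1 : EuclideanSpace.single j (1 / √(m : ℝ))
        = (1 / √(m : ℝ)) • EuclideanSpace.single j (1 : ℝ) := by
      ext i
      by_cases h : i = j <;> simp [h]
    have hss : √(m : ℝ) ^ 2 = m := Real.sq_sqrt hm0.le
    rw [h1, map_smul, norm_smul, PiLp.norm_single, norm_one, mul_one, smul_eq_mul,
      abs_mul, Real.norm_of_nonneg (by positivity : (0 : ℝ) ≤ 1 / √m),
      abs_of_nonneg (by positivity : (0 : ℝ) ≤ 1 / √m)]
    nth_rewrite 1 [← hss]
    field_simp
  rw [sum_map_walkSteps, Finset.sum_congr rfl fun j _ => hterm j]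
  have := sqrt_add_sum_add_const_le (gaussProfile (f y)) (2 * C / √m) ‖f' y‖
    (fun j => f' y (EuclideanSpace.single j 1)) (by positivity) (sum_sq_apply_single_le (f' y))
  rwa [Fintype.card_fin] at this

/-! ### Smoothed level sets of a Lipschitz function -/

lemma lipschitzWith_gaussianPDFReal_std : LipschitzWith 1 (gaussianPDFReal 0 1) :=
  lipschitzWith_of_nnnorm_deriv_le
    (fun t => (hasDerivAt_gaussianPDFReal_std t).differentiableAt) fun t => by
      rw [(hasDerivAt_gaussianPDFReal_std t).deriv, ← NNReal.coe_le_coe, coe_nnnorm]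
      exact abs_mul_gaussianPDFReal_std_le_one t

/-- The mean of `Φ (a (s - g))`, a smooth version of the distribution function of `g`. -/
noncomputable def smoothCdf {E : Type*} [MeasurableSpace E] (μ : Measure E) (g : E → ℝ)
    (a s : ℝ) : ℝ :=
  ∫ x, stdPhi (a * (s - g x)) ∂μ

section

variable {E : Type*} [MeasurableSpace E] [TopologicalSpace E] [OpensMeasurableSpace E]
  {μ : Measure E} [IsProbabilityMeasure μ] {g : E → ℝ}

lemma smoothCdf_mem_Ioo (hg : Continuous g) (a s : ℝ) :
    smoothCdf μ g a s ∈ Ioo (0 : ℝ) 1 := by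
  refine integral_mem_Ioo ?_ fun x => stdPhi_mem_Ioo _
  exact (continuous_stdPhi.comp (by fun_prop)).aestronglyMeasurable

lemma hasDerivAt_smoothCdf (hg : Continuous g) {a : ℝ} (ha : 0 ≤ a)
    (s : ℝ) : HasDerivAt (smoothCdf μ g a) (∫ x, a * gaussianPDFReal 0 1 (a * (s - g x)) ∂μ) s := by
  refine (hasDerivAt_integral_of_dominated_loc_of_deriv_le (s := univ) (bound := fun _ => a)
    (F := fun s x => stdPhi (a * (s - g x)))
    (F' := fun s x => a * gaussianPDFReal 0 1 (a * (s - g x))) univ_mem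
    (Eventually.of_forall fun u => ?_) ?_ ?_ ?_ (integrable_const a) ?_).2
  · exact (continuous_stdPhi.comp (by fun_prop)).aestronglyMeasurable
  · refine Integrable.of_bound (continuous_stdPhi.comp (by fun_prop)).aestronglyMeasurable 1
      (Eventually.of_forall fun x => ?_)
    rw [Real.norm_eq_abs, abs_of_pos (stdPhi_mem_Ioo _).1]
    exact (stdPhi_mem_Ioo _).2.le
  · exact (continuous_const.mul
      (continuous_gaussianPDFReal_std.comp (by fun_prop))).aestronglyMeasurable
  · refine Eventually.of_forall fun x u _ => ?_
    rw [Real.norm_eq_abs, abs_mul, abs_of_nonneg ha, abs_of_pos (gaussianPDFReal_std_pos _)]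
    exact mul_le_of_le_one_right ha (gaussianPDFReal_std_le_one _)
  · refine Eventually.of_forall fun x u _ => ?_
    have h : HasDerivAt (fun u => a * (u - g x)) a u := by
      simpa using ((hasDerivAt_id u).sub_const (g x)).const_mul a
    exact ((hasDerivAt_stdPhi _).comp u h).congr_deriv (mul_comm _ _)

end

theorem gaussProfile_smoothCdf_le {n : ℕ} {g : EuclideanSpace ℝ (Fin n) → ℝ}
    {g' : EuclideanSpace ℝ (Fin n) → EuclideanSpace ℝ (Fin n) →L[ℝ] ℝ} {K : ℝ≥0}
    (hd : ∀ x, HasFDerivAt g (g' x) x) (hg : LipschitzWith 1 g) (hK : LipschitzWith K g')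
    {a : ℝ} (ha : 0 ≤ a) (s : ℝ) :
    gaussProfile (smoothCdf (stdGaussian (EuclideanSpace ℝ (Fin n))) g a s) ≤
      √(1 + a ^ 2) *
        ∫ x, gaussianPDFReal 0 1 (a * (s - g x)) ∂stdGaussian (EuclideanSpace ℝ (Fin n)) := by
  have hg1 (x : EuclideanSpace ℝ (Fin n)) : ‖g' x‖ ≤ 1 := by
    rw [← (hd x).fderiv]
    exact norm_fderiv_le_of_lipschitz ℝ hg
  set c : EuclideanSpace ℝ (Fin n) → ℝ := fun x => -(a * gaussianPDFReal 0 1 (a * (s - g x)))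
    with hc
  have hcabs (x : EuclideanSpace ℝ (Fin n)) :
      ‖c x‖ = a * gaussianPDFReal 0 1 (a * (s - g x)) := by
    rw [hc, norm_neg, Real.norm_of_nonneg (mul_nonneg ha (gaussianPDFReal_std_pos _).le)]
  have hcle (x : EuclideanSpace ℝ (Fin n)) : ‖c x‖ ≤ a := by
    rw [hcabs]
    exact mul_le_of_le_one_right ha (gaussianPDFReal_std_le_one _)
  have hclip (x y : EuclideanSpace ℝ (Fin n)) : ‖c x - c y‖ ≤ a * a * ‖x - y‖ := by
    have h1 := lipschitzWith_gaussianPDFReal_std.norm_sub_le (a * (s - g y)) (a * (s - g x))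
    have h2 := hg.norm_sub_le x y
    have h3 : c x - c y = a * (gaussianPDFReal 0 1 (a * (s - g y))
        - gaussianPDFReal 0 1 (a * (s - g x))) := by
      rw [hc]
      ring
    have h4 : a * (s - g y) - a * (s - g x) = a * (g x - g y) := by ring
    rw [h4, norm_mul, Real.norm_of_nonneg ha] at h1
    simp only [NNReal.coe_one, one_mul] at h1 h2
    rw [h3, norm_mul, Real.norm_of_nonneg ha, mul_assoc]
    gcongr
    exact h1.trans (by gcongr)
  have hlip : LipschitzWith (a.toNNReal * a.toNNReal + a.toNNReal * K)
      (fun x => c x • g' x) := by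
    refine LipschitzWith.of_dist_le_mul fun x y => ?_
    rw [dist_eq_norm, dist_eq_norm]
    push_cast
    rw [Real.coe_toNNReal a ha]
    have h1 : c x • g' x - c y • g' y = (c x - c y) • g' x + c y • (g' x - g' y) := by
      module
    rw [h1]
    calc ‖(c x - c y) • g' x + c y • (g' x - g' y)‖
        ≤ ‖c x - c y‖ * ‖g' x‖ + ‖c y‖ * ‖g' x - g' y‖ := by
          rw [← norm_smul, ← norm_smul]
          exact norm_add_le _ _
      _ ≤ a * a * ‖x - y‖ * 1 + a * (K * ‖x - y‖) := by
          gcongr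
          · exact hclip x y
          · exact hg1 x
          · exact hcle y
          · exact hK.norm_sub_le x y
      _ = _ := by ring
  have hder (x : EuclideanSpace ℝ (Fin n)) :
      HasFDerivAt (fun x => stdPhi (a * (s - g x))) (c x • g' x) x := by
    have h1 : HasFDerivAt (fun x => a * (s - g x)) (a • -g' x) x :=
      ((hd x).const_sub s).const_mul a
    refine ((hasDerivAt_stdPhi _).comp_hasFDerivAt x h1).congr_fderiv ?_
    simp only [hc]
    module
  have hbob := gaussProfile_integral_stdGaussian_le (B := a) (fun x => stdPhi_mem_Ioo _) hder
    (fun x => by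
      rw [norm_smul]
      exact (mul_le_of_le_one_right (norm_nonneg _) (hg1 x)).trans (hcle x)) hlip
  refine hbob.trans ?_
  rw [← integral_const_mul]
  refine integral_mono_of_nonneg (Eventually.of_forall fun x => Real.sqrt_nonneg _) ?_
    (Eventually.of_forall fun x => ?_)
  · refine Integrable.of_bound ?_ (√(1 + a ^ 2)) (Eventually.of_forall fun x => ?_)
    · have := hg.continuous
      exact (continuous_const.mul
        (continuous_gaussianPDFReal_std.comp (by fun_prop))).aestronglyMeasurable
    · rw [norm_mul, Real.norm_of_nonneg (Real.sqrt_nonneg _),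
        Real.norm_of_nonneg (gaussianPDFReal_std_pos _).le]
      exact mul_le_of_le_one_right (Real.sqrt_nonneg _) (gaussianPDFReal_std_le_one _)
  · have hp := (gaussianPDFReal_std_pos (a * (s - g x))).le
    simp only
    rw [gaussProfile_stdPhi, norm_smul, hcabs, Real.sqrt_le_left (by positivity),
      mul_pow (√(1 + a ^ 2)), Real.sq_sqrt (by positivity)]
    have h2 : (a * gaussianPDFReal 0 1 (a * (s - g x)) * ‖g' x‖) ^ 2
        ≤ (a * gaussianPDFReal 0 1 (a * (s - g x)) * 1) ^ 2 := by
      gcongr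
      exact hg1 x
    linarith

theorem stdQuantile_smoothCdf_add_le {n : ℕ} {g : EuclideanSpace ℝ (Fin n) → ℝ}
    {g' : EuclideanSpace ℝ (Fin n) → EuclideanSpace ℝ (Fin n) →L[ℝ] ℝ} {K : ℝ≥0}
    (hd : ∀ x, HasFDerivAt g (g' x) x) (hg : LipschitzWith 1 g) (hK : LipschitzWith K g')
    {a : ℝ} (ha : 0 ≤ a) (s : ℝ) {t : ℝ} (ht : 0 ≤ t) :
    stdQuantile (smoothCdf (stdGaussian (EuclideanSpace ℝ (Fin n))) g a s) + a / √(1 + a ^ 2) * t ≤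
      stdQuantile (smoothCdf (stdGaussian (EuclideanSpace ℝ (Fin n))) g a (s + t)) := by
  set M := smoothCdf (stdGaussian (EuclideanSpace ℝ (Fin n))) g a with hM
  have hMmem (u : ℝ) : M u ∈ Ioo (0 : ℝ) 1 := smoothCdf_mem_Ioo hg.continuous a u
  have hder (u : ℝ) : HasDerivAt (fun u => stdQuantile (M u) - a / √(1 + a ^ 2) * u)
      ((gaussProfile (M u))⁻¹ * (∫ x, a * gaussianPDFReal 0 1 (a * (u - g x))
        ∂stdGaussian (EuclideanSpace ℝ (Fin n))) - a / √(1 + a ^ 2)) u := by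
    refine (((hasDerivAt_stdQuantile (hMmem u)).comp u
      (hasDerivAt_smoothCdf hg.continuous ha u)).sub
        ((hasDerivAt_id u).const_mul (a / √(1 + a ^ 2)))).congr_deriv ?_
    rw [mul_one, gaussProfile]
  have hmono : Monotone fun u => stdQuantile (M u) - a / √(1 + a ^ 2) * u := by
    refine monotone_of_deriv_nonneg (fun u => (hder u).differentiableAt) fun u => ?_
    rw [(hder u).deriv, sub_nonneg, integral_const_mul, div_le_iff₀ (by positivity)]
    have h1 := gaussProfile_smoothCdf_le hd hg hK ha u
    have h2 := gaussProfile_pos (M u)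
    calc a = a * ((gaussProfile (M u))⁻¹ * gaussProfile (M u)) := by
          rw [inv_mul_cancel₀ h2.ne', mul_one]
      _ ≤ a * ((gaussProfile (M u))⁻¹ * (√(1 + a ^ 2) * ∫ x, gaussianPDFReal 0 1 (a * (u - g x))
            ∂stdGaussian (EuclideanSpace ℝ (Fin n)))) := by gcongr
      _ = _ := by ring
  have := hmono (le_add_of_nonneg_right ht : s ≤ s + t)
  simp only at this
  linarith

/-! ### Mollification of Lipschitz functions -/

section

open scoped Convolution

variable {E G F : Type*} [NormedAddCommGroup E] [NormedSpace ℝ E] [FiniteDimensional ℝ E]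
  [MeasurableSpace E] [BorelSpace E] [NormedAddCommGroup G] [NormedSpace ℝ G]
  [NormedAddCommGroup F] [NormedSpace ℝ F] {μ : Measure E} [μ.IsAddHaarMeasure]

lemma norm_convolution_sub_le {k : E → G} (hk : Continuous k) (hks : HasCompactSupport k)
    (L : G →L[ℝ] ℝ →L[ℝ] F) {g : E → ℝ} (hg : LipschitzWith 1 g) (x y : E) :
    ‖(k ⋆[L, μ] g) x - (k ⋆[L, μ] g) y‖ ≤ ‖L‖ * (∫ t, ‖k t‖ ∂μ) * ‖x - y‖ := by
  have hex (z : E) : Integrable (fun t => L (k t) (g (z - t))) μ :=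
    hks.convolutionExists_left L hk hg.continuous.locallyIntegrable z
  rw [convolution_def, convolution_def, ← integral_sub (hex x) (hex y), ← integral_const_mul,
    ← integral_mul_const]
  have hki : Integrable (fun t => ‖k t‖) μ := (hk.integrable_of_hasCompactSupport hks).norm
  refine norm_integral_le_of_norm_le ((hki.const_mul _).mul_const _)
    (Eventually.of_forall fun t => ?_)
  rw [← map_sub]
  refine (L.le_opNorm₂ _ _).trans ?_
  gcongr
  simpa using hg.norm_sub_le (x - t) (y - t)

lemma exists_lipschitzWith_convolution {k : E → G} (hk : Continuous k) (hks : HasCompactSupport k)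
    (L : G →L[ℝ] ℝ →L[ℝ] F) {g : E → ℝ} (hg : LipschitzWith 1 g) :
    ∃ K : ℝ≥0, LipschitzWith K (k ⋆[L, μ] g) := by
  refine ⟨(‖L‖ * ∫ t, ‖k t‖ ∂μ).toNNReal, LipschitzWith.of_dist_le_mul fun x y => ?_⟩
  rw [dist_eq_norm, dist_eq_norm, Real.coe_toNNReal _ (by positivity)]
  exact norm_convolution_sub_le hk hks L hg x y

theorem LipschitzWith.exists_smooth_approx {g : E → ℝ} (hg : LipschitzWith 1 g) {ε : ℝ}
    (hε : 0 < ε) :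
    ∃ (h : E → ℝ) (h' : E → E →L[ℝ] ℝ) (K : ℝ≥0), (∀ x, HasFDerivAt h (h' x) x) ∧
      LipschitzWith 1 h ∧ LipschitzWith K h' ∧ ∀ x, |h x - g x| ≤ ε := by
  let b : ContDiffBump (0 : E) := ⟨ε / 2, ε, by positivity, by linarith⟩
  let μ : Measure E := Measure.addHaar
  set k := b.normed μ with hk
  have hkc : ContDiff ℝ 1 k := b.contDiff_normed
  have hks : HasCompactSupport k := b.hasCompactSupport_normed
  have hki : ∫ t, ‖k t‖ ∂μ = 1 := by
    rw [← b.integral_normed (μ := μ)]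
    exact integral_congr_ae (Eventually.of_forall fun t =>
      Real.norm_of_nonneg (b.nonneg_normed t))
  set L : ℝ →L[ℝ] ℝ →L[ℝ] ℝ := ContinuousLinearMap.lsmul ℝ ℝ
  obtain ⟨K, hK⟩ := exists_lipschitzWith_convolution (μ := μ)
    (hkc.continuous_fderiv one_ne_zero) (hks.fderiv ℝ) (L.precompL E) hg
  refine ⟨k ⋆[L, μ] g, fderiv ℝ k ⋆[L.precompL E, μ] g, K, fun x => ?_, ?_, hK, fun x => ?_⟩
  · exact hks.hasFDerivAt_convolution_left L hkc hg.continuous.locallyIntegrable x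
  · refine LipschitzWith.of_dist_le_mul fun x y => ?_
    have h1 := norm_convolution_sub_le (μ := μ) hkc.continuous hks L hg x y
    rw [hki, mul_one] at h1
    rw [dist_eq_norm, dist_eq_norm]
    refine h1.trans ?_
    gcongr
    exact ContinuousLinearMap.opNorm_lsmul_le
  · rw [← Real.dist_eq]
    refine b.dist_normed_convolution_le hg.continuous.aestronglyMeasurable fun z hz => ?_
    have h1 := hg.dist_le_mul z x
    rw [Metric.mem_ball] at hz
    rw [NNReal.coe_one, one_mul] at h1
    exact h1.trans hz.le

end

/-! ### Gaussian concentration around a median -/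

section

variable {E : Type*} [MeasurableSpace E] [TopologicalSpace E] [BorelSpace E]
  {μ : Measure E} [IsProbabilityMeasure μ] {g : E → ℝ}

lemma integrable_stdPhi_comp (hg : Continuous g) : Integrable (fun x => stdPhi (g x)) μ := by
  refine Integrable.of_bound (continuous_stdPhi.comp hg).aestronglyMeasurable 1
    (Eventually.of_forall fun x => ?_)
  rw [Real.norm_eq_abs, abs_of_pos (stdPhi_mem_Ioo _).1]
  exact (stdPhi_mem_Ioo _).2.le

lemma mul_measureReal_le_smoothCdf (hg : Continuous g) {a : ℝ} (ha : 0 ≤ a) (r δ : ℝ) :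
    stdPhi (a * δ) * μ.real {x | g x ≤ r} ≤ smoothCdf μ g a (r + δ) := by
  have hm : MeasurableSet {x | g x ≤ r} := (isClosed_le hg continuous_const).measurableSet
  rw [smoothCdf, mul_comm, ← smul_eq_mul, ← integral_indicator_const _ hm]
  refine integral_mono ((integrable_const _).indicator hm)
    (integrable_stdPhi_comp (by fun_prop)) fun x => ?_
  refine indicator_apply_le' (fun hx => ?_) (fun _ => (stdPhi_mem_Ioo _).1.le)
  refine strictMono_stdPhi.monotone (mul_le_mul_of_nonneg_left ?_ ha)
  have : g x ≤ r := hx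
  linarith

lemma smoothCdf_le_measureReal_add (hg : Continuous g) {a : ℝ} (ha : 0 ≤ a) (s δ : ℝ) :
    smoothCdf μ g a s ≤ μ.real {x | g x ≤ s + δ} + stdPhi (-(a * δ)) := by
  have hm : MeasurableSet {x | g x ≤ s + δ} := (isClosed_le hg continuous_const).measurableSet
  have h1 : μ.real {x | g x ≤ s + δ} + stdPhi (-(a * δ))
      = ∫ x, ({x | g x ≤ s + δ}.indicator (fun _ => (1 : ℝ)) x + stdPhi (-(a * δ))) ∂μ := by
    rw [integral_add ((integrable_const _).indicator hm) (integrable_const _),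
      integral_indicator_const _ hm]
    simp
  rw [smoothCdf, h1]
  refine integral_mono (integrable_stdPhi_comp (by fun_prop))
    (((integrable_const _).indicator hm).add (integrable_const _)) fun x => ?_
  by_cases hx : g x ≤ s + δ
  · simp only [indicator_of_mem (show x ∈ {x | g x ≤ s + δ} from hx)]
    linarith [(stdPhi_mem_Ioo (a * (s - g x))).2, (stdPhi_mem_Ioo (-(a * δ))).1]
  · simp only [indicator_of_notMem (show x ∉ {x | g x ≤ s + δ} from hx), zero_add]
    refine strictMono_stdPhi.monotone ?_
    rw [← mul_neg]
    exact mul_le_mul_of_nonneg_left (by linarith) ha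

end

lemma tendsto_div_sqrt_one_add_sq : Tendsto (fun a : ℝ => a / √(1 + a ^ 2)) atTop (𝓝 1) := by
  have h1 : Tendsto (fun a : ℝ => √((a⁻¹) ^ 2 + 1)) atTop (𝓝 1) := by
    have := ((tendsto_inv_atTop_zero (𝕜 := ℝ)).pow 2).add_const 1
    simpa using this.sqrt
  have h2 := h1.inv₀ one_ne_zero
  rw [inv_one] at h2
  refine h2.congr' ?_
  filter_upwards [eventually_gt_atTop 0] with a ha
  have h3 : (a⁻¹) ^ 2 + 1 = (1 + a ^ 2) / a ^ 2 := by
    field_simp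
  rw [h3, Real.sqrt_div' _ (sq_nonneg a), Real.sqrt_sq ha.le, inv_div]

lemma stdPhi_le_measureReal_of_smooth {n : ℕ} {g : EuclideanSpace ℝ (Fin n) → ℝ}
    {g' : EuclideanSpace ℝ (Fin n) → EuclideanSpace ℝ (Fin n) →L[ℝ] ℝ} {K : ℝ≥0}
    (hd : ∀ x, HasFDerivAt g (g' x) x) (hg : LipschitzWith 1 g) (hK : LipschitzWith K g')
    {r t δ : ℝ} (ht : 0 ≤ t) (hδ : 0 < δ)
    (hr : 1 / 2 ≤ (stdGaussian (EuclideanSpace ℝ (Fin n))).real {x | g x ≤ r}) :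
    stdPhi t ≤ (stdGaussian (EuclideanSpace ℝ (Fin n))).real {x | g x ≤ r + δ + t + δ} := by
  have hδa : Tendsto (fun a : ℝ => a * δ) atTop atTop := tendsto_id.atTop_mul_const hδ
  have h1 : Tendsto (fun a : ℝ => stdPhi (a * δ) * (1 / 2)) atTop (𝓝 (1 * (1 / 2))) :=
    (tendsto_stdPhi_atTop.comp hδa).mul_const _
  have hhalf : stdQuantile (1 * (1 / 2)) = 0 := by
    rw [one_mul, ← stdPhi_zero, stdQuantile_stdPhi]
  have h2 := (hasDerivAt_stdQuantile (p := 1 * (1 / 2))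
    (by norm_num)).continuousAt.tendsto.comp h1
  rw [hhalf] at h2
  have h3 := h2.add (tendsto_div_sqrt_one_add_sq.mul_const t)
  rw [zero_add, one_mul] at h3
  have h4 := ((continuous_stdPhi.tendsto t).comp h3).sub
    (tendsto_stdPhi_atBot.comp (tendsto_neg_atTop_atBot.comp hδa))
  rw [sub_zero] at h4
  refine le_of_tendsto h4 ?_
  filter_upwards [eventually_ge_atTop 0] with a ha
  have hmem := smoothCdf_mem_Ioo (μ := stdGaussian (EuclideanSpace ℝ (Fin n))) hg.continuous a
  have h5 := mul_measureReal_le_smoothCdf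
    (μ := stdGaussian (EuclideanSpace ℝ (Fin n))) hg.continuous ha r δ
  have h6 := smoothCdf_le_measureReal_add
    (μ := stdGaussian (EuclideanSpace ℝ (Fin n))) hg.continuous ha (r + δ + t) δ
  have h7 := strictMono_stdPhi.monotone (stdQuantile_smoothCdf_add_le hd hg hK ha (r + δ) ht)
  rw [stdPhi_stdQuantile (hmem _)] at h7
  have hphi := stdPhi_mem_Ioo (a * δ)
  have h8 : stdQuantile (stdPhi (a * δ) * (1 / 2))
      ≤ stdQuantile (smoothCdf (stdGaussian (EuclideanSpace ℝ (Fin n))) g a (r + δ)) := by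
    refine stdQuantile_le_stdQuantile ⟨by linarith [hphi.1], by linarith [hphi.2]⟩ (hmem _)
      (le_trans ?_ h5)
    exact mul_le_mul_of_nonneg_left hr hphi.1.le
  have h9 := strictMono_stdPhi.monotone
    (add_le_add_left h8 (a / √(1 + a ^ 2) * t))
  simp only [Function.comp_apply]
  linarith

/-- **Gaussian concentration**: a `1`-Lipschitz function exceeds a median by more than `t` with
probability at most `1 - Φ(t)`. -/
theorem stdPhi_le_measureReal_of_lipschitz {n : ℕ} {g : EuclideanSpace ℝ (Fin n) → ℝ}
    (hg : LipschitzWith 1 g) {r t : ℝ} (ht : 0 ≤ t)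
    (hr : 1 / 2 ≤ (stdGaussian (EuclideanSpace ℝ (Fin n))).real {x | g x ≤ r}) :
    stdPhi t ≤ (stdGaussian (EuclideanSpace ℝ (Fin n))).real {x | g x ≤ r + t} := by
  set γ := stdGaussian (EuclideanSpace ℝ (Fin n)) with hγ
  have hstep (η : ℝ) (hη : 0 < η) : stdPhi t ≤ γ.real {x | g x ≤ r + t + η} := by
    obtain ⟨h, h', K, hd, hh, hK, hclose⟩ := hg.exists_smooth_approx (ε := η / 4) (by positivity)
    have h1 : 1 / 2 ≤ γ.real {x | h x ≤ r + η / 4} := by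
      refine hr.trans (measureReal_mono fun x hx => ?_)
      have h2 : g x ≤ r := hx
      have h3 := (abs_le.1 (hclose x)).2
      show h x ≤ r + η / 4
      linarith
    refine (stdPhi_le_measureReal_of_smooth hd hh hK (δ := η / 4) ht (by positivity) h1).trans
      (measureReal_mono fun x hx => ?_)
    have h2 : h x ≤ r + η / 4 + η / 4 + t + η / 4 := hx
    have h3 := (abs_le.1 (hclose x)).1
    show g x ≤ r + t + η
    linarith
  have hgm : Measurable g := hg.continuous.measurable
  have : IsProbabilityMeasure (γ.map g) := Measure.isProbabilityMeasure_map hgm.aemeasurable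
  have hcdf (u : ℝ) : cdf (γ.map g) u = γ.real {x | g x ≤ u} := by
    rw [cdf_eq_real, map_measureReal_apply hgm measurableSet_Iic]
    rfl
  rw [← hcdf]
  have hlim : Tendsto (cdf (γ.map g)) (𝓝[>] (r + t)) (𝓝 (cdf (γ.map g) (r + t))) :=
    ((cdf (γ.map g)).right_continuous (r + t)).tendsto.mono_left
      (nhdsWithin_mono _ Ioi_subset_Ici_self)
  refine ge_of_tendsto hlim ?_
  filter_upwards [self_mem_nhdsWithin] with u hu
  have := hstep (u - (r + t)) (sub_pos.2 hu)
  rwa [add_sub_cancel, ← hcdf] at this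

/-! ### Convex penalized least squares is a contraction in the data -/

section

variable {V E : Type*} [AddCommGroup V] [Module ℝ V] [NormedAddCommGroup E]
  [InnerProductSpace ℝ E] {F : V → ℝ≥0∞} {A : V →ₗ[ℝ] E}

lemma inner_le_toReal_sub_of_minimizer
    (hF : ∀ (a b : V) (s : ℝ), 0 ≤ s → s ≤ 1 →
      F (s • a + (1 - s) • b) ≤ ENNReal.ofReal s * F a + ENNReal.ofReal (1 - s) * F b)
    {y : E} {z w : V} (hz : F z ≠ ⊤) (hw : F w ≠ ⊤)
    (hmin : ∀ b, ENNReal.ofReal (‖y - A z‖ ^ 2) + 2 * F z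
      ≤ ENNReal.ofReal (‖y - A b‖ ^ 2) + 2 * F b) :
    inner ℝ (y - A z) (A w - A z) ≤ (F w).toReal - (F z).toReal := by
  have hstep (s : ℝ) (hs0 : 0 < s) (hs1 : s ≤ 1) :
      inner ℝ (y - A z) (A w - A z) - ((F w).toReal - (F z).toReal)
        ≤ s * (‖A w - A z‖ ^ 2 / 2) := by
    have h1 : ENNReal.ofReal (‖y - A z‖ ^ 2) + 2 * F z
        ≤ ENNReal.ofReal (‖y - A (s • w + (1 - s) • z)‖ ^ 2)
          + 2 * (ENNReal.ofReal s * F w + ENNReal.ofReal (1 - s) * F z) :=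
      (hmin _).trans (by gcongr; exact hF w z s hs0.le hs1)
    have h2 : y - A (s • w + (1 - s) • z) = (y - A z) - s • (A w - A z) := by
      rw [map_add, map_smul, map_smul]
      module
    lift F z to ℝ≥0 using hz with p hp
    lift F w to ℝ≥0 using hw with q hq
    have h3 := ENNReal.toReal_mono (by finiteness) h1
    rw [ENNReal.toReal_add (by finiteness) (by finiteness),
      ENNReal.toReal_add (by finiteness) (by finiteness), ENNReal.toReal_mul, ENNReal.toReal_mul,
      ENNReal.toReal_add (by finiteness) (by finiteness), ENNReal.toReal_mul, ENNReal.toReal_mul,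
      ENNReal.toReal_ofReal (by positivity), ENNReal.toReal_ofReal (by positivity),
      ENNReal.toReal_ofReal hs0.le, ENNReal.toReal_ofReal (by linarith), h2,
      norm_sub_sq_real (y - A z) (s • _), inner_smul_right, norm_smul,
      Real.norm_of_nonneg hs0.le] at h3
    simp only [ENNReal.toReal_ofNat, ENNReal.coe_toReal] at h3 ⊢
    refine le_of_mul_le_mul_left ?_ hs0
    nlinarith
  have hlim : Tendsto (fun s : ℝ => s * (‖A w - A z‖ ^ 2 / 2)) (𝓝[>] 0)
      (𝓝 (0 * (‖A w - A z‖ ^ 2 / 2))) :=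
    (tendsto_id.mono_left nhdsWithin_le_nhds).mul_const _
  rw [zero_mul] at hlim
  rw [← sub_nonpos]
  refine ge_of_tendsto hlim ?_
  filter_upwards [Ioc_mem_nhdsGT one_pos] with s hs
  exact hstep s hs.1 hs.2

lemma ne_top_of_minimizer (hF : ∃ b, F b ≠ ⊤) {y : E} {z : V}
    (hmin : ∀ b, ENNReal.ofReal (‖y - A z‖ ^ 2) + 2 * F z
      ≤ ENNReal.ofReal (‖y - A b‖ ^ 2) + 2 * F b) : F z ≠ ⊤ := by
  obtain ⟨b, hb⟩ := hF
  intro h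
  have h1 := hmin b
  rw [h, ENNReal.mul_top two_ne_zero, add_top, top_le_iff] at h1
  exact absurd h1 (by finiteness)

theorem norm_sub_le_of_minimizers
    (hF : ∀ (a b : V) (s : ℝ), 0 ≤ s → s ≤ 1 →
      F (s • a + (1 - s) • b) ≤ ENNReal.ofReal s * F a + ENNReal.ofReal (1 - s) * F b)
    (hF' : ∃ b, F b ≠ ⊤) {y y' : E} {z z' : V}
    (hz : ∀ b, ENNReal.ofReal (‖y - A z‖ ^ 2) + 2 * F z
      ≤ ENNReal.ofReal (‖y - A b‖ ^ 2) + 2 * F b)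
    (hz' : ∀ b, ENNReal.ofReal (‖y' - A z'‖ ^ 2) + 2 * F z'
      ≤ ENNReal.ofReal (‖y' - A b‖ ^ 2) + 2 * F b) :
    ‖A z - A z'‖ ≤ ‖y - y'‖ := by
  have hfin := ne_top_of_minimizer hF' hz
  have hfin' := ne_top_of_minimizer hF' hz'
  have h1 := inner_le_toReal_sub_of_minimizer hF hfin hfin' hz
  have h2 := inner_le_toReal_sub_of_minimizer hF hfin' hfin hz'
  have h3 : ‖A z - A z'‖ ^ 2 ≤ inner ℝ (y - y') (A z - A z') := by
    have h4 : ‖A z - A z'‖ ^ 2 = inner ℝ (y - y') (A z - A z')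
        + (inner ℝ (y - A z) (A z' - A z) + inner ℝ (y' - A z') (A z - A z')) := by
      rw [← neg_sub (A z) (A z'), inner_neg_right, ← real_inner_self_eq_norm_sq]
      simp only [inner_sub_left]
      ring
    linarith
  have h5 := h3.trans (real_inner_le_norm _ _)
  by_contra! h
  nlinarith [norm_nonneg (y - y')]

end

/-! ### Transfer to the white noise model -/

/-- The isometry from `ℝⁿ` with the scaled norm to Euclidean space. -/
noncomputable def scaledToLp (n : ℕ) : (Fin n → ℝ) →ₗ[ℝ] EuclideanSpace ℝ (Fin n) :=
  (√(n : ℝ))⁻¹ • (WithLp.linearEquiv 2 ℝ (Fin n → ℝ)).symm.toLinearMap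

lemma norm_scaledToLp {n : ℕ} (u : Fin n → ℝ) : ‖scaledToLp n u‖ = scaledNorm u := by
  have h : scaledToLp n u = (√(n : ℝ))⁻¹ • WithLp.toLp 2 u := rfl
  rw [h, norm_smul, norm_inv, Real.norm_of_nonneg (Real.sqrt_nonneg _), EuclideanSpace.norm_eq,
    scaledNorm, Real.sqrt_div' _ (Nat.cast_nonneg n), div_eq_inv_mul]
  simp

lemma gaussianVec_eq_map_stdGaussian (n : ℕ) (σ : ℝ) :
    gaussianVec n σ = (stdGaussian (EuclideanSpace ℝ (Fin n))).map fun x i => σ * x i := by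
  have h1 : gaussianReal 0 ⟨σ ^ 2, sq_nonneg σ⟩ = (gaussianReal 0 1).map (σ * ·) := by
    rw [gaussianReal_map_const_mul, mul_zero, mul_one]
    rfl
  rw [gaussianVec, h1, ← map_pi_eq_stdGaussian, Measure.map_map (by fun_prop) (by fun_prop),
    ← Measure.pi_map_pi (fun _ => by fun_prop)]
  rfl

lemma one_sub_exp_le_stdPhi {t : ℝ} (ht : 0 ≤ t) : 1 - Real.exp (-(t ^ 2 / 2)) ≤ stdPhi t := by
  have h1 := measure_le_le_exp_mul_mgf (X := fun x : ℝ => x) (μ := gaussianReal 0 1) (-t)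
    (neg_nonpos.2 ht) (integrable_exp_mul_gaussianReal (-t))
  rw [mgf_fun_id_gaussianReal, ← Real.exp_add] at h1
  have h2 : stdPhi (-t) ≤ Real.exp (-(t ^ 2 / 2)) := by
    refine (le_of_eq rfl).trans (h1.trans (le_of_eq ?_))
    congr 1
    simp only [NNReal.coe_one]
    ring
  linarith [stdPhi_neg t]

end

theorem stmt4 (n p : ℕ) (hn : 0 < n) (σ : ℝ) (hσ : 0 < σ) (f : Fin n → ℝ)
    (F : (Fin p → ℝ) → ℝ≥0∞)
    -- `F` is convex (with values in `[0,+∞]`)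
    (hFconv : ∀ (a b : Fin p → ℝ) (s : ℝ), 0 ≤ s → s ≤ 1 →
      F (s • a + (1 - s) • b) ≤ ENNReal.ofReal s * F a + ENNReal.ofReal (1 - s) * F b)
    -- `F` is proper: finite at some point
    (hFproper : ∃ b, F b ≠ ⊤)
    (X : Matrix (Fin n) (Fin p) ℝ)
    (βhat : (Fin n → ℝ) → (Fin p → ℝ))
    (hmin : ∀ (y : Fin n → ℝ) (b : Fin p → ℝ),
      ENNReal.ofReal (scaledNorm (y - X.mulVec (βhat y)) ^ 2) + 2 * F (βhat y)
        ≤ ENNReal.ofReal (scaledNorm (y - X.mulVec b) ^ 2) + 2 * F b)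
    (R : ℝ) (hR : 0 ≤ R)
    (hhalf : gaussianVec n σ {ξ | scaledNorm (X.mulVec (βhat (f + ξ)) - f) ≤ R} ≥ 1/2) :
    (∀ t : ℝ, 0 < t →
      gaussianVec n σ
          {ξ | scaledNorm (X.mulVec (βhat (f + ξ)) - f) ≤ R + σ * t / Real.sqrt n}
        ≥ ENNReal.ofReal (stdPhi t)) ∧
    (∀ x : ℝ, 0 < x →
      gaussianVec n σ
          {ξ | scaledNorm (X.mulVec (βhat (f + ξ)) - f) ≤ R + σ * Real.sqrt (2 * x / n)}
        ≥ 1 - ENNReal.ofReal (Real.exp (-x))) := by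
  set T := scaledToLp n with hT
  set A : (Fin p → ℝ) →ₗ[ℝ] EuclideanSpace ℝ (Fin n) := T ∘ₗ X.mulVecLin with hA
  have hA_apply (b : Fin p → ℝ) : A b = T (X.mulVec b) := rfl
  have hn0 : (0 : ℝ) < √(n : ℝ) := Real.sqrt_pos.2 (by exact_mod_cast hn)
  have hmin' (y : Fin n → ℝ) (b : Fin p → ℝ) :
      ENNReal.ofReal (‖T y - A (βhat y)‖ ^ 2) + 2 * F (βhat y)
        ≤ ENNReal.ofReal (‖T y - A b‖ ^ 2) + 2 * F b := by
    rw [hA_apply, hA_apply, ← map_sub, ← map_sub, norm_scaledToLp, norm_scaledToLp]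
    exact hmin y b
  set e : EuclideanSpace ℝ (Fin n) → Fin n → ℝ := fun x i => σ * x i with he
  set err : (Fin n → ℝ) → ℝ := fun ξ => scaledNorm (X.mulVec (βhat (f + ξ)) - f) with herr
  have herr_eq (ξ : Fin n → ℝ) : err ξ = ‖A (βhat (f + ξ)) - T f‖ := by
    rw [hA_apply, ← map_sub, norm_scaledToLp]
  have hcontr (ξ ξ' : Fin n → ℝ) : |err ξ - err ξ'| ≤ ‖T (ξ - ξ')‖ := by
    rw [herr_eq, herr_eq]
    refine (abs_norm_sub_norm_le _ _).trans ?_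
    rw [sub_sub_sub_cancel_right]
    refine (norm_sub_le_of_minimizers hFconv hFproper (hmin' _) (hmin' _)).trans (le_of_eq ?_)
    rw [← map_sub, add_sub_add_left_eq_sub]
  have hTe (x x' : EuclideanSpace ℝ (Fin n)) : T (e x - e x') = (σ / √(n : ℝ)) • (x - x') := by
    ext i
    simp [hT, he, scaledToLp]
    ring
  have hlip : LipschitzWith 1 fun x => √(n : ℝ) / σ * err (e x) := by
    refine LipschitzWith.of_dist_le_mul fun x x' => ?_
    have h1 := hcontr (e x) (e x')
    rw [hTe, norm_smul, Real.norm_of_nonneg (by positivity)] at h1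
    rw [Real.dist_eq, ← mul_sub, abs_mul, abs_of_pos (by positivity), dist_eq_norm,
      NNReal.coe_one, one_mul]
    calc √(n : ℝ) / σ * |err (e x) - err (e x')|
        ≤ √(n : ℝ) / σ * (σ / √(n : ℝ) * ‖x - x'‖) := by gcongr
      _ = ‖x - x'‖ := by field_simp
  have herr_cont : Continuous err := by
    have hTc : Continuous T := T.continuous_of_finiteDimensional
    refine continuous_iff_continuousAt.2 fun ξ => tendsto_iff_dist_tendsto_zero.2 ?_
    refine squeeze_zero (fun _ => dist_nonneg) (fun ξ' => hcontr ξ' ξ) ?_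
    have h1 : Continuous fun ξ' => ‖T (ξ' - ξ)‖ := by fun_prop
    simpa using h1.tendsto ξ
  have hmeas (c : ℝ) : gaussianVec n σ {ξ | err ξ ≤ c} = ENNReal.ofReal
      ((stdGaussian (EuclideanSpace ℝ (Fin n))).real
        {x | √(n : ℝ) / σ * err (e x) ≤ √(n : ℝ) / σ * c}) := by
    rw [gaussianVec_eq_map_stdGaussian, Measure.map_apply (by fun_prop)
      (isClosed_le herr_cont continuous_const).measurableSet, ofReal_measureReal]
    congr 1
    ext x
    exact (mul_le_mul_iff_right₀ (show 0 < √(n : ℝ) / σ by positivity)).symm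
  have hmain (t : ℝ) (ht : 0 < t) :
      ENNReal.ofReal (stdPhi t) ≤ gaussianVec n σ {ξ | err ξ ≤ R + σ * t / √(n : ℝ)} := by
    rw [hmeas]
    have h1 : √(n : ℝ) / σ * (R + σ * t / √(n : ℝ)) = √(n : ℝ) / σ * R + t := by
      field_simp
    rw [h1]
    refine ENNReal.ofReal_le_ofReal (stdPhi_le_measureReal_of_lipschitz hlip ht.le ?_)
    have h2 : 1 / 2 ≤ gaussianVec n σ {ξ | err ξ ≤ R} := hhalf
    rw [hmeas] at h2
    have h3 := ENNReal.toReal_mono ENNReal.ofReal_ne_top h2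
    rw [ENNReal.toReal_ofReal measureReal_nonneg] at h3
    simpa using h3
  refine ⟨hmain, fun x hx => ?_⟩
  have h1 := hmain √(2 * x) (by positivity)
  have h2 := one_sub_exp_le_stdPhi (Real.sqrt_nonneg (2 * x))
  rw [Real.sq_sqrt (by positivity), mul_div_cancel_left₀ x two_ne_zero] at h2
  have h3 : σ * √(2 * x) / √(n : ℝ) = σ * √(2 * x / n) := by
    rw [Real.sqrt_div (by positivity), mul_div_assoc]
  rw [h3] at h1
  refine le_trans ?_ h1
  rw [← ENNReal.ofReal_one, ← ENNReal.ofReal_sub _ (Real.exp_pos _).le]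
  exact ENNReal.ofReal_le_ofReal h2
end

section
/- Let f ∈ ℝⁿ, ξ ∼ N(0, σ²I_{n×n}), y = f + ξ, let F: ℝᵖ → [0,+∞] be a proper convex function, 𝕏 ∈ ℝ^{n×p}, and let β̂(y) be any solution of min_{β∈ℝᵖ}( ‖y − 𝕏β‖² + 2F(β) ). Suppose there is a constant R ≥ 0 such that P( ‖𝕏β̂(y) − f‖ ≤ R ) ≥ 1/2. Then E‖𝕏β̂(y) − f‖ ≤ R + σ/√(2πn). -/
open MeasureTheory ProbabilityTheory
open scoped ENNReal NNReal

section GaussianAveraging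

open Filter Topology Set

/-- The standard normal density. -/
noncomputable def normalPDF (u : ℝ) : ℝ := gaussianPDFReal 0 1 u

/-- The standard normal cumulative distribution function. -/
noncomputable def normalCDF (u : ℝ) : ℝ := ∫ z in Iic u, normalPDF z

/-- The antiderivative of `normalCDF` vanishing at `-∞`. -/
noncomputable def normalCDFInt (u : ℝ) : ℝ := normalPDF u + u * normalCDF u

lemma normalPDF_eq (u : ℝ) : normalPDF u = (√(2 * Real.pi))⁻¹ * Real.exp (-u ^ 2 / 2) := by
  simp [normalPDF, gaussianPDFReal]

lemma normalPDF_pos (u : ℝ) : 0 < normalPDF u := gaussianPDFReal_pos _ _ _ one_ne_zero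

lemma hasDerivAt_normalPDF (u : ℝ) : HasDerivAt normalPDF (-u * normalPDF u) u := by
  have h1 : normalPDF = fun u => (√(2 * Real.pi))⁻¹ * Real.exp (-u ^ 2 / 2) :=
    funext normalPDF_eq
  have h2 : HasDerivAt (fun u : ℝ => -u ^ 2 / 2) (-u) u := by
    refine (((hasDerivAt_id u).pow 2).neg.div_const 2).congr_deriv ?_
    simp only [id_eq]
    push_cast
    ring
  rw [h1]
  refine (h2.exp.const_mul (√(2 * Real.pi))⁻¹).congr_deriv ?_
  ring

lemma continuous_normalPDF : Continuous normalPDF :=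
  continuous_iff_continuousAt.2 fun u => (hasDerivAt_normalPDF u).continuousAt

lemma integrable_normalPDF : Integrable normalPDF := integrable_gaussianPDFReal 0 1

lemma integral_normalPDF : ∫ z, normalPDF z = 1 := integral_gaussianPDFReal_eq_one 0 one_ne_zero

lemma hasDerivAt_normalCDF (u : ℝ) : HasDerivAt normalCDF (normalPDF u) u := by
  have h1 : normalCDF = fun u => normalCDF 0 + ∫ z in (0 : ℝ)..u, normalPDF z := by
    funext v
    have := intervalIntegral.integral_Iic_sub_Iic (μ := volume) (f := normalPDF) (a := 0) (b := v)
      integrable_normalPDF.integrableOn integrable_normalPDF.integrableOn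
    simp only [normalCDF]
    linarith
  rw [h1]
  exact (intervalIntegral.integral_hasDerivAt_right (integrable_normalPDF.intervalIntegrable)
    (continuous_normalPDF.stronglyMeasurableAtFilter _ _)
    continuous_normalPDF.continuousAt).const_add _

lemma continuous_normalCDF : Continuous normalCDF :=
  continuous_iff_continuousAt.2 fun u => (hasDerivAt_normalCDF u).continuousAt

lemma strictMono_normalCDF : StrictMono normalCDF :=
  strictMono_of_deriv_pos fun u => by
    rw [(hasDerivAt_normalCDF u).deriv]; exact normalPDF_pos u

lemma normalCDF_nonneg (u : ℝ) : 0 ≤ normalCDF u :=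
  setIntegral_nonneg measurableSet_Iic fun z _ => (normalPDF_pos z).le

lemma normalCDF_pos (u : ℝ) : 0 < normalCDF u :=
  (normalCDF_nonneg (u - 1)).trans_lt (strictMono_normalCDF (by linarith))

lemma normalCDF_le_one (u : ℝ) : normalCDF u ≤ 1 := by
  rw [← integral_normalPDF]
  exact setIntegral_le_integral integrable_normalPDF
    (Eventually.of_forall fun z => (normalPDF_pos z).le)

lemma normalCDF_lt_one (u : ℝ) : normalCDF u < 1 :=
  (strictMono_normalCDF (by linarith : u < u + 1)).trans_le (normalCDF_le_one _)

lemma normalCDF_eq_cdf (u : ℝ) : normalCDF u = cdf (gaussianReal 0 1) u := by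
  rw [cdf_eq_real, measureReal_def, gaussianReal_apply_eq_integral _ one_ne_zero]
  exact (ENNReal.toReal_ofReal (normalCDF_nonneg u)).symm

lemma exists_normalCDF_eq {p : ℝ} (h0 : 0 < p) (h1 : p < 1) : ∃ u, normalCDF u = p := by
  have e : normalCDF = cdf (gaussianReal 0 1) := funext normalCDF_eq_cdf
  have hb : Tendsto normalCDF atBot (𝓝 0) := by rw [e]; exact tendsto_cdf_atBot _
  have ht : Tendsto normalCDF atTop (𝓝 1) := by rw [e]; exact tendsto_cdf_atTop _
  obtain ⟨a, ha⟩ := (hb.eventually (gt_mem_nhds h0)).exists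
  obtain ⟨b, hb⟩ := (ht.eventually (lt_mem_nhds h1)).exists
  exact mem_range_of_exists_le_of_exists_ge continuous_normalCDF ⟨a, ha.le⟩ ⟨b, hb.le⟩

lemma normalCDF_zero : normalCDF 0 = 1 / 2 := by
  have h1 : ∫ z in Ioi (0:ℝ), normalPDF z = normalCDF 0 := by
    have := integral_comp_neg_Iic (0:ℝ) normalPDF
    rw [neg_zero] at this
    rw [← this, normalCDF]
    congr 1
    funext z
    simp [normalPDF_eq]
  have h2 : normalCDF 0 + ∫ z in Ioi (0:ℝ), normalPDF z = 1 := by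
    rw [← integral_normalPDF, normalCDF]
    exact intervalIntegral.integral_Iic_add_Ioi integrable_normalPDF.integrableOn
      integrable_normalPDF.integrableOn
  linarith

lemma integral_gaussianReal_eq (g : ℝ → ℝ) :
    ∫ z, g z ∂(gaussianReal 0 1) = ∫ z, normalPDF z * g z :=
  integral_gaussianReal_eq_integral_smul one_ne_zero

lemma integrable_id_mul_normalPDF : Integrable (fun z => z * normalPDF z) := by
  have := integrable_mul_exp_neg_mul_sq (b := 1 / 2) (by norm_num)
  refine (this.const_mul (√(2 * Real.pi))⁻¹).congr (Eventually.of_forall fun z => ?_)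
  simp only [normalPDF_eq]
  rw [show -z ^ 2 / 2 = -(1 / 2) * z ^ 2 by ring]
  ring

lemma tendsto_normalPDF_atBot : Tendsto normalPDF atBot (𝓝 0) := by
  have h := (tendsto_rpow_abs_mul_exp_neg_mul_sq_cocompact (a := 1/2) (by norm_num) 0)
  have h2 := (h.mono_left atBot_le_cocompact).const_mul (√(2 * Real.pi))⁻¹
  rw [mul_zero] at h2
  refine h2.congr fun z => ?_
  rw [normalPDF_eq]
  simp
  left
  ring

lemma integral_Iic_id_mul_normalPDF (u : ℝ) :
    ∫ z in Iic u, z * normalPDF z = -normalPDF u := by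
  have := integral_Iic_of_hasDerivAt_of_tendsto (a := u) (f := fun z => -normalPDF z)
    (f' := fun z => z * normalPDF z) (m := 0) (hasDerivAt_normalPDF u).continuousAt.neg.continuousWithinAt
    (fun z _ => (hasDerivAt_normalPDF z).fun_neg.congr_deriv (by ring))
    integrable_id_mul_normalPDF.integrableOn (by simpa using tendsto_normalPDF_atBot.neg)
  simpa using this

lemma integral_posPart_gaussianReal (u : ℝ) :
    ∫ z, max (u - z) 0 ∂(gaussianReal 0 1) = normalCDFInt u := by
  rw [integral_gaussianReal_eq]
  have h : (fun z => normalPDF z * max (u - z) 0)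
      = (Iic u).indicator (fun z => u * normalPDF z - z * normalPDF z) := by
    funext z
    by_cases hz : z ≤ u
    · rw [indicator_of_mem (show z ∈ Iic u from hz), max_eq_left (by linarith)]; ring
    · rw [indicator_of_notMem (show z ∉ Iic u from hz), max_eq_right (by linarith)]; ring
  rw [h, integral_indicator measurableSet_Iic,
    integral_sub (integrable_normalPDF.integrableOn.const_mul u)
      integrable_id_mul_normalPDF.integrableOn, integral_const_mul,
    integral_Iic_id_mul_normalPDF, normalCDFInt, normalCDF]
  ring

lemma hasDerivAt_normalCDFInt (u : ℝ) : HasDerivAt normalCDFInt (normalCDF u) u := by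
  refine ((hasDerivAt_normalPDF u).add
    ((hasDerivAt_id u).mul (hasDerivAt_normalCDF u))).congr_deriv ?_
  simp only [id_eq]
  ring

lemma strictMono_normalCDFInt : StrictMono normalCDFInt :=
  strictMono_of_deriv_pos fun u => by
    rw [(hasDerivAt_normalCDFInt u).deriv]; exact normalCDF_pos u

lemma normalCDFInt_nonneg (u : ℝ) : 0 ≤ normalCDFInt u := by
  rw [← integral_posPart_gaussianReal]
  exact integral_nonneg fun z => le_max_right _ _

lemma normalCDFInt_pos (u : ℝ) : 0 < normalCDFInt u :=
  (normalCDFInt_nonneg (u - 1)).trans_lt (strictMono_normalCDFInt (by linarith))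

lemma le_normalCDFInt (u : ℝ) : u ≤ normalCDFInt u := by
  have hi : Integrable (fun z : ℝ => z) (gaussianReal 0 1) := IsGaussian.integrable_id
  have h : ∫ z, (u - z) ∂(gaussianReal 0 1) = u := by
    rw [integral_sub (integrable_const _) hi]
    simp
  rw [← integral_posPart_gaussianReal]
  calc u = ∫ z, (u - z) ∂(gaussianReal 0 1) := h.symm
    _ ≤ _ := integral_mono ((integrable_const u).sub hi)
      (((integrable_const u).sub hi).pos_part) fun z => le_max_left _ _

lemma normalCDFInt_zero : normalCDFInt 0 = (√(2 * Real.pi))⁻¹ := by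
  simp [normalCDFInt, normalPDF_eq]

lemma le_normalCDFInt_add {c : ℝ} (hc : 0 ≤ c) (u : ℝ) :
    c ≤ normalCDFInt u + (1 - normalCDF u) / normalPDF c := by
  rcases le_or_gt c u with h | h
  · have := le_normalCDFInt u
    have h2 : 0 ≤ (1 - normalCDF u) / normalPDF c :=
      div_nonneg (by linarith [normalCDF_le_one u]) (normalPDF_pos c).le
    linarith
  · set v := max u 0 with hv
    have h1 : v ≤ normalCDFInt u := max_le (le_normalCDFInt u) (normalCDFInt_nonneg u)
    have hvc : v ≤ c := max_le h.le hc
    have h2 : normalPDF c * (c - v) ≤ normalCDF c - normalCDF v := by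
      refine Convex.mul_sub_le_image_sub_of_le_deriv (convex_Icc v c)
        continuous_normalCDF.continuousOn
        (fun x _ => (hasDerivAt_normalCDF x).differentiableAt.differentiableWithinAt)
        (fun x hx => ?_) v (left_mem_Icc.2 hvc) c (right_mem_Icc.2 hvc) hvc
      rw [interior_Icc] at hx
      have hx0 : 0 ≤ x := (le_max_right _ _).trans hx.1.le
      rw [(hasDerivAt_normalCDF x).deriv, normalPDF_eq, normalPDF_eq]
      have : x ≤ c := hx.2.le
      gcongr
    have h3 : normalCDF u ≤ normalCDF v := strictMono_normalCDF.monotone (le_max_left _ _)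
    have h4 : c - v ≤ (1 - normalCDF u) / normalPDF c := by
      rw [le_div_iff₀ (normalPDF_pos c)]
      linarith [normalCDF_le_one c]
    linarith

/-- The inverse of `normalCDF`. -/
noncomputable def normalQuantile : ℝ → ℝ := Function.invFun normalCDF

lemma normalQuantile_normalCDF (u : ℝ) : normalQuantile (normalCDF u) = u :=
  Function.leftInverse_invFun strictMono_normalCDF.injective u

lemma normalCDF_normalQuantile {p : ℝ} (hp : p ∈ Ioo (0 : ℝ) 1) :
    normalCDF (normalQuantile p) = p :=
  Function.invFun_eq (exists_normalCDF_eq hp.1 hp.2)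

lemma hasDerivAt_normalQuantile {p : ℝ} (hp : p ∈ Ioo (0 : ℝ) 1) :
    HasDerivAt normalQuantile (normalPDF (normalQuantile p))⁻¹ p := by
  have h1 : HasStrictDerivAt normalCDF (normalPDF (normalQuantile p)) (normalQuantile p) :=
    hasStrictDerivAt_of_hasDerivAt_of_continuousAt
      (Eventually.of_forall hasDerivAt_normalCDF) continuous_normalPDF.continuousAt
  have h2 := h1.to_local_left_inverse (normalPDF_pos _).ne'
    (Eventually.of_forall normalQuantile_normalCDF)
  rw [normalCDF_normalQuantile hp] at h2
  exact h2.hasDerivAt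

/-- The isoperimetric-type profile `p ↦ 𝔼 (u - Z)⁺`, where `u` is the `p`-quantile of the standard
normal variable `Z`. -/
noncomputable def excessProfile (p : ℝ) : ℝ := normalCDFInt (normalQuantile p)

/-- The first derivative of `excessProfile`. -/
noncomputable def excessProfileDeriv (p : ℝ) : ℝ := p / normalPDF (normalQuantile p)

/-- The second derivative of `excessProfile`. -/
noncomputable def excessProfileDeriv₂ (p : ℝ) : ℝ :=
  excessProfile p / normalPDF (normalQuantile p) ^ 2

lemma excessProfile_pos (p : ℝ) : 0 < excessProfile p := normalCDFInt_pos _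

lemma hasDerivAt_excessProfile {p : ℝ} (hp : p ∈ Ioo (0 : ℝ) 1) :
    HasDerivAt excessProfile (excessProfileDeriv p) p := by
  refine ((hasDerivAt_normalCDFInt _).comp p (hasDerivAt_normalQuantile hp)).congr_deriv ?_
  rw [normalCDF_normalQuantile hp, excessProfileDeriv, div_eq_mul_inv]

lemma hasDerivAt_normalPDF_normalQuantile {p : ℝ} (hp : p ∈ Ioo (0 : ℝ) 1) :
    HasDerivAt (fun p => normalPDF (normalQuantile p)) (-normalQuantile p) p := by
  refine ((hasDerivAt_normalPDF _).comp p (hasDerivAt_normalQuantile hp)).congr_deriv ?_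
  have := (normalPDF_pos (normalQuantile p)).ne'
  field_simp

lemma hasDerivAt_excessProfileDeriv {p : ℝ} (hp : p ∈ Ioo (0 : ℝ) 1) :
    HasDerivAt excessProfileDeriv (excessProfileDeriv₂ p) p := by
  have hw := (normalPDF_pos (normalQuantile p)).ne'
  refine ((hasDerivAt_id p).div (hasDerivAt_normalPDF_normalQuantile hp) hw).congr_deriv ?_
  rw [excessProfileDeriv₂, excessProfile, normalCDFInt, normalCDF_normalQuantile hp]
  congr 1
  simp only [id_eq]
  ring

lemma hasDerivAt_excessProfileDeriv₂ {p : ℝ} (hp : p ∈ Ioo (0 : ℝ) 1) :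
    HasDerivAt excessProfileDeriv₂ ((excessProfileDeriv p * normalPDF (normalQuantile p) ^ 2
      + 2 * excessProfile p * normalPDF (normalQuantile p) * normalQuantile p)
      / (normalPDF (normalQuantile p) ^ 2) ^ 2) p := by
  have hw := (normalPDF_pos (normalQuantile p)).ne'
  refine ((hasDerivAt_excessProfile hp).div ((hasDerivAt_normalPDF_normalQuantile hp).fun_pow 2)
    (pow_ne_zero 2 hw)).congr_deriv ?_
  congr 1
  push_cast
  ring

lemma continuousOn_normalQuantile : ContinuousOn normalQuantile (Ioo 0 1) :=
  fun _ hp => (hasDerivAt_normalQuantile hp).continuousAt.continuousWithinAt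

lemma continuousOn_excessProfile : ContinuousOn excessProfile (Ioo 0 1) :=
  fun _ hp => (hasDerivAt_excessProfile hp).continuousAt.continuousWithinAt

lemma strictMonoOn_normalQuantile : StrictMonoOn normalQuantile (Ioo 0 1) := by
  intro p hp q hq hpq
  rw [← strictMono_normalCDF.lt_iff_lt, normalCDF_normalQuantile hp, normalCDF_normalQuantile hq]
  exact hpq

lemma monotoneOn_excessProfile : MonotoneOn excessProfile (Ioo 0 1) := fun _ hp _ hq hpq =>
  strictMono_normalCDFInt.monotone (strictMonoOn_normalQuantile.monotoneOn hp hq hpq)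

lemma Icc_sub_subset_Ioo {δ : ℝ} (hδ : 0 < δ) : Icc δ (1 - δ) ⊆ Ioo (0 : ℝ) 1 :=
  fun p hp => ⟨hδ.trans_le hp.1, hp.2.trans_lt (by linarith)⟩

/-- A second order Taylor bound on an interval. -/
lemma abs_sub_taylor_two_le {a b K : ℝ} {f f' f'' f''' : ℝ → ℝ}
    (h1 : ∀ x ∈ Icc a b, HasDerivAt f (f' x) x) (h2 : ∀ x ∈ Icc a b, HasDerivAt f' (f'' x) x)
    (h3 : ∀ x ∈ Icc a b, HasDerivAt f'' (f''' x) x) (hK : ∀ x ∈ Icc a b, |f''' x| ≤ K)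
    {x y : ℝ} (hx : x ∈ Icc a b) (hy : y ∈ Icc a b) :
    |f y - f x - f' x * (y - x) - f'' x / 2 * (y - x) ^ 2| ≤ K * |y - x| ^ 3 := by
  have hsub : uIcc x y ⊆ Icc a b := ordConnected_Icc.uIcc_subset hx hy
  have hconv : Convex ℝ (uIcc x y) := convex_uIcc x y
  have hd : ∀ z ∈ uIcc x y, |z - x| ≤ |y - x| := fun z hz => abs_sub_left_of_mem_uIcc hz
  have hK0 : 0 ≤ K := (abs_nonneg _).trans (hK x hx)
  have e3 : ∀ z ∈ uIcc x y, |f'' z - f'' x| ≤ K * |y - x| := fun z hz =>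
    (hconv.norm_image_sub_le_of_norm_hasDerivWithin_le (f := f'') (f' := f''') (C := K)
      (fun t ht => (h3 t (hsub ht)).hasDerivWithinAt) (fun t ht => hK t (hsub ht))
      left_mem_uIcc hz).trans (mul_le_mul_of_nonneg_left (hd z hz) hK0)
  have e2 : ∀ z ∈ uIcc x y, |f' z - f' x - f'' x * (z - x)| ≤ K * |y - x| * |y - x| := by
    intro z hz
    have := hconv.norm_image_sub_le_of_norm_hasDerivWithin_le
      (f := fun t => f' t - f'' x * (t - x)) (f' := fun t => f'' t - f'' x) (C := K * |y - x|)
      (fun t ht => ((h2 t (hsub ht)).sub (((hasDerivAt_id t).sub_const x).const_mul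
        (f'' x))).hasDerivWithinAt.congr_deriv (by simp)) (fun t ht => e3 t ht)
      left_mem_uIcc hz
    refine le_trans (le_of_eq ?_) (this.trans
      (mul_le_mul_of_nonneg_left (hd z hz) (by positivity)))
    rw [Real.norm_eq_abs]
    congr 1
    ring
  have := hconv.norm_image_sub_le_of_norm_hasDerivWithin_le
      (f := fun t => f t - f' x * (t - x) - f'' x / 2 * (t - x) ^ 2)
      (f' := fun t => f' t - f' x - f'' x * (t - x)) (C := K * |y - x| * |y - x|)
      (fun t ht => (((h1 t (hsub ht)).sub (((hasDerivAt_id t).sub_const x).const_mul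
        (f' x))).sub ((((hasDerivAt_id t).sub_const x).pow 2).const_mul
        (f'' x / 2))).hasDerivWithinAt.congr_deriv (by simp; ring)) (fun t ht => e2 t ht)
      left_mem_uIcc right_mem_uIcc
  refine le_trans (le_of_eq ?_) (this.trans (le_of_eq ?_))
  · rw [Real.norm_eq_abs]
    congr 1
    ring
  · rw [Real.norm_eq_abs]
    ring

lemma exists_excessProfile_taylor {δ : ℝ} (hδ : 0 < δ) :
    ∃ K, 0 ≤ K ∧ ∀ P ∈ Icc δ (1 - δ), ∀ p ∈ Icc δ (1 - δ),
      |excessProfile p - excessProfile P - excessProfileDeriv P * (p - P)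
        - excessProfileDeriv₂ P / 2 * (p - P) ^ 2| ≤ K * |p - P| ^ 3 := by
  have hsub := Icc_sub_subset_Ioo hδ
  have hq := continuousOn_normalQuantile.mono hsub
  have hw : ContinuousOn (fun p => normalPDF (normalQuantile p)) (Icc δ (1 - δ)) :=
    continuous_normalPDF.comp_continuousOn hq
  have hJ := continuousOn_excessProfile.mono hsub
  have hJ' : ContinuousOn excessProfileDeriv (Icc δ (1 - δ)) := fun p hp =>
    (hasDerivAt_excessProfileDeriv (hsub hp)).continuousAt.continuousWithinAt
  have hc : ContinuousOn (fun p => (excessProfileDeriv p * normalPDF (normalQuantile p) ^ 2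
      + 2 * excessProfile p * normalPDF (normalQuantile p) * normalQuantile p)
      / (normalPDF (normalQuantile p) ^ 2) ^ 2) (Icc δ (1 - δ)) := by
    refine ContinuousOn.div ?_ ?_ fun p _ => by have := normalPDF_pos (normalQuantile p); positivity
    · exact (hJ'.mul (hw.pow 2)).add (((continuousOn_const.mul hJ).mul hw).mul hq)
    · exact (hw.pow 2).pow 2
  obtain ⟨K, hK⟩ := isCompact_Icc.exists_bound_of_continuousOn hc
  refine ⟨max K 0, le_max_right _ _, fun P hP p hp => ?_⟩
  exact abs_sub_taylor_two_le (fun x hx => hasDerivAt_excessProfile (hsub hx))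
    (fun x hx => hasDerivAt_excessProfileDeriv (hsub hx))
    (fun x hx => hasDerivAt_excessProfileDeriv₂ (hsub hx))
    (fun x hx => (hK x hx).trans (le_max_left _ _)) hP hp

section Gaussian

variable {E : Type*} [NormedAddCommGroup E] [InnerProductSpace ℝ E]

variable (E) in
/-- The Lebesgue density of the standard Gaussian measure. -/
noncomputable def stdGaussianPDF (x : E) : ℝ :=
  (2 * Real.pi) ^ (-(Module.finrank ℝ E / 2 : ℝ)) * Real.exp (-(1 / 2) * ‖x‖ ^ 2)

lemma stdGaussianPDF_pos (x : E) : 0 < stdGaussianPDF E x := by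
  unfold stdGaussianPDF; positivity

lemma continuous_stdGaussianPDF : Continuous (stdGaussianPDF E) := by
  unfold stdGaussianPDF; fun_prop

lemma abs_exp_sub_one_sub_id_le_sq_mul_exp (y : ℝ) :
    |Real.exp y - 1 - y| ≤ |y| ^ 2 * Real.exp |y| := by
  have := Complex.norm_exp_sub_sum_le_norm_mul_exp (y : ℂ) 2
  simp only [Finset.sum_range_succ, Finset.range_zero, Finset.sum_empty] at this
  rw [Complex.norm_real, Real.norm_eq_abs] at this
  refine le_trans (le_of_eq ?_) this
  rw [← Real.norm_eq_abs, ← Complex.norm_real]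
  push_cast
  congr 1
  simp
  ring

lemma abs_exp_cameronMartin_sub_le {θ w : E} (hθ : ‖θ‖ ≤ 1) :
    |Real.exp (inner ℝ θ w - ‖θ‖ ^ 2 / 2) - 1 - inner ℝ θ w|
      ≤ ‖θ‖ ^ 2 * (3 * ((1 + ‖w‖) ^ 2 * Real.exp ‖w‖)) := by
  set t := ‖θ‖ with ht
  have ht0 : 0 ≤ t := norm_nonneg _
  have hw0 : 0 ≤ ‖w‖ := norm_nonneg _
  set x := inner ℝ θ w with hx
  have hxb : |x| ≤ t * ‖w‖ := abs_real_inner_le_norm θ w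
  set y := x - t ^ 2 / 2 with hy
  have hyb : |y| ≤ t * (‖w‖ + 1 / 2) := by
    calc |y| ≤ |x| + |t ^ 2 / 2| := abs_sub _ _
      _ = |x| + t ^ 2 / 2 := by rw [abs_of_nonneg (by positivity : 0 ≤ t ^ 2 / 2)]
      _ ≤ _ := by nlinarith
  have hyb1 : |y| ≤ ‖w‖ + 1 / 2 := hyb.trans (mul_le_of_le_one_left (by positivity) hθ)
  have hyb2 : |y| ≤ t * (1 + ‖w‖) := hyb.trans (mul_le_mul_of_nonneg_left (by linarith) ht0)
  have hexp : Real.exp |y| ≤ 2 * Real.exp ‖w‖ := by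
    calc Real.exp |y| ≤ Real.exp (‖w‖ + 1 / 2) := Real.exp_le_exp.2 hyb1
      _ = Real.exp (1 / 2) * Real.exp ‖w‖ := by rw [Real.exp_add]; ring
      _ ≤ 2 * Real.exp ‖w‖ := by
        gcongr
        have h4 : Real.exp (1 / 2) ^ 2 = Real.exp 1 := by rw [← Real.exp_nat_mul]; norm_num
        nlinarith [Real.exp_one_lt_d9, Real.exp_pos (1 / 2 : ℝ)]
  have h1 : |Real.exp y - 1 - y| ≤ (t * (1 + ‖w‖)) ^ 2 * (2 * Real.exp ‖w‖) :=
    (abs_exp_sub_one_sub_id_le_sq_mul_exp y).trans (by gcongr)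
  have h2 : 1 ≤ (1 + ‖w‖) ^ 2 * Real.exp ‖w‖ :=
    one_le_mul_of_one_le_of_one_le (one_le_pow₀ (by linarith)) (Real.one_le_exp hw0)
  calc |Real.exp y - 1 - x| = |(Real.exp y - 1 - y) + -(t ^ 2 / 2)| := by rw [hy]; congr 1; ring
    _ ≤ |Real.exp y - 1 - y| + |-(t ^ 2 / 2)| := abs_add_le _ _
    _ = |Real.exp y - 1 - y| + t ^ 2 / 2 := by
        rw [abs_neg, abs_of_nonneg (by positivity : 0 ≤ t ^ 2 / 2)]
    _ ≤ (t * (1 + ‖w‖)) ^ 2 * (2 * Real.exp ‖w‖) + t ^ 2 * ((1 + ‖w‖) ^ 2 * Real.exp ‖w‖) := by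
        gcongr
        nlinarith [sq_nonneg t]
    _ = _ := by ring

variable [FiniteDimensional ℝ E] [MeasurableSpace E] [BorelSpace E]

lemma integrable_exp_neg_mul_sq_norm {b : ℝ} (hb : 0 < b) :
    Integrable (fun x : E => Real.exp (-b * ‖x‖ ^ 2)) := by
  have h := GaussianFourier.integrable_cexp_neg_mul_sq_norm_add (V := E) (b := (b : ℂ))
    (by simpa using hb) 0 0
  refine h.norm.congr (Eventually.of_forall fun x => ?_)
  simp only [Complex.norm_exp]
  congr 1
  simp [← Complex.ofReal_pow]

lemma stdGaussian_eq_withDensity :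
    stdGaussian E = volume.withDensity (fun x => ENNReal.ofReal (stdGaussianPDF E x)) := by
  have hi : Integrable (stdGaussianPDF E) := (integrable_exp_neg_mul_sq_norm one_half_pos).const_mul _
  have : IsFiniteMeasure (volume.withDensity (fun x : E => ENNReal.ofReal (stdGaussianPDF E x))) :=
    isFiniteMeasure_withDensity_ofReal hi.2
  refine Measure.ext_of_charFun ?_
  ext t
  rw [charFun_stdGaussian, charFun_apply, integral_withDensity_eq_integral_toReal_smul
    continuous_stdGaussianPDF.measurable.ennreal_ofReal (Eventually.of_forall fun x => by simp)]
  have h1 : ∀ x : E, (ENNReal.ofReal (stdGaussianPDF E x)).toReal • Complex.exp (inner ℝ x t * Complex.I)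
      = ((2 * Real.pi : ℝ) ^ (-(Module.finrank ℝ E / 2 : ℝ)) : ℝ)
        * Complex.exp (-(1 / 2 : ℂ) * ‖x‖ ^ 2 + Complex.I * inner ℝ t x) := by
    intro x
    rw [ENNReal.toReal_ofReal (stdGaussianPDF_pos x).le, Complex.exp_add, stdGaussianPDF,
      Complex.real_smul]
    push_cast
    rw [real_inner_comm]
    ring_nf
  simp_rw [h1]
  rw [integral_const_mul, GaussianFourier.integral_cexp_neg_mul_sq_norm_add (by norm_num)]
  have h2 : (Real.pi / (1 / 2 : ℂ)) ^ (Module.finrank ℝ E / 2 : ℂ)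
      = (((2 * Real.pi : ℝ) ^ (Module.finrank ℝ E / 2 : ℝ) : ℝ) : ℂ) := by
    rw [Complex.ofReal_cpow (by positivity)]
    push_cast
    congr 1
    ring
  rw [h2, ← mul_assoc, ← Complex.ofReal_mul, ← Real.rpow_add (by positivity)]
  simp
  ring_nf

lemma integral_stdGaussian_eq (g : E → ℝ) :
    ∫ x, g x ∂(stdGaussian E) = ∫ x, stdGaussianPDF E x * g x := by
  rw [stdGaussian_eq_withDensity, integral_withDensity_eq_integral_toReal_smul
    continuous_stdGaussianPDF.measurable.ennreal_ofReal (Eventually.of_forall fun x => by simp)]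
  refine integral_congr_ae (Eventually.of_forall fun x => ?_)
  simp [ENNReal.toReal_ofReal (stdGaussianPDF_pos x).le]

/-- The Cameron-Martin formula for the standard Gaussian measure. -/
lemma integral_add_stdGaussian (h : E → ℝ) (θ : E) :
    ∫ w, h (θ + w) ∂(stdGaussian E)
      = ∫ w, h w * Real.exp (inner ℝ θ w - ‖θ‖ ^ 2 / 2) ∂(stdGaussian E) := by
  rw [integral_stdGaussian_eq, integral_stdGaussian_eq,
    ← integral_add_left_eq_self (μ := volume)
      (fun w => stdGaussianPDF E w * (h w * Real.exp (inner ℝ θ w - ‖θ‖ ^ 2 / 2))) θ]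
  refine integral_congr_ae (Eventually.of_forall fun w => ?_)
  simp only [stdGaussianPDF]
  have : Real.exp (-(1 / 2) * ‖w‖ ^ 2)
      = Real.exp (-(1 / 2) * ‖θ + w‖ ^ 2) * Real.exp (inner ℝ θ (θ + w) - ‖θ‖ ^ 2 / 2) := by
    rw [← Real.exp_add, norm_add_sq_real, inner_add_right, real_inner_self_eq_norm_sq]
    congr 1
    ring
  rw [this]
  ring

lemma integrable_exp_mul_sq_norm_stdGaussian {a : ℝ} (ha : a < 1 / 2) :
    Integrable (fun w : E => Real.exp (a * ‖w‖ ^ 2)) (stdGaussian E) := by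
  rw [stdGaussian_eq_withDensity, integrable_withDensity_iff_integrable_smul'
    continuous_stdGaussianPDF.measurable.ennreal_ofReal (Eventually.of_forall fun x => by simp)]
  refine ((integrable_exp_neg_mul_sq_norm (E := E) (b := 1 / 2 - a) (by linarith)).const_mul
    ((2 * Real.pi) ^ (-(Module.finrank ℝ E / 2 : ℝ)))).congr (Eventually.of_forall fun x => ?_)
  beta_reduce
  rw [ENNReal.toReal_ofReal (stdGaussianPDF_pos x).le, stdGaussianPDF, smul_eq_mul, mul_assoc,
    ← Real.exp_add]
  ring_nf

lemma integrable_one_add_norm_pow_mul_exp_norm (k : ℕ) :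
    Integrable (fun w : E => (1 + ‖w‖) ^ k * Real.exp ‖w‖) (stdGaussian E) := by
  refine Integrable.mono' ((integrable_exp_mul_sq_norm_stdGaussian (E := E) (a := 1 / 4)
    (by norm_num)).const_mul (k.factorial * Real.exp 5)) (by fun_prop)
    (Eventually.of_forall fun w => ?_)
  rw [Real.norm_of_nonneg (by positivity)]
  have h1 := Real.pow_div_factorial_le_exp (1 + ‖w‖) (by positivity) k
  rw [div_le_iff₀ (by positivity)] at h1
  calc (1 + ‖w‖) ^ k * Real.exp ‖w‖
      ≤ (Real.exp (1 + ‖w‖) * k.factorial) * Real.exp ‖w‖ := by gcongr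
    _ = k.factorial * Real.exp (1 + ‖w‖ + ‖w‖) := by rw [Real.exp_add (1 + ‖w‖)]; ring
    _ ≤ k.factorial * Real.exp (5 + 1 / 4 * ‖w‖ ^ 2) := by
        refine mul_le_mul_of_nonneg_left (Real.exp_le_exp.2 ?_) (by positivity)
        nlinarith [sq_nonneg (‖w‖ - 4)]
    _ = _ := by rw [Real.exp_add]; ring

lemma integrable_one_add_norm_pow (k : ℕ) :
    Integrable (fun w : E => (1 + ‖w‖) ^ k) (stdGaussian E) := by
  refine (integrable_one_add_norm_pow_mul_exp_norm k).mono' (by fun_prop)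
    (Eventually.of_forall fun w => ?_)
  rw [Real.norm_of_nonneg (by positivity)]
  exact le_mul_of_one_le_right (by positivity) (Real.one_le_exp (norm_nonneg _))

lemma map_inner_stdGaussian {e : E} (he : ‖e‖ = 1) :
    (stdGaussian E).map (fun w => inner ℝ e w) = gaussianReal 0 1 := by
  have := IsGaussian.map_eq_gaussianReal (μ := stdGaussian E) (innerSL ℝ e)
  rw [integral_strongDual_stdGaussian, variance_dual_stdGaussian, innerSL_apply_norm, he] at this
  simpa using this

lemma integral_inner_sq_stdGaussian (m : E) :
    ∫ w, (inner ℝ m w) ^ 2 ∂(stdGaussian E) = ‖m‖ ^ 2 := by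
  have h := variance_dual_stdGaussian (innerSL ℝ m)
  rw [innerSL_apply_norm, variance_of_integral_eq_zero (by fun_prop)
    (integral_strongDual_stdGaussian _)] at h
  simpa using h

/-- Rotation invariance of the standard Gaussian measure. -/
lemma integral_integral_stdGaussian {a b : ℝ} (hab : a ^ 2 + b ^ 2 = 1) {f : E → ℝ}
    (hf : Integrable f (stdGaussian E)) :
    ∫ z, ∫ w, f (a • z + b • w) ∂(stdGaussian E) ∂(stdGaussian E)
      = ∫ w, f w ∂(stdGaussian E) := by
  have hconv : ((stdGaussian E).map (a • ·)).conv ((stdGaussian E).map (b • ·)) = stdGaussian E := by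
    have i1 := Measure.isProbabilityMeasure_map (μ := stdGaussian E) (f := (a • ·)) (by fun_prop)
    have i2 := Measure.isProbabilityMeasure_map (μ := stdGaussian E) (f := (b • ·)) (by fun_prop)
    refine Measure.ext_of_charFun ?_
    ext t
    rw [charFun_conv, charFun_map_smul, charFun_map_smul, charFun_stdGaussian, charFun_stdGaussian,
      charFun_stdGaussian, ← Complex.exp_add]
    congr 1
    simp only [norm_smul, Real.norm_eq_abs]
    have : (a : ℂ) ^ 2 + b ^ 2 = 1 := by exact_mod_cast hab
    have ha : ((|a| : ℝ) : ℂ) ^ 2 = a ^ 2 := by exact_mod_cast sq_abs a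
    have hb : ((|b| : ℝ) : ℂ) ^ 2 = b ^ 2 := by exact_mod_cast sq_abs b
    push_cast
    rw [mul_pow, mul_pow, ha, hb]
    linear_combination (-(‖t‖ : ℂ) ^ 2 / 2) * this
  have hm : Measurable (fun x : E × E => a • x.1 + b • x.2) := by fun_prop
  have hmap : ((stdGaussian E).prod (stdGaussian E)).map (fun x => a • x.1 + b • x.2)
      = stdGaussian E := by
    refine Eq.trans ?_ hconv
    rw [Measure.conv, Measure.map_prod_map _ _ (by fun_prop) (by fun_prop),
      Measure.map_map (by fun_prop) (by fun_prop)]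
    rfl
  have hf' := hf
  rw [← hmap] at hf'
  rw [integral_integral (f := fun z w => f (a • z + b • w)) (hf'.comp_measurable hm),
    ← integral_map hm.aemeasurable hf'.aestronglyMeasurable, hmap]

lemma measurable_excessProfile : Measurable excessProfile := by
  have h : excessProfile = (Ioo (0 : ℝ) 1).piecewise excessProfile
      (fun _ => normalCDFInt (Classical.arbitrary ℝ)) := by
    funext p
    by_cases hp : p ∈ Ioo (0 : ℝ) 1
    · rw [piecewise_eq_of_mem _ _ _ hp]
    · rw [piecewise_eq_of_notMem _ _ _ hp, excessProfile, normalQuantile, Function.invFun_neg]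
      rintro ⟨u, rfl⟩
      exact hp ⟨normalCDF_pos u, normalCDF_lt_one u⟩
  rw [h]
  exact continuousOn_excessProfile.measurable_piecewise continuousOn_const measurableSet_Ioo

lemma integrable_of_mem_Icc {α : Type*} [MeasurableSpace α] {μ : Measure α} [IsFiniteMeasure μ]
    {h : α → ℝ} {a b : ℝ} (hm : Measurable h) (hh : ∀ x, h x ∈ Icc a b) : Integrable h μ :=
  Integrable.of_mem_Icc a b hm.aemeasurable (Eventually.of_forall hh)

lemma integral_mem_Icc {α : Type*} [MeasurableSpace α] {μ : Measure α} [IsProbabilityMeasure μ]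
    {h : α → ℝ} {a b : ℝ} (hm : Measurable h) (hh : ∀ x, h x ∈ Icc a b) :
    ∫ x, h x ∂μ ∈ Icc a b := by
  have hi : Integrable h μ := integrable_of_mem_Icc hm hh
  constructor
  · simpa using integral_mono (integrable_const a) hi fun x => (hh x).1
  · simpa using integral_mono hi (integrable_const b) fun x => (hh x).2

variable (E) in
/-- The moments of the function `w ↦ 1 + ‖w‖` under the standard Gaussian measure. -/
noncomputable def normMoment (k : ℕ) : ℝ := ∫ w : E, (1 + ‖w‖) ^ k ∂(stdGaussian E)

lemma normMoment_nonneg (k : ℕ) : 0 ≤ normMoment E k :=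
  integral_nonneg fun w => by positivity

lemma integrable_smul_id_stdGaussian {h : E → ℝ} (hm : Measurable h)
    (hh : ∀ x, h x ∈ Icc (0 : ℝ) 1) : Integrable (fun w => h w • w) (stdGaussian E) := by
  refine (integrable_one_add_norm_pow (E := E) 1).mono'
    (hm.smul measurable_id).aestronglyMeasurable (Eventually.of_forall fun w => ?_)
  rw [norm_smul, Real.norm_of_nonneg (hh w).1, pow_one]
  nlinarith [norm_nonneg w, (hh w).2]

lemma norm_integral_smul_id_le {h : E → ℝ} (hh : ∀ x, h x ∈ Icc (0 : ℝ) 1) :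
    ‖∫ w, h w • w ∂(stdGaussian E)‖ ≤ normMoment E 1 := by
  refine norm_integral_le_of_norm_le (integrable_one_add_norm_pow (E := E) 1)
    (Eventually.of_forall fun w => ?_)
  rw [norm_smul, Real.norm_of_nonneg (hh w).1, pow_one]
  nlinarith [norm_nonneg w, (hh w).2]

lemma inner_integral_smul_id {h : E → ℝ} (hm : Measurable h) (hh : ∀ x, h x ∈ Icc (0 : ℝ) 1)
    (e : E) : inner ℝ (∫ w, h w • w ∂(stdGaussian E)) e
      = ∫ w, h w * inner ℝ e w ∂(stdGaussian E) := by
  rw [real_inner_comm, ← integral_inner (integrable_smul_id_stdGaussian hm hh)]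
  simp_rw [inner_smul_right]

lemma integrable_mul_inner {h : E → ℝ} (hm : Measurable h) (hh : ∀ x, h x ∈ Icc (0 : ℝ) 1)
    (e : E) : Integrable (fun w => h w * inner ℝ e w) (stdGaussian E) := by
  have := (integrable_smul_id_stdGaussian hm hh).const_inner (𝕜 := ℝ) e
  simpa only [inner_smul_right] using this

/-- The first Gaussian moment of a `[0, 1]`-valued function is largest for half-spaces. -/
lemma norm_integral_smul_id_le_normalPDF {h : E → ℝ} (hm : Measurable h)
    (hh : ∀ x, h x ∈ Icc (0 : ℝ) 1) (hP : ∫ w, h w ∂(stdGaussian E) ∈ Ioo (0 : ℝ) 1) :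
    ‖∫ w, h w • w ∂(stdGaussian E)‖ ≤ normalPDF (normalQuantile (∫ w, h w ∂(stdGaussian E))) := by
  set m := ∫ w, h w • w ∂(stdGaussian E) with hmdef
  set P := ∫ w, h w ∂(stdGaussian E) with hPdef
  set u := normalQuantile P with hu
  by_cases h0 : m = 0
  · rw [h0, norm_zero]; exact (normalPDF_pos _).le
  have hn : ‖m‖ ≠ 0 := norm_ne_zero_iff.2 h0
  set e : E := -(‖m‖⁻¹ • m) with he
  have he1 : ‖e‖ = 1 := by
    rw [he, norm_neg, norm_smul, norm_inv, norm_norm, inv_mul_cancel₀ hn]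
  have hme : ∫ w, h w * inner ℝ e w ∂(stdGaussian E) = -‖m‖ := by
    rw [← inner_integral_smul_id hm hh, ← hmdef, he, inner_neg_right, inner_smul_right,
      real_inner_self_eq_norm_sq]
    field_simp
  have hih : Integrable h (stdGaussian E) := integrable_of_mem_Icc hm hh
  have hie : Integrable (fun w => inner ℝ e w) (stdGaussian E) := by
    simpa using integrable_mul_inner (h := fun _ => 1) measurable_const (by simp) e
  have h1 : ∫ w, (u * h w - h w * inner ℝ e w) ∂(stdGaussian E) = u * P + ‖m‖ := by
    rw [integral_sub (hih.const_mul u) (integrable_mul_inner hm hh e), integral_const_mul, hme]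
    ring
  have h2 : ∫ w, max (u - inner ℝ e w) 0 ∂(stdGaussian E) = normalCDFInt u := by
    rw [← integral_posPart_gaussianReal, ← map_inner_stdGaussian he1,
      integral_map (by fun_prop) (by fun_prop)]
  have h3 : u * P + ‖m‖ ≤ normalCDFInt u := by
    rw [← h1, ← h2]
    refine integral_mono ((hih.const_mul u).sub (integrable_mul_inner hm hh e))
      ((integrable_const u).sub hie).pos_part fun w => ?_
    have h01 := hh w
    have : u * h w - h w * inner ℝ e w = h w * (u - inner ℝ e w) := by ring
    beta_reduce
    rw [this]
    rcases le_total 0 (u - inner ℝ e w) with hs | hs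
    · exact (mul_le_of_le_one_left hs h01.2).trans (le_max_left _ _)
    · exact (mul_nonpos_of_nonneg_of_nonpos h01.1 hs).trans (le_max_right _ _)
  rw [normalCDFInt, hu, normalCDF_normalQuantile hP, ← hu] at h3
  linarith

variable (E) in
/-- Gaussian averages of `[0, 1]`-valued functions have a uniform second order expansion. -/
lemma exists_abs_integral_add_sub_le : ∃ C, 0 ≤ C ∧ ∀ h : E → ℝ, Measurable h →
    (∀ x, h x ∈ Icc (0 : ℝ) 1) → ∀ θ : E,
      |∫ w, h (θ + w) ∂(stdGaussian E) - ∫ w, h w ∂(stdGaussian E)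
        - inner ℝ (∫ w, h w • w ∂(stdGaussian E)) θ| ≤ C * ‖θ‖ ^ 2 := by
  set C₀ := ∫ w : E, 3 * ((1 + ‖w‖) ^ 2 * Real.exp ‖w‖) ∂(stdGaussian E) with hC0
  have hC0' : 0 ≤ C₀ := integral_nonneg fun w => by positivity
  have hM := normMoment_nonneg (E := E) 1
  refine ⟨C₀ + 1 + normMoment E 1, by positivity, fun h hm hh θ => ?_⟩
  have hih : Integrable h (stdGaussian E) := integrable_of_mem_Icc hm hh
  rcases le_or_gt ‖θ‖ 1 with hθ | hθ
  · have hdom : Integrable (fun w : E => ‖θ‖ ^ 2 * (3 * ((1 + ‖w‖) ^ 2 * Real.exp ‖w‖)))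
        (stdGaussian E) := ((integrable_one_add_norm_pow_mul_exp_norm 2).const_mul 3).const_mul _
    have hie : Integrable (fun w => h w *
        (Real.exp (inner ℝ θ w - ‖θ‖ ^ 2 / 2) - 1 - inner ℝ θ w)) (stdGaussian E) := by
      refine hdom.mono' (by fun_prop) (Eventually.of_forall fun w => ?_)
      rw [norm_mul, Real.norm_of_nonneg (hh w).1]
      exact (mul_le_of_le_one_left (norm_nonneg _) (hh w).2).trans (abs_exp_cameronMartin_sub_le hθ)
    have heq : ∫ w, h (θ + w) ∂(stdGaussian E) - ∫ w, h w ∂(stdGaussian E)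
        - inner ℝ (∫ w, h w • w ∂(stdGaussian E)) θ
        = ∫ w, h w * (Real.exp (inner ℝ θ w - ‖θ‖ ^ 2 / 2) - 1 - inner ℝ θ w)
          ∂(stdGaussian E) := by
      have h1 : ∫ w, h w * Real.exp (inner ℝ θ w - ‖θ‖ ^ 2 / 2) ∂(stdGaussian E)
          = ∫ w, (h w * (Real.exp (inner ℝ θ w - ‖θ‖ ^ 2 / 2) - 1 - inner ℝ θ w) + h w
            + h w * inner ℝ θ w) ∂(stdGaussian E) := by
        congr 1
        funext w
        ring
      have hs : Integrable (fun w => h w * (Real.exp (inner ℝ θ w - ‖θ‖ ^ 2 / 2) - 1 - inner ℝ θ w)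
          + h w) (stdGaussian E) := hie.add hih
      rw [integral_add_stdGaussian, inner_integral_smul_id hm hh, h1,
        integral_add hs (integrable_mul_inner hm hh θ), integral_add hie hih]
      ring
    rw [heq, ← Real.norm_eq_abs]
    calc _ ≤ ∫ w : E, ‖θ‖ ^ 2 * (3 * ((1 + ‖w‖) ^ 2 * Real.exp ‖w‖)) ∂(stdGaussian E) := by
          refine norm_integral_le_of_norm_le hdom (Eventually.of_forall fun w => ?_)
          rw [norm_mul, Real.norm_of_nonneg (hh w).1]
          exact (mul_le_of_le_one_left (norm_nonneg _) (hh w).2).trans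
            (abs_exp_cameronMartin_sub_le hθ)
      _ = C₀ * ‖θ‖ ^ 2 := by rw [integral_const_mul, mul_comm]
      _ ≤ _ := by
        gcongr
        linarith
  · have h1 : ∫ w, h (θ + w) ∂(stdGaussian E) ∈ Icc (0 : ℝ) 1 :=
      integral_mem_Icc (hm.comp (measurable_const_add θ)) fun x => hh _
    have h2 : ∫ w, h w ∂(stdGaussian E) ∈ Icc (0 : ℝ) 1 := integral_mem_Icc hm hh
    have h3 : |inner ℝ (∫ w, h w • w ∂(stdGaussian E)) θ| ≤ normMoment E 1 * ‖θ‖ :=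
      (abs_real_inner_le_norm _ _).trans
        (mul_le_mul_of_nonneg_right (norm_integral_smul_id_le hh) (norm_nonneg _))
    have h4 : normMoment E 1 * ‖θ‖ ≤ normMoment E 1 * ‖θ‖ ^ 2 := by
      gcongr
      nlinarith
    have h5 : 1 ≤ ‖θ‖ ^ 2 := one_le_pow₀ hθ.le
    rw [abs_le] at h3 ⊢
    constructor <;> nlinarith [h1.1, h1.2, h2.1, h2.2]

lemma excessProfileDeriv₂_nonneg (p : ℝ) : 0 ≤ excessProfileDeriv₂ p :=
  div_nonneg (excessProfile_pos p).le (sq_nonneg _)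

lemma exists_excessProfileDeriv_le {δ : ℝ} (hδ : 0 < δ) :
    ∃ L, 0 ≤ L ∧ ∀ p ∈ Icc δ (1 - δ), |excessProfileDeriv p| ≤ L ∧ excessProfileDeriv₂ p ≤ L := by
  have hsub := Icc_sub_subset_Ioo hδ
  have c1 : ContinuousOn excessProfileDeriv (Icc δ (1 - δ)) := fun p hp =>
    (hasDerivAt_excessProfileDeriv (hsub hp)).continuousAt.continuousWithinAt
  have c2 : ContinuousOn excessProfileDeriv₂ (Icc δ (1 - δ)) := fun p hp =>
    (hasDerivAt_excessProfileDeriv₂ (hsub hp)).continuousAt.continuousWithinAt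
  obtain ⟨L₁, hL₁⟩ := isCompact_Icc.exists_bound_of_continuousOn c1
  obtain ⟨L₂, hL₂⟩ := isCompact_Icc.exists_bound_of_continuousOn c2
  refine ⟨max 0 (max L₁ L₂), le_max_left _ _, fun p hp => ⟨?_, ?_⟩⟩
  · exact (hL₁ p hp).trans ((le_max_left _ _).trans (le_max_right _ _))
  · exact (le_abs_self _).trans
      ((hL₂ p hp).trans ((le_max_right _ _).trans (le_max_right _ _)))

lemma measurable_gaussianAverage {h : E → ℝ} (hm : Measurable h) (a b : ℝ) :
    Measurable fun z => ∫ w, h (a • z + b • w) ∂(stdGaussian E) := by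
  have : StronglyMeasurable (Function.uncurry fun z w : E => h (a • z + b • w)) := by
    apply Measurable.stronglyMeasurable
    unfold Function.uncurry
    fun_prop
  exact this.integral_prod_right.measurable

lemma gaussianAverage_mem_Icc {h : E → ℝ} (hm : Measurable h) {c d : ℝ}
    (hh : ∀ x, h x ∈ Icc c d) (a b : ℝ) (z : E) :
    ∫ w, h (a • z + b • w) ∂(stdGaussian E) ∈ Icc c d :=
  integral_mem_Icc (hm.comp (by fun_prop)) fun _ => hh _

lemma sq_le_of_abs_sub_le {D x e b : ℝ} (hDx : |D - x| ≤ e) (hD : |D| ≤ b) (hx : |x| ≤ b) :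
    D ^ 2 ≤ x ^ 2 + 2 * b * e := by
  have h1 : D ^ 2 - x ^ 2 = (D - x) * (D + x) := by ring
  have h2 : |D + x| ≤ 2 * b := (abs_add_le _ _).trans (by linarith)
  have h3 : |(D - x) * (D + x)| ≤ e * (2 * b) := by
    rw [abs_mul]
    exact mul_le_mul hDx h2 (abs_nonneg _) ((abs_nonneg _).trans hDx)
  have := le_abs_self ((D - x) * (D + x))
  linarith

set_option maxHeartbeats 1000000 in
variable (E) in
/-- A small Gaussian smoothing step increases the average of `excessProfile` by a factor
of at most `1 + ε ^ 2 / 2`, up to third order. -/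
lemma exists_integral_excessProfile_le {δ : ℝ} (hδ : 0 < δ) (hδ' : δ < 1 / 2) :
    ∃ C, 0 ≤ C ∧ ∀ h : E → ℝ, Measurable h → (∀ x, h x ∈ Icc δ (1 - δ)) → ∀ ε ∈ Icc (0 : ℝ) 1,
      ∫ z, excessProfile (∫ w, h (ε • z + w) ∂(stdGaussian E)) ∂(stdGaussian E)
        ≤ (1 + ε ^ 2 / 2 + C * ε ^ 3)
          * excessProfile (∫ z, ∫ w, h (ε • z + w) ∂(stdGaussian E) ∂(stdGaussian E)) := by
  obtain ⟨K, hK0, hK⟩ := exists_excessProfile_taylor hδ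
  obtain ⟨L, hL0, hL⟩ := exists_excessProfileDeriv_le hδ
  obtain ⟨C₁, hC0, hC⟩ := exists_abs_integral_add_sub_le E
  set M₁ := normMoment E 1
  set M₂ := normMoment E 2 with hM2
  set M₄ := normMoment E 4 with hM4
  set M₆ := normMoment E 6 with hM6
  have hM1n : 0 ≤ M₁ := normMoment_nonneg 1
  have hM2n : 0 ≤ M₂ := normMoment_nonneg 2
  have hM4n : 0 ≤ M₄ := normMoment_nonneg 4
  have hM6n : 0 ≤ M₆ := normMoment_nonneg 6
  set B := M₁ + C₁ with hB
  have hBn : 0 ≤ B := by positivity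
  set T := L * (C₁ * B * M₄) + K * B ^ 3 * M₆ + K * (C₁ * M₂) ^ 3
    + (L + K) * (C₁ * M₂) with hT
  have hTn : 0 ≤ T := by positivity
  have hJδ := excessProfile_pos δ
  refine ⟨T / excessProfile δ, by positivity, fun h hm hh ε hε => ?_⟩
  obtain ⟨hε0, hε1⟩ := hε
  have hsub := Icc_sub_subset_Ioo hδ
  have hh1 : ∀ x, h x ∈ Icc (0 : ℝ) 1 := fun x => ⟨(hsub (hh x)).1.le, (hsub (hh x)).2.le⟩
  set p : E → ℝ := fun z => ∫ w, h (ε • z + w) ∂(stdGaussian E) with hp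
  have hpm : Measurable p := by simpa using measurable_gaussianAverage hm ε 1
  have hpI : ∀ z, p z ∈ Icc δ (1 - δ) := fun z =>
    integral_mem_Icc (hm.comp (by fun_prop)) fun _ => hh _
  set P₀ := ∫ w, h w ∂(stdGaussian E) with hP0
  have hP0I : P₀ ∈ Icc δ (1 - δ) := integral_mem_Icc hm hh
  set P := ∫ z, p z ∂(stdGaussian E) with hP
  have hPI : P ∈ Icc δ (1 - δ) := integral_mem_Icc hpm hpI
  set m := ∫ w, h w • w ∂(stdGaussian E) with hmd
  have hmM : ‖m‖ ≤ M₁ := norm_integral_smul_id_le hh1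
  have hmφ := norm_integral_smul_id_le_normalPDF hm hh1 (hsub hP0I)
  rw [← hP0, ← hmd] at hmφ
  have hD : ∀ z, |p z - P₀ - ε * inner ℝ m z| ≤ C₁ * ε ^ 2 * (1 + ‖z‖) ^ 2 := fun z => by
    have := hC h hm hh1 (ε • z)
    rw [inner_smul_right, norm_smul, Real.norm_of_nonneg hε0, mul_pow, ← mul_assoc] at this
    refine this.trans ?_
    gcongr
    linarith
  have hmz : ∀ z, |ε * inner ℝ m z| ≤ ε * B * (1 + ‖z‖) ^ 2 := fun z => by
    rw [abs_mul, abs_of_nonneg hε0, mul_assoc]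
    gcongr
    calc |inner ℝ m z| ≤ ‖m‖ * ‖z‖ := abs_real_inner_le_norm m z
      _ ≤ B * (1 + ‖z‖) ^ 2 := by
        gcongr
        · linarith
        · nlinarith [norm_nonneg z]
  have hD2 : ∀ z, |p z - P₀| ≤ ε * B * (1 + ‖z‖) ^ 2 := fun z => by
    have h1 : |ε * inner ℝ m z| ≤ ε * M₁ * (1 + ‖z‖) ^ 2 := by
      rw [abs_mul, abs_of_nonneg hε0, mul_assoc]
      gcongr
      calc |inner ℝ m z| ≤ ‖m‖ * ‖z‖ := abs_real_inner_le_norm m z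
        _ ≤ M₁ * (1 + ‖z‖) ^ 2 := by
          gcongr
          nlinarith [norm_nonneg z]
    have h2 : C₁ * ε ^ 2 * (1 + ‖z‖) ^ 2 ≤ C₁ * ε * (1 + ‖z‖) ^ 2 := by
      gcongr
      nlinarith
    calc |p z - P₀| = |(p z - P₀ - ε * inner ℝ m z) + ε * inner ℝ m z| := by
          congr 1; ring
      _ ≤ _ := abs_add_le _ _
      _ ≤ C₁ * ε ^ 2 * (1 + ‖z‖) ^ 2 + ε * M₁ * (1 + ‖z‖) ^ 2 := add_le_add (hD z) h1
      _ ≤ _ := by rw [hB]; linarith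
  have hi1 : Integrable (fun z => inner ℝ m z) (stdGaussian E) := by
    simpa using integrable_mul_inner (h := fun _ => 1) measurable_const (by simp) m
  have hi2 : Integrable (fun z => (inner ℝ m z) ^ 2) (stdGaussian E) := by
    refine ((integrable_one_add_norm_pow (E := E) 2).const_mul (‖m‖ ^ 2)).mono' (by fun_prop)
      (Eventually.of_forall fun z => ?_)
    rw [Real.norm_of_nonneg (sq_nonneg _), ← sq_abs, ← mul_pow]
    gcongr
    exact (abs_real_inner_le_norm m z).trans (by gcongr; linarith)
  have hip : Integrable p (stdGaussian E) := integrable_of_mem_Icc hpm hpI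
  have hm0 : ∫ z, inner ℝ m z ∂(stdGaussian E) = 0 :=
    integral_strongDual_stdGaussian (innerSL ℝ m)
  have hip' : Integrable (fun z => p z - P₀) (stdGaussian E) := hip.sub (integrable_const _)
  have hPP : |P - P₀| ≤ C₁ * M₂ * ε ^ 2 := by
    have h1 : ∫ z, (p z - P₀ - ε * inner ℝ m z) ∂(stdGaussian E) = P - P₀ := by
      rw [integral_sub hip' (hi1.const_mul ε), integral_sub hip (integrable_const _), integral_const_mul, hm0]
      simp [hP]
    rw [← h1, ← Real.norm_eq_abs]
    calc _ ≤ ∫ z : E, C₁ * ε ^ 2 * (1 + ‖z‖) ^ 2 ∂(stdGaussian E) :=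
          norm_integral_le_of_norm_le ((integrable_one_add_norm_pow 2).const_mul _)
            (Eventually.of_forall hD)
      _ = _ := by rw [integral_const_mul, hM2, normMoment]; ring
  have hPP1 : |P - P₀| ≤ 1 := by
    rw [abs_le]; constructor <;> linarith [hPI.1, hPI.2, hP0I.1, hP0I.2]
  set J₀ := excessProfile P₀
  set J₁ := excessProfileDeriv P₀
  set J₂ := excessProfileDeriv₂ P₀ with hJ2
  have hJ2n : 0 ≤ J₂ := excessProfileDeriv₂_nonneg _
  have hJ2L : J₂ ≤ L := (hL _ hP0I).2
  have hpt : ∀ z, excessProfile (p z) ≤ J₀ + J₁ * (p z - P₀)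
      + J₂ / 2 * (ε ^ 2 * (inner ℝ m z) ^ 2)
      + (J₂ * (C₁ * B) * ε ^ 3) * (1 + ‖z‖) ^ 4 + (K * B ^ 3 * ε ^ 3) * (1 + ‖z‖) ^ 6 := fun z => by
    have h1 := (abs_le.1 (hK P₀ hP0I (p z) (hpI z))).2
    have h2 := sq_le_of_abs_sub_le (hD z) (hD2 z) (hmz z)
    have h3 : |p z - P₀| ^ 3 ≤ (ε * B * (1 + ‖z‖) ^ 2) ^ 3 := by gcongr; exact hD2 z
    have h4 := mul_le_mul_of_nonneg_left h3 hK0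
    have h5 := mul_le_mul_of_nonneg_left h2 (div_nonneg hJ2n zero_le_two)
    nlinarith
  have hbound : ∫ z, excessProfile (p z) ∂(stdGaussian E) ≤ J₀ + J₁ * (P - P₀)
      + J₂ / 2 * (ε ^ 2 * ‖m‖ ^ 2)
      + (J₂ * (C₁ * B) * ε ^ 3) * M₄ + (K * B ^ 3 * ε ^ 3) * M₆ := by
    have hJp : Integrable (fun z => excessProfile (p z)) (stdGaussian E) := by
      refine integrable_of_mem_Icc (a := 0) (b := excessProfile (1 - δ))
        (measurable_excessProfile.comp hpm) fun z => ⟨(excessProfile_pos _).le, ?_⟩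
      exact monotoneOn_excessProfile (hsub (hpI z))
        (hsub (right_mem_Icc.2 (by linarith))) (hpI z).2
    have i1 : Integrable (fun z => J₀ + J₁ * (p z - P₀)) (stdGaussian E) :=
      (integrable_const _).add (hip'.const_mul _)
    have i2 : Integrable (fun z => J₀ + J₁ * (p z - P₀)
        + J₂ / 2 * (ε ^ 2 * (inner ℝ m z) ^ 2)) (stdGaussian E) :=
      i1.add ((hi2.const_mul _).const_mul _)
    have i4 := (integrable_one_add_norm_pow (E := E) 4).const_mul (J₂ * (C₁ * B) * ε ^ 3)
    have i6 := (integrable_one_add_norm_pow (E := E) 6).const_mul (K * B ^ 3 * ε ^ 3)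
    have i3 : Integrable (fun z => J₀ + J₁ * (p z - P₀)
        + J₂ / 2 * (ε ^ 2 * (inner ℝ m z) ^ 2)
        + (J₂ * (C₁ * B) * ε ^ 3) * (1 + ‖z‖) ^ 4) (stdGaussian E) := i2.add i4
    refine (integral_mono hJp (i3.add i6) hpt).trans (le_of_eq ?_)
    refine (integral_add i3 i6).trans ?_
    rw [integral_add i2 i4, integral_add i1 ((hi2.const_mul _).const_mul _),
      integral_add (integrable_const _) (hip'.const_mul _), integral_const_mul, integral_const_mul,
      integral_const_mul, integral_const_mul, integral_const_mul, integral_inner_sq_stdGaussian,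
      integral_sub hip (integrable_const _), hM4, hM6, normMoment, normMoment]
    simp [hP]
  refine hbound.trans ?_
  have hε3 : 0 ≤ ε ^ 3 := by positivity
  have hε23 : ε ^ 4 ≤ ε ^ 3 := pow_le_pow_of_le_one hε0 hε1 (by norm_num)
  have hε63 : ε ^ 6 ≤ ε ^ 3 := pow_le_pow_of_le_one hε0 hε1 (by norm_num)
  have hJm : J₂ * ‖m‖ ^ 2 ≤ J₀ := by
    have hφ := normalPDF_pos (normalQuantile P₀)
    calc J₂ * ‖m‖ ^ 2 ≤ J₂ * normalPDF (normalQuantile P₀) ^ 2 := by gcongr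
      _ = J₀ := by rw [hJ2, excessProfileDeriv₂]; field_simp; rfl
  have hT1 := (abs_le.1 (hK P₀ hP0I P hPI)).1
  have hT2 : 0 ≤ J₂ / 2 * (P - P₀) ^ 2 := by positivity
  have hPP3 : |P - P₀| ^ 3 ≤ (C₁ * M₂) ^ 3 * ε ^ 3 := by
    calc |P - P₀| ^ 3 ≤ (C₁ * M₂ * ε ^ 2) ^ 3 := by gcongr
      _ = (C₁ * M₂) ^ 3 * ε ^ 6 := by ring
      _ ≤ _ := by gcongr
  have hA : J₀ + J₁ * (P - P₀) ≤ excessProfile P + K * ((C₁ * M₂) ^ 3 * ε ^ 3) := by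
    have := mul_le_mul_of_nonneg_left hPP3 hK0
    linarith
  have hB1 : J₀ ≤ excessProfile P + (L + K) * (C₁ * M₂ * ε ^ 2) := by
    have h1 : |P - P₀| ^ 3 ≤ |P - P₀| := pow_le_of_le_one (abs_nonneg _) hPP1 (by norm_num)
    have h2 : |J₁ * (P - P₀)| ≤ L * |P - P₀| := by
      rw [abs_mul]
      exact mul_le_mul_of_nonneg_right (hL _ hP0I).1 (abs_nonneg _)
    have h3 := (abs_le.1 h2).1
    have h4 := mul_le_mul_of_nonneg_left h1 hK0
    have h5 := mul_le_mul_of_nonneg_left hPP (add_nonneg hL0 hK0)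
    linarith
  have hPδ : excessProfile δ ≤ excessProfile P :=
    monotoneOn_excessProfile (hsub (left_mem_Icc.2 (by linarith))) (hsub hPI) hPI.1
  have hTP : T * ε ^ 3 ≤ T / excessProfile δ * ε ^ 3 * excessProfile P := by
    calc T * ε ^ 3 = T / excessProfile δ * ε ^ 3 * excessProfile δ := by field_simp
      _ ≤ _ := by gcongr
  have hQ1 : J₂ * (C₁ * B) * ε ^ 3 * M₄ ≤ L * (C₁ * B * M₄) * ε ^ 3 := by
    calc _ = J₂ * ((C₁ * B) * ε ^ 3 * M₄) := by ring
      _ ≤ L * ((C₁ * B) * ε ^ 3 * M₄) := by gcongr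
      _ = _ := by ring
  have hQ2 : ε ^ 2 * J₀ ≤ ε ^ 2 * excessProfile P + (L + K) * (C₁ * M₂) * ε ^ 3 := by
    calc _ ≤ ε ^ 2 * (excessProfile P + (L + K) * (C₁ * M₂ * ε ^ 2)) := by gcongr
      _ = ε ^ 2 * excessProfile P + (L + K) * (C₁ * M₂) * ε ^ 4 := by ring
      _ ≤ _ := by gcongr
  have hQ3 : J₂ / 2 * (ε ^ 2 * ‖m‖ ^ 2) ≤ ε ^ 2 * J₀ / 2 := by
    calc _ = ε ^ 2 / 2 * (J₂ * ‖m‖ ^ 2) := by ring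
      _ ≤ ε ^ 2 / 2 * J₀ := by gcongr
      _ = _ := by ring
  have hQ4 : 0 ≤ (L + K) * (C₁ * M₂) * ε ^ 3 := by positivity
  rw [hT, add_mul, add_mul, add_mul] at hTP
  linarith

/-- Gaussian smoothing with weights `a` and `b` increases the average of `excessProfile` by a
factor of at most `A`, over all functions with values in `[δ, 1 - δ]`. -/
def SmoothingBound (E : Type*) [NormedAddCommGroup E] [InnerProductSpace ℝ E]
    [FiniteDimensional ℝ E] [MeasurableSpace E] [BorelSpace E] (δ a b A : ℝ) : Prop :=
  ∀ h : E → ℝ, Measurable h → (∀ x, h x ∈ Icc δ (1 - δ)) →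
    ∫ z, excessProfile (∫ w, h (a • z + b • w) ∂(stdGaussian E)) ∂(stdGaussian E)
      ≤ A * excessProfile (∫ w, h w ∂(stdGaussian E))

lemma integrable_excessProfile_gaussianAverage {δ : ℝ} (hδ : 0 < δ) (hδ' : δ < 1 / 2) {h : E → ℝ}
    (hm : Measurable h) (hh : ∀ x, h x ∈ Icc δ (1 - δ)) (a b : ℝ) {μ : Measure E}
    [IsFiniteMeasure μ] :
    Integrable (fun z => excessProfile (∫ w, h (a • z + b • w) ∂(stdGaussian E))) μ := by
  refine integrable_of_mem_Icc (a := 0) (b := excessProfile (1 - δ))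
    (measurable_excessProfile.comp (measurable_gaussianAverage hm a b))
    fun z => ⟨(excessProfile_pos _).le, ?_⟩
  have hz := gaussianAverage_mem_Icc (E := E) hm hh a b z
  exact monotoneOn_excessProfile (Icc_sub_subset_Ioo hδ hz)
    (Icc_sub_subset_Ioo hδ (right_mem_Icc.2 (by linarith))) hz.2

lemma smoothingBound_zero (δ : ℝ) : SmoothingBound E δ 0 1 1 := by
  intro h hm hh
  simp

lemma SmoothingBound.trans {δ a b A a' b' A' c : ℝ} (hδ : 0 < δ) (hδ' : δ < 1 / 2)
    (hA : 0 ≤ A) (hc : c ≠ 0) (hcs : c ^ 2 = a' ^ 2 + (b' * a) ^ 2)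
    (h₁ : SmoothingBound E δ a b A) (h₂ : SmoothingBound E δ a' b' A') :
    SmoothingBound E δ c (b' * b) (A * A') := by
  intro h hm hh
  have hrot : (a' / c) ^ 2 + (b' * a / c) ^ 2 = 1 := by
    field_simp
    linear_combination -hcs
  have hcx : ∀ x z w : E, c • ((a' / c) • x + (b' * a / c) • z) + (b' * b) • w
      = a' • x + b' • (a • z + b • w) := fun x z w => by
    simp only [smul_add, smul_smul]
    rw [mul_div_cancel₀ _ hc, mul_div_cancel₀ _ hc, add_assoc]
  have hx : ∀ x, ∫ z, excessProfile (∫ w, h (a' • x + b' • (a • z + b • w)) ∂(stdGaussian E))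
      ∂(stdGaussian E) ≤ A * excessProfile (∫ w, h (a' • x + b' • w) ∂(stdGaussian E)) :=
    fun x => h₁ (fun v => h (a' • x + b' • v)) (hm.comp (by fun_prop)) fun v => hh _
  rw [← integral_integral_stdGaussian hrot
    (integrable_excessProfile_gaussianAverage hδ hδ' hm hh c (b' * b))]
  simp_rw [hcx]
  calc _ ≤ ∫ x, A * excessProfile (∫ w, h (a' • x + b' • w) ∂(stdGaussian E)) ∂(stdGaussian E) := by
        refine integral_mono_of_nonneg (Eventually.of_forall fun x =>
          integral_nonneg fun z => (excessProfile_pos _).le)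
          ((integrable_excessProfile_gaussianAverage hδ hδ' hm hh a' b').const_mul A)
          (Eventually.of_forall hx)
    _ ≤ A * (A' * excessProfile (∫ w, h w ∂(stdGaussian E))) := by
        rw [integral_const_mul]
        exact mul_le_mul_of_nonneg_left (h₂ h hm hh) hA
    _ = _ := by ring

variable (E) in
lemma exists_smoothingBound {δ : ℝ} (hδ : 0 < δ) (hδ' : δ < 1 / 2) :
    ∃ C, 0 ≤ C ∧ ∀ ε ∈ Ioc (0 : ℝ) 1, ∀ k : ℕ,
      SmoothingBound E δ (√(1 - (1 + ε ^ 2)⁻¹ ^ k)) (√((1 + ε ^ 2)⁻¹ ^ k))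
        ((1 + ε ^ 2 / 2 + C * ε ^ 3) ^ k) := by
  obtain ⟨C, hC0, hC⟩ := exists_integral_excessProfile_le E hδ hδ'
  refine ⟨C, hC0, fun ε hε k => ?_⟩
  have hε0 := hε.1
  set A := 1 + ε ^ 2 / 2 + C * ε ^ 3 with hA
  have hA0 : 0 ≤ A := by positivity
  set r := (1 + ε ^ 2)⁻¹ with hr
  have hr0 : 0 < r := by positivity
  have hr1 : r < 1 := inv_lt_one_of_one_lt₀ (by nlinarith)
  have hrε : r + ε ^ 2 * r = 1 := by rw [hr]; field_simp
  have hsr : √r ^ 2 = r := Real.sq_sqrt hr0.le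
  have hab : (ε * √r) ^ 2 + √r ^ 2 = 1 := by rw [mul_pow, hsr]; linarith
  have hone : SmoothingBound E δ (ε * √r) (√r) A := by
    intro h hm hh
    have h1 := hC (fun v => h (√r • v)) (hm.comp (by fun_prop)) (fun v => hh _) ε ⟨hε0.le, hε.2⟩
    have h2 : ∀ z w : E, √r • (ε • z + w) = (ε * √r) • z + √r • w := fun z w => by
      rw [smul_add, smul_smul, mul_comm]
    simp_rw [h2] at h1
    rwa [integral_integral_stdGaussian hab (integrable_of_mem_Icc hm hh)] at h1
  induction k with
  | zero => simpa using smoothingBound_zero δ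
  | succ k ih =>
    have hk1 : r ^ k ≤ 1 := pow_le_one₀ hr0.le hr1.le
    have hk2 : r ^ (k + 1) < 1 := pow_lt_one₀ hr0.le hr1 (by omega)
    have := SmoothingBound.trans (c := √(1 - r ^ (k + 1))) hδ hδ' hA0
      (Real.sqrt_pos.2 (by linarith)).ne' ?_ hone ih
    · rw [pow_succ' A, pow_succ r, Real.sqrt_mul (by positivity)]
      convert this using 2
      rw [pow_succ]
    · rw [Real.sq_sqrt (by linarith), Real.sq_sqrt (by linarith), mul_pow, mul_pow, hsr,
        Real.sq_sqrt (by positivity), pow_succ]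
      linear_combination (-r ^ k) * hrε

lemma smoothingBound_sqrt {δ τ : ℝ} (hδ : 0 < δ) (hδ' : δ < 1 / 2) (hτ : τ ∈ Ioo (0 : ℝ) 1) :
    SmoothingBound E δ (√(1 - τ)) (√τ) (√τ)⁻¹ := by
  obtain ⟨C, hC0, hC⟩ := exists_smoothingBound E hδ hδ'
  intro h hm hh
  set J := excessProfile (∫ w, h w ∂(stdGaussian E)) with hJ
  have hJ0 : 0 < J := excessProfile_pos _
  set l := -Real.log τ with hl
  have hl0 : 0 < l := neg_pos.2 (Real.log_neg hτ.1 hτ.2)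
  have hτl : Real.exp (-l) = τ := by rw [hl, neg_neg, Real.exp_log hτ.1]
  have hsτ : (√τ)⁻¹ = Real.exp (l / 2) := by
    have h1 : √τ = Real.exp (-l / 2) := by rw [← hτl, Real.exp_half]
    rw [h1, ← Real.exp_neg]
    congr 1
    ring
  have hx : Tendsto (fun k : ℕ => l / k) atTop (𝓝 0) := tendsto_const_div_atTop_nhds_zero_nat l
  have hlim : Tendsto (fun k : ℕ => Real.exp (l / 2 + l * (l / k) / 2 + 2 * C * l * √(2 * (l / k)))
      * J) atTop (𝓝 ((√τ)⁻¹ * J)) := by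
    have hcont : Continuous fun x : ℝ => Real.exp (l / 2 + l * x / 2 + 2 * C * l * √(2 * x)) * J := by
      fun_prop
    have := (hcont.tendsto 0).comp hx
    simpa [hsτ, Function.comp_def] using this
  refine ge_of_tendsto hlim ?_
  filter_upwards [hx.eventually (Iio_mem_nhds (show (0 : ℝ) < 1 / 2 by norm_num)),
    eventually_gt_atTop 0] with k hk hk0
  have hk0' : (0 : ℝ) < k := by exact_mod_cast hk0
  set x := l / k with hxd
  have hkx : k * x = l := by rw [hxd]; field_simp
  have hx0 : 0 < x := by positivity
  have hx2 : x < 1 / 2 := hk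
  set ε := √(Real.exp x - 1) with hε
  have he1 : 0 < Real.exp x - 1 := by linarith [Real.add_one_lt_exp hx0.ne']
  have hε0 : 0 < ε := Real.sqrt_pos.2 he1
  have hε2 : ε ^ 2 = Real.exp x - 1 := Real.sq_sqrt he1.le
  have hbx : Real.exp x - 1 ≤ x + x ^ 2 := by
    have := (abs_le.1 (Real.abs_exp_sub_one_sub_id_le (x := x)
      (by rw [abs_of_pos hx0]; linarith))).2
    linarith
  have hb2 : Real.exp x - 1 ≤ 2 * x := by nlinarith
  have hεs : ε ≤ √(2 * x) := Real.sqrt_le_sqrt hb2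
  have hε1 : ε ≤ 1 := Real.sqrt_le_one.2 (by linarith)
  have hr : (1 + ε ^ 2)⁻¹ ^ k = τ := by
    rw [hε2, add_sub_cancel, ← Real.exp_neg, ← Real.exp_nat_mul, mul_neg, hkx, hτl]
  have h1 := hC ε ⟨hε0, hε1⟩ k h hm hh
  rw [hr] at h1
  refine h1.trans (mul_le_mul_of_nonneg_right ?_ hJ0.le)
  have hε3 : ε ^ 3 ≤ 2 * x * √(2 * x) := by
    rw [pow_succ]
    exact mul_le_mul (hε2.trans_le hb2) hεs hε0.le (by positivity)
  calc (1 + ε ^ 2 / 2 + C * ε ^ 3) ^ k ≤ Real.exp (ε ^ 2 / 2 + C * ε ^ 3) ^ k := by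
        refine pow_le_pow_left₀ (by positivity) ?_ k
        linarith [Real.add_one_le_exp (ε ^ 2 / 2 + C * ε ^ 3)]
    _ = Real.exp (k * (ε ^ 2 / 2 + C * ε ^ 3)) := by rw [Real.exp_nat_mul]
    _ ≤ Real.exp (k * ((x + x ^ 2) / 2 + C * (2 * x * √(2 * x)))) := by
        gcongr
        exact hε2.trans_le hbx
    _ = _ := by
        congr 1
        linear_combination (1 / 2 + x / 2 + 2 * C * √(2 * x)) * hkx

lemma normalQuantile_half : normalQuantile (1 / 2) = 0 := by
  rw [← normalCDF_zero, normalQuantile_normalCDF]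

lemma excessProfile_half : excessProfile (1 / 2) = (√(2 * Real.pi))⁻¹ := by
  rw [excessProfile, normalQuantile_half, normalCDFInt_zero]

lemma le_excessProfile_add {c p : ℝ} (hc : 0 ≤ c) (hp : p ∈ Ioo (0 : ℝ) 1) :
    c ≤ excessProfile p + (1 - p) / normalPDF c := by
  have := le_normalCDFInt_add hc (normalQuantile p)
  rwa [normalCDF_normalQuantile hp] at this

lemma inv_normalPDF (c : ℝ) : (normalPDF c)⁻¹ = √(2 * Real.pi) * Real.exp (c ^ 2 / 2) := by
  rw [normalPDF_eq, mul_inv, inv_inv, ← Real.exp_neg]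
  congr 2
  ring

/-- A lower tail bound for the Gaussian smoothing of a `[0, 1]`-valued function of mean at most `1 / 2`. -/
lemma sqrt_mul_integral_le {χ : E → ℝ} (hχm : Measurable χ) (hχ : ∀ x, χ x ∈ Icc (0 : ℝ) 1)
    (hχi : ∫ x, χ x ∂(stdGaussian E) ≤ 1 / 2) {τ : ℝ} (hτ : τ ∈ Ioo (0 : ℝ) 1)
    {c : E → ℝ} (hcm : Measurable c) {B : ℝ} (hc : ∀ x, c x ∈ Icc 0 B) {M : ℝ}
    (hM : ∀ x, (1 - ∫ w, χ (√(1 - τ) • x + √τ • w) ∂(stdGaussian E)) * Real.exp (c x ^ 2 / 2) ≤ M) :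
    √τ * ∫ x, c x ∂(stdGaussian E) ≤ (√(2 * Real.pi))⁻¹ + √τ * (√(2 * Real.pi) * M) := by
  set s := √(2 * Real.pi) with hs
  have hs0 : 0 ≤ s := Real.sqrt_nonneg _
  have hτ0 : 0 < √τ := Real.sqrt_pos.2 hτ.1
  have hci : Integrable c (stdGaussian E) := integrable_of_mem_Icc hcm hc
  have hχi' : Integrable χ (stdGaussian E) := integrable_of_mem_Icc hχm hχ
  have key : ∀ δ ∈ Ioo (0 : ℝ) (1 / 2), √τ * ∫ x, c x ∂(stdGaussian E)
      ≤ s⁻¹ + √τ * (s * M) + √τ * (s * Real.exp (B ^ 2 / 2)) * δ := by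
    rintro δ ⟨hδ, hδ'⟩
    set h : E → ℝ := fun x => δ + (1 - 2 * δ) * χ x with hh
    have hm : Measurable h := by fun_prop
    have h12 : 0 ≤ 1 - 2 * δ := by linarith
    have hI : ∀ x, h x ∈ Icc δ (1 - δ) := fun x => by
      constructor <;> nlinarith [(hχ x).1, (hχ x).2, mul_nonneg h12 (hχ x).1,
        mul_nonneg h12 (sub_nonneg.2 (hχ x).2)]
    have hsub := Icc_sub_subset_Ioo hδ
    have hP : ∫ x, h x ∂(stdGaussian E) ≤ 1 / 2 := by
      rw [hh, integral_add (integrable_const _) (hχi'.const_mul _), integral_const_mul]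
      simp
      nlinarith
    have hJP : excessProfile (∫ x, h x ∂(stdGaussian E)) ≤ s⁻¹ := by
      rw [hs, ← excessProfile_half]
      exact monotoneOn_excessProfile (hsub (integral_mem_Icc hm hI)) (by norm_num) hP
    have hsm := (smoothingBound_sqrt (E := E) hδ hδ' hτ h hm hI).trans
      (mul_le_mul_of_nonneg_left hJP (inv_nonneg.2 hτ0.le))
    have hpt : ∀ x, c x ≤ excessProfile (∫ w, h (√(1 - τ) • x + √τ • w) ∂(stdGaussian E))
        + (s * M + s * Real.exp (B ^ 2 / 2) * δ) := fun x => by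
      set u := ∫ w, χ (√(1 - τ) • x + √τ • w) ∂(stdGaussian E) with hu
      have hu01 : u ∈ Icc (0 : ℝ) 1 := gaussianAverage_mem_Icc hχm hχ _ _ x
      have hp : ∫ w, h (√(1 - τ) • x + √τ • w) ∂(stdGaussian E) = δ + (1 - 2 * δ) * u := by
        have hi : Integrable (fun w => χ (√(1 - τ) • x + √τ • w)) (stdGaussian E) :=
          integrable_of_mem_Icc (hχm.comp (by fun_prop)) fun _ => hχ _
        rw [hh, integral_add (integrable_const _) (hi.const_mul _), integral_const_mul]
        simp [hu]
      have hpI := gaussianAverage_mem_Icc (E := E) hm hI (√(1 - τ)) (√τ) x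
      refine (le_excessProfile_add (hc x).1 (hsub hpI)).trans ?_
      rw [div_eq_mul_inv, inv_normalPDF, ← hs]
      gcongr
      have h1 : 1 - ∫ w, h (√(1 - τ) • x + √τ • w) ∂(stdGaussian E) ≤ (1 - u) + δ := by
        rw [hp]; nlinarith [hu01.1, hu01.2]
      have h2 : Real.exp (c x ^ 2 / 2) ≤ Real.exp (B ^ 2 / 2) := by
        have := hc x
        gcongr
        · exact this.1
        · exact this.2
      calc _ ≤ ((1 - u) + δ) * (s * Real.exp (c x ^ 2 / 2)) := by gcongr
        _ = s * ((1 - u) * Real.exp (c x ^ 2 / 2)) + s * Real.exp (c x ^ 2 / 2) * δ := by ring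
        _ ≤ _ := by
          gcongr
          exact hM x
    have hbound := integral_mono hci
      ((integrable_excessProfile_gaussianAverage hδ hδ' hm hI (√(1 - τ)) (√τ)).add
        (integrable_const _)) hpt
    rw [integral_add' (integrable_excessProfile_gaussianAverage hδ hδ' hm hI (√(1 - τ)) (√τ))
        (integrable_const _)] at hbound
    simp only [integral_const, probReal_univ, one_smul] at hbound
    have := mul_le_mul_of_nonneg_left (hbound.trans (add_le_add_left hsm _)) hτ0.le
    rw [mul_add, ← mul_assoc, mul_inv_cancel₀ hτ0.ne', one_mul] at this
    linarith
  have hcont : Continuous fun δ : ℝ => s⁻¹ + √τ * (s * M) + √τ * (s * Real.exp (B ^ 2 / 2)) * δ := by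
    fun_prop
  have hlim := (hcont.tendsto 0).mono_left (nhdsWithin_le_nhds (s := Ioi 0))
  rw [mul_zero, add_zero] at hlim
  exact ge_of_tendsto hlim (eventually_of_mem (Ioo_mem_nhdsGT (by norm_num)) key)

/-- A nonnegative `1`-Lipschitz function which vanishes with Gaussian probability at least `1 / 2`
has mean at most that of the positive part of a standard normal variable. -/
lemma integral_le_of_lipschitzWith {H : E → ℝ} (hL : LipschitzWith 1 H) (h0 : ∀ x, 0 ≤ H x)
    (hS : stdGaussian E {x | 0 < H x} ≤ 1 / 2) :
    Integrable H (stdGaussian E) ∧ ∫ x, H x ∂(stdGaussian E) ≤ (√(2 * Real.pi))⁻¹ := by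
  have hLd : ∀ x y, H x ≤ H y + ‖x - y‖ := fun x y => by
    have := hL.dist_le_mul x y
    rw [Real.dist_eq, dist_eq_norm, NNReal.coe_one, one_mul] at this
    linarith [(abs_le.1 this).2]
  have hHc : Continuous H := hL.continuous
  have hHm : Measurable H := hHc.measurable
  have hN1 : Integrable (fun x : E => 1 + ‖x‖) (stdGaussian E) := by
    simpa using integrable_one_add_norm_pow (E := E) 1
  have hN : Integrable (fun x : E => ‖x‖) (stdGaussian E) := by
    refine (hN1.sub (integrable_const 1)).congr (Eventually.of_forall fun x => ?_)
    simp
  have hHi : Integrable H (stdGaussian E) := by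
    refine ((integrable_const (H 0)).add hN).mono' hHm.aestronglyMeasurable
      (Eventually.of_forall fun x => ?_)
    rw [Real.norm_of_nonneg (h0 x)]
    simpa using hLd x 0
  set s := √(2 * Real.pi) with hs
  set m₁ := ∫ x : E, ‖x‖ ∂(stdGaussian E) with hm1
  set χ : E → ℝ := {x | 0 < H x}.indicator 1 with hχd
  have hSm : MeasurableSet {x | 0 < H x} := measurableSet_lt measurable_const hHm
  have hχm : Measurable χ := measurable_one.indicator hSm
  have hχ : ∀ x, χ x ∈ Icc (0 : ℝ) 1 := fun x => by
    by_cases hx : 0 < H x <;> simp [hχd, hx]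
  have hχi : ∫ x, χ x ∂(stdGaussian E) ≤ 1 / 2 := by
    rw [hχd, integral_indicator_one hSm, measureReal_def]
    refine (ENNReal.toReal_mono (by simp) hS).trans (by simp)
  have hmin : ∀ K x, 0 ≤ K → min (H x) K ∈ Icc 0 K := fun K x hK =>
    ⟨le_min (h0 x) hK, min_le_right _ _⟩
  have step : ∀ K, 0 ≤ K → ∀ η ∈ Ioo (0 : ℝ) 1, ∀ τ ∈ Ioo (0 : ℝ) 1,
      η * ∫ x, min (H x) K ∂(stdGaussian E)
        ≤ s⁻¹ + √τ * (s * ∫ w : E, Real.exp (η ^ 2 / 2 * ‖w‖ ^ 2) ∂(stdGaussian E))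
          + η * ((1 - √(1 - τ)) * m₁) := by
    rintro K hK η ⟨hη0, hη1⟩ τ hτ
    have hτ0 : 0 < √τ := Real.sqrt_pos.2 hτ.1
    have hτ1 : √(1 - τ) ≤ 1 := Real.sqrt_le_one.2 (by linarith [hτ.1])
    have hexp := integrable_exp_mul_sq_norm_stdGaussian (E := E) (a := η ^ 2 / 2) (by nlinarith)
    set c : E → ℝ := fun x => η * min (H (√(1 - τ) • x)) K / √τ with hc
    have hcm : Measurable c := by fun_prop
    have hcI : ∀ x, c x ∈ Icc 0 (η * K / √τ) := fun x => by
      have := hmin K (√(1 - τ) • x) hK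
      constructor
      · exact div_nonneg (mul_nonneg hη0.le this.1) hτ0.le
      · exact div_le_div_of_nonneg_right (mul_le_mul_of_nonneg_left this.2 hη0.le) hτ0.le
    have hM : ∀ x, (1 - ∫ w, χ (√(1 - τ) • x + √τ • w) ∂(stdGaussian E))
        * Real.exp (c x ^ 2 / 2) ≤ ∫ w : E, Real.exp (η ^ 2 / 2 * ‖w‖ ^ 2) ∂(stdGaussian E) :=
      fun x => by
      have hi : Integrable (fun w => χ (√(1 - τ) • x + √τ • w)) (stdGaussian E) :=
        integrable_of_mem_Icc (hχm.comp (by fun_prop)) fun _ => hχ _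
      have h1 : 1 - ∫ w, χ (√(1 - τ) • x + √τ • w) ∂(stdGaussian E)
          = ∫ w, (1 - χ (√(1 - τ) • x + √τ • w)) ∂(stdGaussian E) := by
        rw [integral_sub (integrable_const _) hi]; simp
      rw [h1, ← integral_mul_const]
      refine integral_mono (((integrable_const _).sub hi).mul_const _) hexp fun w => ?_
      beta_reduce
      by_cases hw : 0 < H (√(1 - τ) • x + √τ • w)
      · have : χ (√(1 - τ) • x + √τ • w) = 1 := by simp [hχd, hw]
        rw [this, sub_self, zero_mul]
        positivity
      · have : χ (√(1 - τ) • x + √τ • w) = 0 := by simp [hχd, hw]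
        rw [this, sub_zero, one_mul]
        have h2 : H (√(1 - τ) • x) ≤ √τ * ‖w‖ := by
          have h3 := hLd (√(1 - τ) • x) (√(1 - τ) • x + √τ • w)
          rw [sub_add_cancel_left, norm_neg, norm_smul, Real.norm_of_nonneg hτ0.le] at h3
          linarith
        have h4 : c x ≤ η * ‖w‖ := by
          rw [hc]
          beta_reduce
          rw [div_le_iff₀ hτ0]
          calc _ ≤ η * (√τ * ‖w‖) :=
                mul_le_mul_of_nonneg_left ((min_le_left _ _).trans h2) hη0.le
            _ = _ := by ring
        have h5 : c x ^ 2 ≤ (η * ‖w‖) ^ 2 := pow_le_pow_left₀ (hcI x).1 h4 2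
        exact Real.exp_le_exp.2 (by linarith)
    have hmain := sqrt_mul_integral_le hχm hχ hχi hτ hcm hcI hM
    have hci : √τ * ∫ x, c x ∂(stdGaussian E)
        = η * ∫ x, min (H (√(1 - τ) • x)) K ∂(stdGaussian E) := by
      rw [hc, integral_div, integral_const_mul, mul_div_cancel₀ _ hτ0.ne']
    have i1 : Integrable (fun x => min (H (√(1 - τ) • x)) K) (stdGaussian E) :=
      integrable_of_mem_Icc (by fun_prop) fun x => hmin K _ hK
    have i2 : Integrable (fun x => min (H x) K) (stdGaussian E) :=
      integrable_of_mem_Icc (by fun_prop) fun x => hmin K _ hK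
    have hcmp : ∫ x, min (H x) K ∂(stdGaussian E)
        ≤ ∫ x, min (H (√(1 - τ) • x)) K ∂(stdGaussian E) + (1 - √(1 - τ)) * m₁ := by
      rw [hm1, ← integral_const_mul, ← integral_add i1 (hN.const_mul _)]
      refine integral_mono i2 (i1.add (hN.const_mul _)) fun x => ?_
      have h3 := hLd x (√(1 - τ) • x)
      have h4 : x - √(1 - τ) • x = (1 - √(1 - τ)) • x := by rw [sub_smul, one_smul]
      rw [h4, norm_smul, Real.norm_of_nonneg (sub_nonneg.2 hτ1)] at h3
      have h5 : 0 ≤ (1 - √(1 - τ)) * ‖x‖ := mul_nonneg (sub_nonneg.2 hτ1) (norm_nonneg _)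
      beta_reduce
      rw [← min_add_add_right]
      exact le_min ((min_le_left _ _).trans h3) ((min_le_right _ _).trans (by linarith))
    rw [hci] at hmain
    have := mul_le_mul_of_nonneg_left hcmp hη0.le
    linarith
  have step2 : ∀ K, 0 ≤ K → ∀ η ∈ Ioo (0 : ℝ) 1,
      η * ∫ x, min (H x) K ∂(stdGaussian E) ≤ s⁻¹ := by
    intro K hK η hη
    have hcont : Continuous fun τ : ℝ => s⁻¹
        + √τ * (s * ∫ w : E, Real.exp (η ^ 2 / 2 * ‖w‖ ^ 2) ∂(stdGaussian E))
        + η * ((1 - √(1 - τ)) * m₁) := by fun_prop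
    have hlim := (hcont.tendsto 0).mono_left (nhdsWithin_le_nhds (s := Ioi 0))
    simp only [Real.sqrt_zero, zero_mul, add_zero, sub_zero, Real.sqrt_one, sub_self,
      mul_zero] at hlim
    exact ge_of_tendsto hlim (eventually_of_mem (Ioo_mem_nhdsGT one_pos) (step K hK η hη))
  have step3 : ∀ K, 0 ≤ K → ∫ x, min (H x) K ∂(stdGaussian E) ≤ s⁻¹ := by
    intro K hK
    have hcont : Continuous fun η : ℝ => η * ∫ x, min (H x) K ∂(stdGaussian E) := by fun_prop
    have hlim := (hcont.tendsto 1).mono_left (nhdsWithin_le_nhds (s := Iio 1))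
    rw [one_mul] at hlim
    exact le_of_tendsto hlim (eventually_of_mem (Ioo_mem_nhdsLT one_pos) (step2 K hK))
  refine ⟨hHi, ?_⟩
  have hlim : Tendsto (fun k : ℕ => ∫ x, min (H x) k ∂(stdGaussian E)) atTop
      (𝓝 (∫ x, H x ∂(stdGaussian E))) := by
    refine tendsto_integral_of_dominated_convergence H (fun k => by fun_prop) hHi
      (fun k => Eventually.of_forall fun x => ?_) (Eventually.of_forall fun x => ?_)
    · rw [Real.norm_of_nonneg (hmin k x k.cast_nonneg).1]
      exact min_le_left _ _
    · refine tendsto_const_nhds.congr' ?_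
      filter_upwards [eventually_ge_atTop ⌈H x⌉₊] with k hk
      exact (min_eq_left (Nat.ceil_le.1 hk)).symm
  exact le_of_tendsto' hlim fun k => step3 k k.cast_nonneg

end Gaussian

lemma inner_le_of_forall_sq_norm_le {V : Type*} [NormedAddCommGroup V] [InnerProductSpace ℝ V]
    {d w : V} {c : ℝ} (h : ∀ s ∈ Ioo (0 : ℝ) 1, ‖d‖ ^ 2 ≤ ‖d - s • w‖ ^ 2 + 2 * s * c) :
    inner ℝ d w ≤ c := by
  have key : ∀ s ∈ Ioo (0 : ℝ) 1, inner ℝ d w ≤ s * ‖w‖ ^ 2 / 2 + c := by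
    intro s hs
    have h1 := h s hs
    rw [norm_sub_sq_real, inner_smul_right, norm_smul, mul_pow, Real.norm_of_nonneg hs.1.le] at h1
    have h2 : 0 ≤ s * (s * ‖w‖ ^ 2 / 2 + c - inner ℝ d w) := by linarith
    linarith [nonneg_of_mul_nonneg_right h2 hs.1]
  have hcont : Continuous fun s : ℝ => s * ‖w‖ ^ 2 / 2 + c := by fun_prop
  have hlim := (hcont.tendsto 0).mono_left (nhdsWithin_le_nhds (s := Ioi 0))
  rw [zero_mul, zero_div, zero_add] at hlim
  exact ge_of_tendsto hlim (eventually_of_mem (Ioo_mem_nhdsGT one_pos) key)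

lemma norm_sub_le_of_inner_le {V : Type*} [NormedAddCommGroup V] [InnerProductSpace ℝ V]
    {y y' u v : V} {c : ℝ} (h₁ : inner ℝ (y - u) (v - u) ≤ c)
    (h₂ : inner ℝ (y' - v) (u - v) ≤ -c) : ‖u - v‖ ≤ ‖y - y'‖ := by
  have h3 : ‖u - v‖ ^ 2 ≤ inner ℝ (y - y') (u - v) := by
    have e1 : inner ℝ (y - u) (v - u) = -inner ℝ (y - u) (u - v) := by
      rw [← inner_neg_right, neg_sub]
    have e2 : y - y' = (y - u) - (y' - v) + (u - v) := by abel
    rw [e2, inner_add_left, inner_sub_left, real_inner_self_eq_norm_sq]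
    linarith
  have h4 := real_inner_le_norm (y - y') (u - v)
  rcases (norm_nonneg (u - v)).eq_or_lt with h0 | h0
  · rw [← h0]; exact norm_nonneg _
  · exact le_of_mul_le_mul_right (by linarith [sq ‖u - v‖]) h0

lemma scaledNorm_eq_norm_div {n : ℕ} (u : Fin n → ℝ) :
    scaledNorm u = ‖WithLp.toLp 2 u‖ / √n := by
  rw [scaledNorm, EuclideanSpace.norm_eq, Real.sqrt_div' _ n.cast_nonneg]
  simp

lemma scaledNorm_sq_eq {n : ℕ} (u : Fin n → ℝ) :
    scaledNorm u ^ 2 = ‖WithLp.toLp 2 u‖ ^ 2 / n := by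
  rw [scaledNorm_eq_norm_div, div_pow, Real.sq_sqrt n.cast_nonneg]

/-- The fitted values of a penalised least squares estimator are `1`-Lipschitz in the data. -/
lemma norm_mulVec_sub_le {n p : ℕ} (hn : 0 < n) {F : (Fin p → ℝ) → ℝ≥0∞}
    (hFconv : ∀ (a b : Fin p → ℝ) (s : ℝ), 0 ≤ s → s ≤ 1 →
      F (s • a + (1 - s) • b) ≤ ENNReal.ofReal s * F a + ENNReal.ofReal (1 - s) * F b)
    (hFproper : ∃ b, F b ≠ ⊤) {X : Matrix (Fin n) (Fin p) ℝ} {βhat : (Fin n → ℝ) → (Fin p → ℝ)}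
    (hmin : ∀ (y : Fin n → ℝ) (b : Fin p → ℝ),
      ENNReal.ofReal (scaledNorm (y - X.mulVec (βhat y)) ^ 2) + 2 * F (βhat y)
        ≤ ENNReal.ofReal (scaledNorm (y - X.mulVec b) ^ 2) + 2 * F b) (y y' : Fin n → ℝ) :
    ‖WithLp.toLp 2 (X.mulVec (βhat y)) - WithLp.toLp 2 (X.mulVec (βhat y'))‖
      ≤ ‖WithLp.toLp 2 y - WithLp.toLp 2 y'‖ := by
  have hn' : (0 : ℝ) < n := by exact_mod_cast hn
  have hfin : ∀ y, F (βhat y) ≠ ⊤ := fun y => by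
    obtain ⟨b, hb⟩ := hFproper
    intro h
    have := hmin y b
    rw [h, ENNReal.mul_top two_ne_zero, add_top, top_le_iff] at this
    exact ENNReal.add_ne_top.2 ⟨ENNReal.ofReal_ne_top, ENNReal.mul_ne_top (by simp) hb⟩ this
  have key : ∀ y y', inner ℝ (WithLp.toLp 2 y - WithLp.toLp 2 (X.mulVec (βhat y)))
      (WithLp.toLp 2 (X.mulVec (βhat y')) - WithLp.toLp 2 (X.mulVec (βhat y)))
      ≤ n * ((F (βhat y')).toReal - (F (βhat y)).toReal) := by
    intro y y'
    refine inner_le_of_forall_sq_norm_le fun s hs => ?_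
    have hs0 : 0 ≤ s := hs.1.le
    have hs1 : 0 ≤ 1 - s := by linarith [hs.2]
    have h1 := hmin y (s • βhat y' + (1 - s) • βhat y)
    have h2 := hFconv (βhat y') (βhat y) s hs.1.le hs.2.le
    have hA : F (βhat y) = ENNReal.ofReal (F (βhat y)).toReal :=
      (ENNReal.ofReal_toReal (hfin y)).symm
    have hB : F (βhat y') = ENNReal.ofReal (F (βhat y')).toReal :=
      (ENNReal.ofReal_toReal (hfin y')).symm
    set A := (F (βhat y)).toReal with hAd
    set B := (F (βhat y')).toReal with hBd
    have hA0 : 0 ≤ A := ENNReal.toReal_nonneg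
    have hB0 : 0 ≤ B := ENNReal.toReal_nonneg
    have hAB : 0 ≤ s * B + (1 - s) * A := by positivity
    have h3 := h1.trans (add_le_add_right (mul_le_mul_right h2 2) _)
    rw [hA, hB, ← ENNReal.ofReal_mul hs.1.le, ← ENNReal.ofReal_mul hs1,
      ← ENNReal.ofReal_add (by positivity) (by positivity),
      show (2 : ℝ≥0∞) = ENNReal.ofReal 2 by simp, ← ENNReal.ofReal_mul zero_le_two,
      ← ENNReal.ofReal_mul zero_le_two, ← ENNReal.ofReal_add (by positivity) (by positivity),
      ← ENNReal.ofReal_add (by positivity) (by positivity),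
      ENNReal.ofReal_le_ofReal_iff (by positivity), scaledNorm_sq_eq, scaledNorm_sq_eq] at h3
    have h4 : WithLp.toLp 2 (y - X.mulVec (s • βhat y' + (1 - s) • βhat y))
        = WithLp.toLp 2 y - WithLp.toLp 2 (X.mulVec (βhat y))
          - s • (WithLp.toLp 2 (X.mulVec (βhat y')) - WithLp.toLp 2 (X.mulVec (βhat y))) := by
      rw [Matrix.mulVec_add, Matrix.mulVec_smul, Matrix.mulVec_smul, ← WithLp.toLp_sub,
        ← WithLp.toLp_sub, ← WithLp.toLp_smul, ← WithLp.toLp_sub]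
      congr 1
      module
    rw [h4, WithLp.toLp_sub] at h3
    have h5 := mul_le_mul_of_nonneg_left h3 hn'.le
    rw [mul_add, mul_add, mul_div_cancel₀ _ hn'.ne', mul_div_cancel₀ _ hn'.ne'] at h5
    linarith
  refine norm_sub_le_of_inner_le (key y y') ?_
  have := key y' y
  linarith

lemma gaussianVec_eq_map (n : ℕ) (σ : ℝ) :
    gaussianVec n σ = (stdGaussian (EuclideanSpace ℝ (Fin n))).map fun w i => σ * w i := by
  rw [← map_pi_eq_stdGaussian, Measure.map_map (by fun_prop) (by fun_prop), gaussianVec]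
  have h : ∀ _ : Fin n, (gaussianReal 0 1).map (σ * ·) = gaussianReal 0 ⟨σ ^ 2, sq_nonneg σ⟩ :=
    fun _ => by
      rw [gaussianReal_map_const_mul, mul_zero, mul_one]
      rfl
  rw [← funext h]
  exact (Measure.pi_map_pi fun _ => by fun_prop).symm

end GaussianAveraging

theorem stmt5 (n p : ℕ) (hn : 0 < n) (σ : ℝ) (hσ : 0 < σ) (f : Fin n → ℝ)
    (F : (Fin p → ℝ) → ℝ≥0∞)
    -- `F` is convex (with values in `[0,+∞]`)
    (hFconv : ∀ (a b : Fin p → ℝ) (s : ℝ), 0 ≤ s → s ≤ 1 →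
      F (s • a + (1 - s) • b) ≤ ENNReal.ofReal s * F a + ENNReal.ofReal (1 - s) * F b)
    -- `F` is proper: finite at some point
    (hFproper : ∃ b, F b ≠ ⊤)
    (X : Matrix (Fin n) (Fin p) ℝ)
    (βhat : (Fin n → ℝ) → (Fin p → ℝ))
    (hmin : ∀ (y : Fin n → ℝ) (b : Fin p → ℝ),
      ENNReal.ofReal (scaledNorm (y - X.mulVec (βhat y)) ^ 2) + 2 * F (βhat y)
        ≤ ENNReal.ofReal (scaledNorm (y - X.mulVec b) ^ 2) + 2 * F b)
    (R : ℝ) (hR : 0 ≤ R)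
    (hhalf : gaussianVec n σ {ξ | scaledNorm (X.mulVec (βhat (f + ξ)) - f) ≤ R} ≥ 1/2) :
    ∫⁻ ξ, ENNReal.ofReal (scaledNorm (X.mulVec (βhat (f + ξ)) - f)) ∂(gaussianVec n σ)
      ≤ ENNReal.ofReal (R + σ / Real.sqrt (2 * Real.pi * n)) := by
  have hn' : (0 : ℝ) < n := by exact_mod_cast hn
  have hsn : 0 < √(n : ℝ) := Real.sqrt_pos.2 hn'
  set T : EuclideanSpace ℝ (Fin n) → Fin n → ℝ := fun w i => σ * w i with hT
  have hTm : Measurable T := by fun_prop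
  have hTs : ∀ w w', WithLp.toLp 2 (f + T w) - WithLp.toLp 2 (f + T w') = σ • (w - w') := by
    intro w w'
    ext i
    simp [hT]
    ring
  set G : EuclideanSpace ℝ (Fin n) → ℝ := fun w =>
    scaledNorm (X.mulVec (βhat (f + T w)) - f) with hG
  set H : EuclideanSpace ℝ (Fin n) → ℝ := fun w => max (√n / σ * (G w - R)) 0 with hH
  have hGd : ∀ w w', G w - G w' ≤ σ / √n * ‖w - w'‖ := fun w w' => by
    have h1 := norm_mulVec_sub_le hn hFconv hFproper hmin (f + T w) (f + T w')
    rw [hTs, norm_smul, Real.norm_of_nonneg hσ.le] at h1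
    have h2 := norm_sub_norm_le (WithLp.toLp 2 (X.mulVec (βhat (f + T w)) - f))
      (WithLp.toLp 2 (X.mulVec (βhat (f + T w')) - f))
    rw [WithLp.toLp_sub, WithLp.toLp_sub, sub_sub_sub_cancel_right] at h2
    simp only [hG]
    rw [scaledNorm_eq_norm_div, scaledNorm_eq_norm_div, ← sub_div, div_mul_eq_mul_div,
      WithLp.toLp_sub, WithLp.toLp_sub]
    exact div_le_div_of_nonneg_right (h2.trans h1) hsn.le
  have hGL : LipschitzWith 1 fun w => √n / σ * (G w - R) := by
    refine LipschitzWith.of_le_add_mul 1 fun w w' => ?_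
    have := mul_le_mul_of_nonneg_left (hGd w w') (by positivity : 0 ≤ √n / σ)
    have e : √n / σ * (σ / √n * ‖w - w'‖) = ‖w - w'‖ := by field_simp
    rw [e] at this
    rw [NNReal.coe_one, one_mul, dist_eq_norm]
    linarith
  have hHL : LipschitzWith 1 H := hGL.max_const 0
  have hGm : Measurable G := by
    have h1 : G = fun w => σ / √n * (√n / σ * (G w - R)) + R := by
      funext w
      field_simp
      ring
    have h2 := hGL.continuous
    rw [h1]
    exact (h2.measurable.const_mul _).add_const _
  have hpos : ∀ w, 0 < H w ↔ ¬ G w ≤ R := fun w => by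
    have h1 : 0 < √n / σ := by positivity
    simp only [hH, lt_max_iff, lt_irrefl, or_false, not_le]
    rw [mul_pos_iff_of_pos_left h1, sub_pos]
  have hgm : Measurable fun ξ => scaledNorm (X.mulVec (βhat (f + ξ)) - f) := by
    have h1 : (fun ξ => scaledNorm (X.mulVec (βhat (f + ξ)) - f))
        = G ∘ fun ξ : Fin n → ℝ => WithLp.toLp 2 (σ⁻¹ • ξ) := by
      funext ξ
      have h2 : T (WithLp.toLp 2 (σ⁻¹ • ξ)) = ξ := by
        funext i
        simp [hT, hσ.ne']
      simp only [hG, Function.comp, h2]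
    rw [h1]
    exact hGm.comp (by fun_prop)
  rw [gaussianVec_eq_map, ← hT] at hhalf ⊢
  rw [Measure.map_apply hTm (measurableSet_le hgm measurable_const)] at hhalf
  have hS : stdGaussian (EuclideanSpace ℝ (Fin n)) {w | 0 < H w} ≤ 1 / 2 := by
    have h1 : {w | 0 < H w} = {w | G w ≤ R}ᶜ := by
      ext w
      exact hpos w
    rw [h1, prob_compl_eq_one_sub (measurableSet_le hGm measurable_const), one_div,
      ← ENNReal.one_sub_inv_two, ← one_div]
    exact tsub_le_tsub_left hhalf 1
  obtain ⟨hHi, hHint⟩ := integral_le_of_lipschitzWith hHL (fun w => le_max_right _ _) hS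
  have hGH : ∀ w, G w ≤ R + σ / √n * H w := fun w => by
    have h1 : √n / σ * (G w - R) ≤ H w := le_max_left _ _
    have h2 := mul_le_mul_of_nonneg_left h1 (by positivity : 0 ≤ σ / √n)
    have e : σ / √n * (√n / σ * (G w - R)) = G w - R := by field_simp
    linarith
  rw [lintegral_map hgm.ennreal_ofReal hTm]
  calc _ ≤ ∫⁻ w, ENNReal.ofReal (R + σ / √n * H w) ∂(stdGaussian (EuclideanSpace ℝ (Fin n))) :=
        lintegral_mono fun w => ENNReal.ofReal_le_ofReal (hGH w)
    _ = ENNReal.ofReal (∫ w, (R + σ / √n * H w) ∂(stdGaussian (EuclideanSpace ℝ (Fin n)))) := by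
        refine (ofReal_integral_eq_lintegral_ofReal
          ((integrable_const R).add (hHi.const_mul _)) (Filter.Eventually.of_forall fun w => ?_)).symm
        have : 0 ≤ H w := le_max_right _ _
        exact add_nonneg hR (mul_nonneg (by positivity) this)
    _ ≤ _ := by
        refine ENNReal.ofReal_le_ofReal ?_
        rw [integral_add (integrable_const R) (hHi.const_mul _), integral_const_mul]
        have h1 := mul_le_mul_of_nonneg_left hHint (by positivity : 0 ≤ σ / √n)
        have e : σ / √n * (√(2 * Real.pi))⁻¹ = σ / √(2 * Real.pi * n) := by
          rw [Real.sqrt_mul (by positivity : 0 ≤ 2 * Real.pi) (n : ℝ)]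
          field_simp
        rw [e] at h1
        simpa using h1
end
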